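/- For every ε > 0 there exists a constant C = C(q, ε) > 0 such that for every N ∈ ℕ and every x ∈ 𝕋, |Σ_{f ∈ 𝔽_q[t], deg f ≤ N} (Λ'(f) − Λ_{N/4}(f)) · e(fx)| ≤ C · q^{N(3/4 + ε)}. -/

import Mathlib

open Polynomial
open scoped Classical

noncomputable section

variable (p : ℕ) [Fact p.Prime] (Fq : Type) [Field Fq] [Fintype Fq] [Algebra (ZMod p) Fq]

/-- `t` as an element of `K∞ = 𝔽_q((1/t))`; the exponent of the Hahn series variable records
the power of `1/t`, so that `res x = x.coeff 1` and `ord x = -x.order`. -/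
def Kt : LaurentSeries Fq := HahnSeries.single (-1 : ℤ) 1

/-- The Laurent expansion at infinity of a polynomial. -/
def toK (f : Polynomial Fq) : LaurentSeries Fq := Polynomial.aeval (Kt Fq) f

/-- The additive character `e(x) = exp(2πi · tr(res x)/p)` on `K∞`. -/
def eC (x : LaurentSeries Fq) : ℂ :=
  Complex.exp (2 * Real.pi * Complex.I *
    ((Algebra.trace (ZMod p) Fq (x.coeff 1)).val : ℂ) / (p : ℂ))

/-- The norm `⟨x⟩ = q^(ord x)` on `K∞` (with `⟨0⟩ = 0`). -/
def Knorm (x : LaurentSeries Fq) : ℝ :=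
  if x = 0 then 0 else (Fintype.card Fq : ℝ) ^ (-x.order)

/-- The norm `⟨f⟩ = q^(deg f)` of a polynomial (with `⟨0⟩ = 0`). -/
def pnorm (f : Polynomial Fq) : ℝ :=
  if f = 0 then 0 else (Fintype.card Fq : ℝ) ^ f.natDegree

/-- The Euler totient function: the number of units of `𝔽_q[t]/(f)`. -/
def phiP (f : Polynomial Fq) : ℕ := Nat.card ((Polynomial Fq ⧸ Ideal.span {f})ˣ)

/-- The Möbius function on `𝔽_q[t]`: `(-1)^(number of distinct monic irreducible factors)`
for squarefree `f`, and `0` otherwise. -/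
def muP (f : Polynomial Fq) : ℤ :=
  if Squarefree f then
    (-1) ^ {P : Polynomial Fq | P.Monic ∧ Irreducible P ∧ P ∣ f}.ncard
  else 0

/-- The Ramanujan sum `c_s(f) = Σ_{deg a < deg s, gcd(a,s)=1} e(af/s)`. -/
def ramanujanC (s f : Polynomial Fq) : ℂ :=
  ∑ᶠ a ∈ {a : Polynomial Fq | a.degree < s.degree ∧ IsCoprime a s},
    eC p Fq (toK Fq (a * f) / toK Fq s)

/-- The modified von Mangoldt function `Λ'(f) = deg f` if `f` is irreducible, `0` otherwise. -/
def vonMangoldt' (f : Polynomial Fq) : ℝ := if Irreducible f then (f.natDegree : ℝ) else 0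

/-- The truncated Ramanujan expansion `Λ_X(f) = Σ_{g monic squarefree, deg g ≤ X} (μ(g)/φ(g))·c_g(f)`. -/
def LambdaX (X : ℝ) (f : Polynomial Fq) : ℂ :=
  ∑ᶠ g ∈ {g : Polynomial Fq | g.Monic ∧ Squarefree g ∧ (g.natDegree : ℝ) ≤ X},
    ((muP Fq g : ℂ) / (phiP Fq g : ℂ)) * ramanujanC p Fq g f

namespace FFRH

set_option linter.unusedSectionVars false

section Filtration

variable {k : Type*} [Field k] {B : Type*} [CommRing B] [Algebra k B] [Algebra k[X] B]
  [IsScalarTower k k[X] B] {ι : Type*} [Fintype ι] (ω : Module.Basis ι k[X] B)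

/-- The elements whose coordinates with respect to `ω` have degree less than `l`. -/
def degFilt (l : ℕ) : Submodule k B where
  carrier := {x | ∀ i, ω.repr x i ∈ degreeLT k l}
  add_mem' := fun ha hb i => by
    rw [map_add]; exact Submodule.add_mem _ (ha i) (hb i)
  zero_mem' := fun i => by simp
  smul_mem' := fun c x hx i => by
    have : c • x = (C c : k[X]) • x := by
      rw [← algebraMap_smul k[X] c x]; rfl
    rw [this, map_smul, Finsupp.smul_apply, smul_eq_mul, ← smul_eq_C_mul]
    exact Submodule.smul_mem _ _ (hx i)

lemma degFilt_mono {l m : ℕ} (h : l ≤ m) : degFilt ω l ≤ degFilt ω m :=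
  fun _ hx i => degreeLT_mono h (hx i)

/-- The coordinates identify `degFilt ω l` with tuples of polynomials of degree less than `l`. -/
def degFiltEquiv (l : ℕ) : degFilt ω l ≃ₗ[k] (ι → degreeLT k l) where
  toFun x := fun i => ⟨ω.repr x i, x.2 i⟩
  map_add' x y := by ext; simp
  map_smul' c x := by
    funext i
    apply Subtype.ext
    have : c • (x : B) = (C c : k[X]) • (x : B) := by
      rw [← algebraMap_smul k[X] c (x : B)]; rfl
    simp [this, smul_eq_C_mul]
  invFun a := ⟨∑ i, (a i : k[X]) • ω i, fun i => by
    rw [ω.repr_sum_self]; exact (a i).2⟩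
  left_inv x := by
    apply Subtype.ext
    simp [ω.sum_repr]
  right_inv a := by
    funext i
    apply Subtype.ext
    simp only [ω.repr_sum_self]

instance finite_degreeLT (l : ℕ) : Module.Finite k (degreeLT k l) :=
  Module.Finite.equiv (degreeLTEquiv k l).symm

lemma finrank_degreeLT (l : ℕ) : Module.finrank k (degreeLT k l) = l := by
  rw [(degreeLTEquiv k l).finrank_eq]; simp

instance finite_degFilt (l : ℕ) : Module.Finite k (degFilt ω l) :=
  Module.Finite.equiv (degFiltEquiv ω l).symm

lemma finrank_degFilt (l : ℕ) :
    Module.finrank k (degFilt ω l) = l * Fintype.card ι := by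
  rw [(degFiltEquiv ω l).finrank_eq, Module.finrank_pi_fintype]
  simp [finrank_degreeLT, mul_comm]

lemma exists_mem_degFilt (x : B) : ∃ l, x ∈ degFilt ω l := by
  refine ⟨(Finset.univ.sup fun i => (ω.repr x i).natDegree) + 1, fun i => ?_⟩
  rw [mem_degreeLT]
  refine lt_of_le_of_lt degree_le_natDegree ?_
  exact_mod_cast Nat.lt_succ_of_le
    (Finset.le_sup (f := fun i => (ω.repr x i).natDegree) (Finset.mem_univ i))

lemma exists_forall_mem_degFilt {κ : Type*} [Finite κ] (x : κ → B) :
    ∃ l, ∀ j, x j ∈ degFilt ω l := by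
  cases nonempty_fintype κ
  choose f hf using fun j => exists_mem_degFilt ω (x j)
  exact ⟨Finset.univ.sup f, fun j =>
    degFilt_mono ω (Finset.le_sup (Finset.mem_univ j)) (hf j)⟩

lemma mul_mem_degreeLT {l m : ℕ} {a b : k[X]} (ha : a ∈ degreeLT k l) (hb : b ∈ degreeLT k m) :
    a * b ∈ degreeLT k (l + m) := by
  rw [mem_degreeLT] at *
  by_cases h : a = 0
  · subst h; simp
  by_cases h' : b = 0
  · subst h'; simp
  rw [degree_mul, degree_eq_natDegree h, degree_eq_natDegree h'] at *
  norm_cast at *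
  omega

lemma smul_mem_degFilt {l m : ℕ} {a : k[X]} {x : B} (ha : a ∈ degreeLT k l)
    (hx : x ∈ degFilt ω m) : a • x ∈ degFilt ω (l + m) := fun i => by
  rw [map_smul, Finsupp.smul_apply, smul_eq_mul]
  exact mul_mem_degreeLT ha (hx i)

lemma exists_mul_mem_degFilt :
    ∃ c, ∀ l m (x y : B), x ∈ degFilt ω l → y ∈ degFilt ω m → x * y ∈ degFilt ω (l + m + c) := by
  obtain ⟨c, hc⟩ := exists_forall_mem_degFilt ω (fun ij : ι × ι => ω ij.1 * ω ij.2)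
  refine ⟨c, fun l m x y hx hy => ?_⟩
  rw [← ω.sum_repr x, ← ω.sum_repr y, Finset.sum_mul_sum]
  refine Submodule.sum_mem _ fun i _ => Submodule.sum_mem _ fun j _ => ?_
  rw [smul_mul_smul_comm]
  exact smul_mem_degFilt ω (mul_mem_degreeLT (hx i) (hy j)) (hc (i, j))

lemma exists_map_mem_degFilt (γ : B →ₐ[k[X]] B) :
    ∃ c, ∀ l (x : B), x ∈ degFilt ω l → γ x ∈ degFilt ω (l + c) := by
  obtain ⟨c, hc⟩ := exists_forall_mem_degFilt ω (fun i : ι => γ (ω i))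
  refine ⟨c, fun l x hx => ?_⟩
  rw [← ω.sum_repr x, map_sum]
  refine Submodule.sum_mem _ fun i _ => ?_
  rw [map_smul]
  exact smul_mem_degFilt ω (hx i) (hc i)

lemma pow_mem_degFilt {c : ℕ}
    (hc : ∀ l m (x y : B), x ∈ degFilt ω l → y ∈ degFilt ω m → x * y ∈ degFilt ω (l + m + c))
    {l : ℕ} {x : B} (hx : x ∈ degFilt ω l) (n : ℕ) (hn : n ≠ 0) :
    x ^ n ∈ degFilt ω (n * (l + c)) := by
  obtain ⟨n, rfl⟩ := Nat.exists_eq_succ_of_ne_zero hn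
  clear hn
  induction n with
  | zero => simpa using degFilt_mono ω (Nat.le_add_right _ _) hx
  | succ n ih =>
    rw [pow_succ]
    refine degFilt_mono ω ?_ (hc _ _ _ _ ih hx)
    simp only [Nat.succ_eq_add_one]
    ring_nf; omega

variable [IsDomain B]

/-- A linearly independent family modulo the ideal generated by `h` has bounded size. -/
lemma card_le_of_linearIndependent_mkQ {c : ℕ}
    (hc : ∀ l m (x y : B), x ∈ degFilt ω l → y ∈ degFilt ω m → x * y ∈ degFilt ω (l + m + c))
    {s : ℕ} {h : B} (hs : h ∈ degFilt ω s) (h0 : h ≠ 0) {κ : Type*} [Fintype κ] (v : κ → B)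
    (hv : LinearIndependent k
      (fun j => ((Ideal.span {h}).restrictScalars k).mkQ (v j))) :
    Fintype.card κ ≤ (s + c) * Fintype.card ι := by
  obtain ⟨n, hn⟩ := exists_forall_mem_degFilt ω v
  set I := (Ideal.span {h}).restrictScalars k
  let W := degFilt ω (n + s + c)
  let μ : degFilt ω n →ₗ[k] W :=
    ((LinearMap.mulRight k h).comp (degFilt ω n).subtype).codRestrict W
      (fun x => hc _ _ _ _ x.2 hs)
  have hμ : Function.Injective μ := by
    intro x y hxy
    have : (x : B) * h = y * h := congrArg Subtype.val hxy
    exact Subtype.ext (mul_right_cancel₀ h0 this)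
  let p : W →ₗ[k] B ⧸ I := I.mkQ.comp W.subtype
  have hle : LinearMap.range μ ≤ LinearMap.ker p := by
    rintro _ ⟨x, rfl⟩
    rw [LinearMap.mem_ker]
    change I.mkQ ((x : B) * h) = 0
    rw [Submodule.mkQ_apply, Submodule.Quotient.mk_eq_zero]
    exact Ideal.mul_mem_left _ _ (Ideal.mem_span_singleton_self h)
  have h1 := LinearMap.finrank_range_add_finrank_ker p
  have h2 := Submodule.finrank_mono hle
  rw [LinearMap.finrank_range_of_inj hμ, finrank_degFilt] at h2
  rw [finrank_degFilt] at h1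
  have hmem : ∀ j, v j ∈ W := fun j => degFilt_mono ω (by omega) (hn j)
  have h3 : LinearIndependent k (fun j => (⟨p ⟨v j, hmem j⟩, LinearMap.mem_range_self _ _⟩ :
      LinearMap.range p)) := by
    apply LinearIndependent.of_comp (LinearMap.range p).subtype
    exact hv
  have h4 := h3.fintype_card_le_finrank
  have : (n + s + c) * Fintype.card ι = n * Fintype.card ι + (s + c) * Fintype.card ι := by ring
  omega

/-- Distinct `k`-algebra homomorphisms vanishing at `h` are bounded in number. -/
lemma card_zeros_le {c : ℕ}
    (hc : ∀ l m (x y : B), x ∈ degFilt ω l → y ∈ degFilt ω m → x * y ∈ degFilt ω (l + m + c))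
    {s : ℕ} {h : B} (hs : h ∈ degFilt ω s) (h0 : h ≠ 0)
    {Ω : Type*} [Field Ω] [Algebra k Ω] (T : Finset (B →ₐ[k] Ω)) (hT : ∀ θ ∈ T, θ h = 0) :
    T.card ≤ (s + c) * Fintype.card ι := by
  set I := Ideal.span {h}
  let lift : T → ((B ⧸ I) →ₐ[k] Ω) := fun θ => Ideal.Quotient.liftₐ I θ.1 (by
    intro a ha
    obtain ⟨b, rfl⟩ := Ideal.mem_span_singleton'.mp ha
    rw [map_mul, hT _ θ.2, mul_zero])
  have hinj : Function.Injective lift := by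
    intro θ θ' e
    apply Subtype.ext
    ext b
    exact DFunLike.congr_fun e (Ideal.Quotient.mk I b)
  have hli := (linearIndependent_algHom_toLinearMap k (B ⧸ I) Ω).comp lift hinj
  by_contra hlt
  push Not at hlt
  set m := (s + c) * Fintype.card ι
  have hfin : Module.Finite k (B ⧸ I) := by
    by_contra hinf
    have : ∃ v : Fin (m + 1) → (B ⧸ I), LinearIndependent k v := by
      have hrank : Cardinal.aleph0 ≤ Module.rank k (B ⧸ I) := by
        by_contra hr
        exact hinf (Module.rank_lt_aleph0_iff.mp (not_le.mp hr))
      obtain ⟨t, ht, hli'⟩ := le_rank_iff_exists_linearIndependent_finset.mp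
        (le_trans (Cardinal.natCast_lt_aleph0 (n := m + 1)).le hrank)
      exact ⟨_, hli'.comp _ (t.equivFinOfCardEq ht).symm.injective⟩
    obtain ⟨v, hv⟩ := this
    choose w hw using fun j => Ideal.Quotient.mk_surjective (v j)
    have := card_le_of_linearIndependent_mkQ ω hc hs h0 w (by
      have : (fun j => ((Ideal.span {h}).restrictScalars k).mkQ (w j)) = v := by
        funext j; exact hw j
      rw [this]; exact hv)
    simp at this
    omega
  have hdim : Module.finrank k (B ⧸ I) ≤ m := by
    have b := Module.finBasis k (B ⧸ I)
    choose w hw using fun j => Ideal.Quotient.mk_surjective (b j)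
    have := card_le_of_linearIndependent_mkQ ω hc hs h0 w (by
      have : (fun j => ((Ideal.span {h}).restrictScalars k).mkQ (w j)) = b := by
        funext j; exact hw j
      rw [this]; exact b.linearIndependent)
    simpa using this
  have h5 := hli.fintype_card_le_finrank
  rw [Module.finrank_linearMap_self] at h5
  simp only [Fintype.card_coe] at h5
  omega

end Filtration

section Frob

variable (k : Type*) [Field k] [Fintype k]

/-- The `e`-th power of the Frobenius endomorphism over the finite field `k`. -/
def frobPow (A : Type*) [CommRing A] [Algebra k A] (e : ℕ) : A →ₐ[k] A :=
  (FiniteField.frobeniusAlgHom k A) ^ e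

lemma frobPow_apply (A : Type*) [CommRing A] [Algebra k A] (e : ℕ) (a : A) :
    frobPow k A e a = a ^ (Fintype.card k ^ e) := by
  rw [frobPow, AlgHom.coe_pow, FiniteField.coe_frobeniusAlgHom, pow_iterate]

end Frob

section Stepanov

variable {k : Type*} [Field k] {B : Type*} [CommRing B] [Algebra k B] [Algebra k[X] B]
  [IsScalarTower k k[X] B] {ι : Type*} [Fintype ι] (ω : Module.Basis ι k[X] B)
  [IsDomain B] (τ : B →ₐ[k[X]] PowerSeries k) (hτ : Function.Injective τ)

include hτ in
/-- Elements of bounded degree have bounded order at the place given by `τ`. -/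
lemma le_of_X_pow_dvd {c : ℕ}
    (hc : ∀ l m (x y : B), x ∈ degFilt ω l → y ∈ degFilt ω m → x * y ∈ degFilt ω (l + m + c))
    {s : ℕ} {h : B} (hs : h ∈ degFilt ω s) (h0 : h ≠ 0) {n : ℕ}
    (hn : (PowerSeries.X : PowerSeries k) ^ n ∣ τ h) : n ≤ (s + c) * Fintype.card ι := by
  have := card_le_of_linearIndependent_mkQ ω hc hs h0
    (fun j : Fin n => algebraMap k[X] B (X ^ (j : ℕ))) (by
      rw [Fintype.linearIndependent_iff]
      intro g hg
      set P : k[X] := ∑ i, C (g i) * X ^ (i : ℕ) with hP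
      have hmem : algebraMap k[X] B P ∈ Ideal.span {h} := by
        rw [← Ideal.Quotient.eq_zero_iff_mem]
        have h2 : ((Ideal.span {h}).restrictScalars k).mkQ (algebraMap k[X] B P) = 0 := by
          rw [← hg, hP, map_sum, map_sum]
          refine Finset.sum_congr rfl fun i _ => ?_
          rw [← map_smul, map_mul, Algebra.smul_def, IsScalarTower.algebraMap_apply k k[X] B]
          rfl
        exact h2
      obtain ⟨b, hb⟩ := Ideal.mem_span_singleton'.mp hmem
      have hd : (PowerSeries.X : PowerSeries k) ^ n ∣ (P : PowerSeries k) := by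
        have : (P : PowerSeries k) = τ (algebraMap k[X] B P) := by
          rw [AlgHom.commutes]; simp [PowerSeries.algebraMap_apply']
        rw [this, ← hb, map_mul]
        exact hn.mul_left _
      rw [PowerSeries.X_pow_dvd_iff] at hd
      intro i
      have h3 := hd i i.2
      rw [coeff_coe, hP, finsetSum_coeff] at h3
      simpa [coeff_C_mul, coeff_X_pow, Fin.ext_iff, Finset.sum_ite_eq, ← Fin.ext_iff] using h3)
  simpa using this

variable [Fintype k]

include hτ in
/-- Functions of small degree are linearly independent over `q^e`-th powers. -/
lemma eq_zero_of_sum_mul_frobPow {κ : Type*} [Fintype κ] {l e : ℕ}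
    (hord : ∀ x ∈ degFilt ω l, (PowerSeries.X : PowerSeries k) ^ (Fintype.card k ^ e) ∣ τ x → x = 0)
    (f : κ → B) (hf : ∀ i, f i ∈ degFilt ω l) (hli : LinearIndependent k f)
    (g : κ → B) (hg : ∑ i, f i * frobPow k B e (g i) = 0) : ∀ i, g i = 0 := by
  set M := Fintype.card k ^ e with hM
  have step : ∀ H : κ → PowerSeries k, ∑ i, τ (f i) * frobPow k _ e (H i) = 0 →
      ∀ i, PowerSeries.X ∣ H i := by
    intro H hH
    set a : κ → k := fun i => PowerSeries.constantCoeff (H i) with ha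
    have hdec : ∀ i, ∃ K, H i = PowerSeries.C (a i) + PowerSeries.X * K := fun i =>
      ⟨_, (PowerSeries.eq_X_mul_shift_add_const (H i)).trans (add_comm _ _)⟩
    choose K hK using hdec
    have hfr : ∀ i, frobPow k _ e (H i) = PowerSeries.C (a i) + PowerSeries.X ^ M * (K i) ^ M := by
      intro i
      rw [hK i, map_add, map_mul]
      congr 1
      · exact (frobPow k _ e).commutes (a i)
      · rw [frobPow_apply, frobPow_apply]
    have h0 : ∑ i, a i • f i = 0 := by
      apply hord _ (Submodule.sum_mem _ fun i _ => Submodule.smul_mem _ _ (hf i))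
      have : τ (∑ i, a i • f i) = PowerSeries.X ^ M * (- ∑ i, τ (f i) * (K i) ^ M) := by
        have h1 : τ (∑ i, a i • f i) = ∑ i, τ (f i) * PowerSeries.C (a i) := by
          rw [map_sum]
          refine Finset.sum_congr rfl fun i _ => ?_
          rw [← algebraMap_smul k[X] (a i) (f i), map_smul, Algebra.smul_def, mul_comm]
          simp [PowerSeries.algebraMap_apply']
        rw [h1, mul_neg, eq_neg_iff_add_eq_zero, Finset.mul_sum, ← Finset.sum_add_distrib, ← hH]
        refine Finset.sum_congr rfl fun i _ => ?_
        rw [hfr]; ring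
      rw [this]; exact dvd_mul_right _ _
    have h2 := Fintype.linearIndependent_iff.mp hli a h0
    intro i
    rw [PowerSeries.X_dvd_iff]; exact h2 i
  have all : ∀ n, ∃ H : κ → PowerSeries k, (∀ i, τ (g i) = PowerSeries.X ^ n * H i) ∧
      ∑ i, τ (f i) * frobPow k _ e (H i) = 0 := by
    intro n
    induction n with
    | zero =>
      refine ⟨fun i => τ (g i), fun i => by simp, ?_⟩
      have := congrArg τ hg
      rw [map_sum, map_zero] at this
      rw [← this]
      refine Finset.sum_congr rfl fun i _ => ?_
      rw [map_mul, frobPow_apply, frobPow_apply, map_pow]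
    | succ n ih =>
      obtain ⟨H, h1, h2⟩ := ih
      choose H' hH' using step H h2
      refine ⟨H', fun i => by rw [h1, hH', pow_succ, mul_assoc], ?_⟩
      have : PowerSeries.X ^ M * ∑ i, τ (f i) * frobPow k _ e (H' i) = 0 := by
        rw [← h2, Finset.mul_sum]
        refine Finset.sum_congr rfl fun i _ => ?_
        rw [hH' i, map_mul, frobPow_apply k _ e PowerSeries.X]
        ring
      exact (mul_eq_zero.mp this).resolve_left (pow_ne_zero _ PowerSeries.X_ne_zero)
  intro i
  apply hτ
  rw [map_zero]
  ext n
  obtain ⟨H, h1, -⟩ := all (n + 1)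
  have : (PowerSeries.X : PowerSeries k) ^ (n+1) ∣ τ (g i) := h1 i ▸ dvd_mul_right _ _
  rw [PowerSeries.X_pow_dvd_iff] at this
  rw [this n (Nat.lt_succ_self n), map_zero]

include ω hτ in
/-- The upper bound for the number of points with prescribed Frobenius, by Stepanov's method. -/
theorem card_frob_eq_le (γ : B →ₐ[k[X]] B) (Ω : Type*) [Field Ω] [Algebra k Ω] :
    ∃ C e₀ : ℕ, ∀ e ≥ e₀, ∀ T : Finset (B →ₐ[k] Ω),
      (∀ θ ∈ T, ∀ b, θ b ^ (Fintype.card k ^ (2 * e)) = θ (γ b)) →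
      T.card ≤ Fintype.card k ^ (2 * e) + C * Fintype.card k ^ e := by
  obtain ⟨c₁, hc₁⟩ := exists_mul_mem_degFilt ω
  obtain ⟨c₂, hc₂⟩ := exists_map_mem_degFilt ω γ
  set c := max c₁ c₂
  have hc : ∀ l m (x y : B), x ∈ degFilt ω l → y ∈ degFilt ω m → x * y ∈ degFilt ω (l + m + c) :=
    fun l m x y hx hy => degFilt_mono ω (by have := le_max_left c₁ c₂; omega) (hc₁ l m x y hx hy)
  have hγ : ∀ l (x : B), x ∈ degFilt ω l → γ x ∈ degFilt ω (l + c) :=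
    fun l x hx => degFilt_mono ω (by have := le_max_right c₁ c₂; omega) (hc₂ l x hx)
  set D := Fintype.card ι with hD
  have hDpos : 0 < D := by
    rw [hD, Fintype.card_pos_iff]
    by_contra hne
    rw [not_nonempty_iff] at hne
    have : (1 : B) = 0 := by rw [← ω.sum_repr 1]; simp
    exact one_ne_zero this
  set q := Fintype.card k with hq
  have hq2 : 2 ≤ q := Fintype.one_lt_card
  set b := 2 * c + 3 with hb
  set E := D * (c * (c + 1) * D + b + 3 * c + 3) + 1 with hE
  refine ⟨b * D + 1 + 2 * c * D, E, fun e he T hT => ?_⟩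
  set M := q ^ e with hM
  have hME : E ≤ M := le_trans he (Nat.lt_pow_self (by omega)).le
  set L := (M - 1) / D with hL
  have hL1 : L * D ≤ M - 1 := Nat.div_mul_le_self _ _
  have hL2 : M ≤ (L + 1) * D := by
    have := Nat.lt_succ_iff.mp (Nat.lt_succ_of_lt (Nat.lt_div_mul_add (a := M - 1) hDpos))
    rw [← hL] at this
    have h3 := Nat.lt_div_mul_add (a := M - 1) hDpos
    rw [← hL] at h3
    have : (L+1) * D = L * D + D := by ring
    omega
  have hL3 : c * (c + 1) * D + b + 3 * c + 3 ≤ L := by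
    rw [hL, Nat.le_div_iff_mul_le hDpos, mul_comm]
    omega
  obtain ⟨l, hl⟩ : ∃ l, L = l + c := ⟨L - c, by omega⟩
  have hlbig : c * (c + 1) * D + b + 2 * c + 3 ≤ l := by omega
  set m := l + b with hm
  have hord : ∀ x ∈ degFilt ω l,
      (PowerSeries.X : PowerSeries k) ^ (Fintype.card k ^ e) ∣ τ x → x = 0 := by
    intro x hx hd
    by_contra hx0
    have := le_of_X_pow_dvd ω τ hτ hc hx hx0 hd
    rw [← hl] at this
    change M ≤ L * D at this
    have : 1 ≤ M := by omega
    omega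
  let bas := Module.finBasis k (degFilt ω l)
  set d := Module.finrank k (degFilt ω l) with hd
  let f : Fin d → B := fun i => (bas i : B)
  have hfmem : ∀ i, f i ∈ degFilt ω l := fun i => (bas i).2
  have hfli : LinearIndependent k f :=
    bas.linearIndependent.map' (degFilt ω l).subtype (Submodule.ker_subtype _)
  let T1 : (Fin d → degFilt ω m) →ₗ[k] degFilt ω (M * (l + c) + (m + c) + c) :=
    LinearMap.codRestrict _
      (∑ i, (LinearMap.mulLeft k (frobPow k B e (f i))).comp
        (((γ.toLinearMap.restrictScalars k).comp (degFilt ω m).subtype).comp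
          (LinearMap.proj i))) (by
        intro g
        rw [LinearMap.sum_apply]
        refine Submodule.sum_mem _ fun i _ => ?_
        refine hc _ _ _ _ ?_ (hγ _ _ (g i).2)
        rw [frobPow_apply]
        exact pow_mem_degFilt ω hc (hfmem i) _ (by positivity))
  have hT1 : ∀ g, (T1 g : B) = ∑ i, frobPow k B e (f i) * γ (g i) := by
    intro g
    simp [T1, LinearMap.sum_apply]
  have hker : LinearMap.ker T1 ≠ ⊥ := by
    apply LinearMap.ker_ne_bot_of_finrank_lt
    rw [finrank_degFilt, Module.finrank_pi_fintype]
    simp only [finrank_degFilt, Finset.sum_const, Finset.card_univ, Fintype.card_fin, smul_eq_mul]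
    rw [hd, finrank_degFilt, ← hD, ← mul_assoc]
    refine Nat.mul_lt_mul_of_pos_right ?_ hDpos
    have h1 : M * (l + c) ≤ (l + c + 1) * D * (l + c) := by
      rw [hl] at hL2; exact Nat.mul_le_mul_right _ hL2
    have h2 : l * D * m = l * l * D + (2 * c + 1) * (l * D) + 2 * (l * D) := by
      rw [hm, hb]; ring
    have h3 : (l + c + 1) * D * (l + c) = l * l * D + (2 * c + 1) * (l * D) + c * (c + 1) * D := by
      ring
    have h4 : l ≤ l * D := Nat.le_mul_of_pos_right _ hDpos
    omega
  obtain ⟨g, hg, hg0⟩ := (Submodule.ne_bot_iff _).mp hker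
  rw [LinearMap.mem_ker] at hg
  have hg1 : ∑ i, frobPow k B e (f i) * γ (g i) = 0 := by rw [← hT1, hg]; rfl
  set h : B := ∑ i, f i * frobPow k B e (g i) with hh
  have hne : h ≠ 0 := by
    intro h0
    apply hg0
    funext i
    exact Subtype.ext (eq_zero_of_sum_mul_frobPow ω τ hτ hord f hfmem hfli (fun i => g i) h0 i)
  have hhmem : h ∈ degFilt ω (l + M * (m + c) + c) := by
    refine Submodule.sum_mem _ fun i _ => hc _ _ _ _ (hfmem i) ?_
    rw [frobPow_apply]
    exact pow_mem_degFilt ω hc (g i).2 _ (by positivity)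
  have hzero : ∀ θ ∈ T, θ h = 0 := by
    intro θ hθ
    apply pow_eq_zero_iff (n := M) (by positivity) |>.mp
    rw [← map_pow, hM, hq, ← frobPow_apply k B e h, hh, map_sum, map_sum]
    have : ∀ i, θ (frobPow k B e (f i * frobPow k B e (g i))) =
        θ (frobPow k B e (f i) * γ (g i)) := by
      intro i
      rw [map_mul, map_mul, map_mul, ← hT θ hθ, frobPow_apply k B e (frobPow k B e _),
        frobPow_apply k B e (g i : B), ← pow_mul, ← pow_add, ← two_mul, map_pow]
    rw [Finset.sum_congr rfl fun i _ => this i, ← map_sum, hg1, map_zero]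
  have hfin := card_zeros_le ω hc hhmem hne T hzero
  rw [← hD] at hfin
  refine hfin.trans ?_
  have e1 : q ^ (2 * e) = M * M := by rw [hM, two_mul, pow_add]
  rw [e1]
  have h5 : l * D + c * D ≤ M := by
    rw [← add_mul, ← hl]; omega
  have h6 : (l + M * (m + c) + c + c) * D
      = M * (l * D + c * D) + M * (b * D) + (l * D + c * D) + c * D := by rw [hm]; ring
  rw [h6]
  have h7 : M * (l * D + c * D) ≤ M * M := Nat.mul_le_mul_left _ h5
  have h8 : c * D ≤ 2 * c * D * M := by
    calc c * D ≤ 2 * c * D := by rw [mul_assoc]; omega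
      _ ≤ _ := Nat.le_mul_of_pos_right _ (by positivity)
  have h9 : (b * D + 1 + 2 * c * D) * M = M * (b * D) + M + 2 * c * D * M := by ring
  omega

end Stepanov

section FrobMat

variable {k : Type*} [Field k] [Fintype k] {d : Type*} [Fintype d] [DecidableEq d]

/-- The polynomial `∏_{i < n} (1 + x^(q^i) Z)` in the variable `Z`. -/
def normPoly (k : Type*) [Fintype k] {S : Type*} [CommRing S] (x : S) (n : ℕ) : S[X] :=
  ∏ i ∈ Finset.range n, (1 + C (x ^ (Fintype.card k ^ i)) * X)

/-- The scalar extension of a matrix. -/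
abbrev extMat (S : Type*) [CommRing S] [Algebra k S] (U : Matrix d d k) : Matrix d d S :=
  U.map (algebraMap k S)

lemma extMat_map {S S' : Type*} [CommRing S] [Algebra k S] [CommRing S'] [Algebra k S']
    (φ : S →ₐ[k] S') (U : Matrix d d k) : φ.mapMatrix (extMat S U) = extMat S' U := by
  ext i j; simp

lemma mapMatrix_smul {S S' : Type*} [CommRing S] [Algebra k S] [CommRing S'] [Algebra k S']
    (φ : S →ₐ[k] S') (x : S) (V : Matrix d d S) : φ.mapMatrix (x • V) = φ x • φ.mapMatrix V := by
  ext i j; simp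

lemma mapMatrix_aeval {S S' : Type*} [CommRing S] [Algebra k S] [CommRing S'] [Algebra k S']
    (φ : S →ₐ[k] S') (U : Matrix d d k) (P : S[X]) :
    φ.mapMatrix (aeval (extMat S U) P) = aeval (extMat S' U) (P.map (φ : S →+* S')) := by
  induction P using Polynomial.induction_on' with
  | add p q hp hq => simp only [map_add, hp, hq, Polynomial.map_add]
  | monomial n a =>
    rw [aeval_monomial, map_monomial, aeval_monomial, map_mul, map_pow, extMat_map]
    congr 1
    rw [Algebra.algebraMap_eq_smul_one, mapMatrix_smul, map_one, Algebra.algebraMap_eq_smul_one]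
    rfl

variable (U : Matrix d d k)

lemma frobPow_succ_apply {S : Type*} [CommRing S] [Algebra k S] (n : ℕ) (x : S) :
    frobPow k S (n + 1) x = frobPow k S 1 (frobPow k S n x) := by
  rw [frobPow_apply, frobPow_apply, frobPow_apply, pow_one, pow_succ, pow_mul]

/-- A matrix with `F(V) = (1 + xU)V` satisfies `F^n(V) = (∏_{i<n} (1 + x^(q^i) U)) V`. -/
lemma frobPow_mapMatrix {S : Type*} [CommRing S] [Algebra k S] {x : S} {V : Matrix d d S}
    (hV : (frobPow k S 1).mapMatrix V = (1 + x • extMat S U) * V) (n : ℕ) :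
    (frobPow k S n).mapMatrix V = aeval (extMat S U) (normPoly k x n) * V := by
  induction n with
  | zero =>
    ext i j
    simp [normPoly, frobPow_apply]
  | succ n ih =>
    have h1 : (frobPow k S (n + 1)).mapMatrix V =
        (frobPow k S 1).mapMatrix ((frobPow k S n).mapMatrix V) := by
      ext i j
      simp only [AlgHom.mapMatrix_apply, Matrix.map_apply]
      exact frobPow_succ_apply _ _
    have h2 : (normPoly k x n).map (frobPow k S 1 : S →+* S) * (1 + C x * X) =
        normPoly k x (n + 1) := by
      rw [normPoly, normPoly, Finset.prod_range_succ', Polynomial.map_prod]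
      congr 1
      · refine Finset.prod_congr rfl fun i _ => ?_
        simp [frobPow_apply, ← pow_mul, pow_succ, mul_comm]
      · simp
    rw [h1, ih, map_mul, hV, ← mul_assoc, mapMatrix_aeval, ← h2, map_mul]
    congr 2
    simp [Algebra.smul_def]

end FrobMat

section PowerSeriesSolution

variable {k : Type*} [Field k] [Fintype k] {d : Type*} [Fintype d] [DecidableEq d]

lemma coeff_pow_card (f : PowerSeries k) (n : ℕ) :
    PowerSeries.coeff n (f ^ Fintype.card k) =
      if Fintype.card k ∣ n then PowerSeries.coeff (n / Fintype.card k) f else 0 := by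
  have h1 : PowerSeries.coeff n (f ^ Fintype.card k) =
      ((PowerSeries.trunc (n + 1) f) ^ Fintype.card k).coeff n := by
    rw [← coeff_coe, coe_pow, ← PowerSeries.coeff_coe_trunc_of_lt (Nat.lt_succ_self n),
      ← PowerSeries.trunc_trunc_pow, PowerSeries.coeff_coe_trunc_of_lt (Nat.lt_succ_self n)]
  rw [h1, ← FiniteField.expand_card, coeff_expand Fintype.card_pos]
  split_ifs
  · rw [PowerSeries.coeff_trunc, if_pos (Nat.lt_succ_of_le (Nat.div_le_self _ _))]
  · rfl

variable (U : Matrix d d k)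

/-- The matrix coefficients of the power series solution `W` of `W(X^q) = (1 + X U) W(X)`. -/
def solCoeff (U : Matrix d d k) : ℕ → Matrix d d k
  | 0 => 1
  | n + 1 =>
    have : (n + 1) / Fintype.card k < n + 1 := Nat.div_lt_self (Nat.succ_pos n) Fintype.one_lt_card
    (if Fintype.card k ∣ n + 1 then solCoeff U ((n + 1) / Fintype.card k) else 0) -
      U * solCoeff U n

lemma solCoeff_succ (n : ℕ) : solCoeff U (n + 1) = (if Fintype.card k ∣ n + 1 then
      solCoeff U ((n + 1) / Fintype.card k) else 0) - U * solCoeff U n := by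
  rw [solCoeff]

lemma solCoeff_comm (n : ℕ) : U * solCoeff U n = solCoeff U n * U := by
  induction n using Nat.strong_induction_on with
  | _ n ih =>
    cases n with
    | zero => simp [solCoeff]
    | succ n =>
      rw [solCoeff_succ, mul_sub, sub_mul]
      congr 1
      · split_ifs
        · exact ih _ (Nat.div_lt_self (Nat.succ_pos n) Fintype.one_lt_card)
        · simp
      · rw [ih n (Nat.lt_succ_self n), ← mul_assoc, ih n (Nat.lt_succ_self n)]

/-- The power series solution `W` of `W(X^q) = (1 + X U) W(X)` with `W(0) = 1`. -/
def sol : Matrix d d (PowerSeries k) := fun i j => PowerSeries.mk fun n => solCoeff U n i j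

lemma sol_comm : extMat (PowerSeries k) U * sol U = sol U * extMat (PowerSeries k) U := by
  ext i j n
  have := congrFun (congrFun (solCoeff_comm U n) i) j
  simp only [Matrix.mul_apply] at this
  simp only [Matrix.mul_apply, map_sum, extMat, Matrix.map_apply, sol, PowerSeries.algebraMap_apply,
    PowerSeries.coeff_C_mul, PowerSeries.coeff_mul_C, PowerSeries.coeff_mk, Algebra.algebraMap_self,
    RingHom.id_apply]
  exact this

lemma det_sol_ne_zero : (sol U).det ≠ 0 := by
  intro h
  have h1 : (PowerSeries.constantCoeff (R := k)).mapMatrix (sol U) = 1 := by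
    ext i j
    simp only [RingHom.mapMatrix_apply, Matrix.map_apply, sol]
    rw [← PowerSeries.coeff_zero_eq_constantCoeff_apply, PowerSeries.coeff_mk]
    simp [solCoeff]
  have := congrArg (PowerSeries.constantCoeff (R := k)) h
  rw [RingHom.map_det, h1] at this
  simp at this

lemma frobPow_sol : (frobPow k (PowerSeries k) 1).mapMatrix (sol U) =
    (1 + (PowerSeries.X : PowerSeries k) • extMat (PowerSeries k) U) * sol U := by
  ext i j n
  rw [add_mul, one_mul, Matrix.add_apply, map_add, smul_mul_assoc, Matrix.smul_apply]
  simp only [AlgHom.mapMatrix_apply, Matrix.map_apply, frobPow_apply, pow_one, coeff_pow_card,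
    smul_eq_mul]
  have hc : ∀ m, PowerSeries.coeff m (sol U i j) = solCoeff U m i j := fun m => by
    simp [sol]
  rw [hc, hc]
  cases n with
  | zero => simp
  | succ n =>
    have hm : PowerSeries.coeff n ((extMat (PowerSeries k) U * sol U) i j) =
        (U * solCoeff U n) i j := by
      simp [Matrix.mul_apply, sol]
    rw [PowerSeries.coeff_succ_X_mul, hm, solCoeff_succ]
    split_ifs <;> simp

end PowerSeriesSolution

lemma exists_algebraMap_of_pow_card {k : Type*} [Field k] [Fintype k] {S : Type*} [CommRing S]
    [IsDomain S] [Algebra k S] {x : S} (hx : x ^ Fintype.card k = x) :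
    ∃ a : k, algebraMap k S a = x := by
  have h : (X ^ Fintype.card k - X : k[X]) = ∏ a : k, (X - C a) := by
    have h1 := FiniteField.roots_X_pow_card_sub_X k
    have h2 := prod_multiset_X_sub_C_of_monic_of_roots_card_eq (p := (X ^ Fintype.card k - X : k[X]))
      (monic_X_pow_sub (by rw [degree_X]; exact_mod_cast Fintype.one_lt_card))
      (by rw [h1, FiniteField.X_pow_card_sub_X_natDegree_eq k Fintype.one_lt_card]; rfl)
    rw [← h2, h1]; rfl
  have h3 := congrArg (aeval x) h
  rw [map_prod] at h3
  simp only [map_sub, map_pow, aeval_X, aeval_C, hx, sub_self] at h3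
  obtain ⟨a, -, ha⟩ := Finset.prod_eq_zero_iff.mp h3.symm
  exact ⟨a, (sub_eq_zero.mp ha).symm⟩

section Torsor

variable {k : Type*} [Field k] [Fintype k] {d : Type*} [Fintype d] [DecidableEq d]
  {U : Matrix d d k}

lemma extMat_mul {S : Type*} [CommRing S] [Algebra k S] (a b : Matrix d d k) :
    extMat S (a * b) = extMat S a * extMat S b := by
  simp [extMat, Matrix.map_mul]

lemma extMat_one {S : Type*} [CommRing S] [Algebra k S] :
    extMat S (1 : Matrix d d k) = 1 := by
  simp [extMat]

lemma extMat_injective {S : Type*} [CommRing S] [Nontrivial S] [Algebra k S] :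
    Function.Injective (extMat S : Matrix d d k → Matrix d d S) := by
  intro a b h
  ext i j
  exact (algebraMap k S).injective (congrFun (congrFun h i) j)

/-- `det(V)^q = det(1 + xU) det V`. -/
lemma det_pow_card {S : Type*} [CommRing S] [Algebra k S] {x : S} {V : Matrix d d S}
    (hV : (frobPow k S 1).mapMatrix V = (1 + x • extMat S U) * V) :
    V.det ^ Fintype.card k = (1 + x • extMat S U).det * V.det := by
  rw [← Matrix.det_mul, ← hV, ← AlgHom.map_det, frobPow_apply, pow_one]

/-- Two solutions of `F(V) = (1 + xU)V` over a field differ by a matrix over `k`. -/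
lemma exists_eq_mul_extMat {S : Type*} [Field S] [Algebra k S] {x : S} {V V' : Matrix d d S}
    (hV : (frobPow k S 1).mapMatrix V = (1 + x • extMat S U) * V)
    (hV' : (frobPow k S 1).mapMatrix V' = (1 + x • extMat S U) * V')
    (hdet : V.det ≠ 0) : ∃ b : Matrix d d k, V' = V * extMat S b := by
  have hu : IsUnit V.det := isUnit_iff_ne_zero.mpr hdet
  have hx : IsUnit (1 + x • extMat S U).det := by
    rw [isUnit_iff_ne_zero]
    intro h
    have := det_pow_card hV
    rw [h, zero_mul] at this
    exact hdet (pow_eq_zero_iff Fintype.card_ne_zero |>.mp this)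
  set c := V⁻¹ * V' with hc
  have hVc : V * c = V' := Matrix.mul_nonsing_inv_cancel_left _ _ hu
  have h1 : (frobPow k S 1).mapMatrix c = c := by
    have := congrArg (frobPow k S 1).mapMatrix hVc
    rw [map_mul, hV, hV', ← hVc, mul_assoc] at this
    have h2 := congrArg (fun M => (1 + x • extMat S U)⁻¹ * M) this
    simp only [Matrix.nonsing_inv_mul_cancel_left _ _ hx] at h2
    have h3 := congrArg (fun M => V⁻¹ * M) h2
    simpa only [Matrix.nonsing_inv_mul_cancel_left _ _ hu] using h3
  have h2 : ∀ i j, ∃ a : k, algebraMap k S a = c i j := by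
    intro i j
    apply exists_algebraMap_of_pow_card
    have := congrFun (congrFun h1 i) j
    simpa [frobPow_apply] using this
  choose b hb using h2
  refine ⟨b, ?_⟩
  have : extMat S (Matrix.of b) = c := by ext i j; exact hb i j
  rw [← hVc]; exact congrArg _ this.symm

end Torsor

section Fields

variable {k : Type*} [Field k] [Fintype k] {d : Type*} [Fintype d] [DecidableEq d]
  (U : Matrix d d k) {A : Type*} [CommRing A] [IsDomain A] [Algebra k A] [IsIntegrallyClosed A]
  {B : Type*} [CommRing B] [IsDomain B] [Algebra k B] [Algebra A B] [IsScalarTower k A B]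
  (F K : Type*) [Field F] [Algebra A F] [IsFractionRing A F] [Field K] [Algebra B K]
  [IsFractionRing B K] [Algebra A K] [IsScalarTower A B K] [Algebra F K] [IsScalarTower A F K]
  [Algebra k F] [IsScalarTower k A F] [Algebra k K] [IsScalarTower k B K] [IsScalarTower k F K]
  (W : Matrix d d B) (x : A)
  (hgen : Algebra.adjoin A (Set.range fun ij : d × d => W ij.1 ij.2) = ⊤)
  (hF : (frobPow k B 1).mapMatrix W = (1 + algebraMap A B x • extMat B U) * W)
  (hdet : W.det ≠ 0)

include hgen in
lemma intermediateField_eq_top (E : IntermediateField F K)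
    (hE : ∀ i j, algebraMap B K (W i j) ∈ E) : E = ⊤ := by
  have hB : ∀ b : B, algebraMap B K b ∈ E := by
    intro b
    have hb : b ∈ Algebra.adjoin A (Set.range fun ij : d × d => W ij.1 ij.2) := by
      rw [hgen]; trivial
    induction hb using Algebra.adjoin_induction with
    | mem x hx => obtain ⟨ij, rfl⟩ := hx; exact hE _ _
    | algebraMap r =>
      rw [← IsScalarTower.algebraMap_apply A B K, IsScalarTower.algebraMap_apply A F K]
      exact E.algebraMap_mem _
    | add x y _ _ hx hy => rw [map_add]; exact E.add_mem hx hy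
    | mul x y _ _ hx hy => rw [map_mul]; exact E.mul_mem hx hy
  rw [eq_top_iff]
  intro y _
  obtain ⟨a, b, -, rfl⟩ := IsFractionRing.div_surjective (A := B) y
  exact E.div_mem (hB a) (hB b)

include hF in
lemma frobPow_map_solution {S : Type*} [CommRing S] [Algebra k S] (φ : B →ₐ[k] S) :
    (frobPow k S 1).mapMatrix (φ.mapMatrix W) =
      (1 + φ (algebraMap A B x) • extMat S U) * φ.mapMatrix W := by
  have h := congrArg φ.mapMatrix hF
  rw [map_mul, map_add, map_one, mapMatrix_smul, extMat_map] at h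
  rw [← h]
  ext i j
  simp [frobPow_apply]

include hgen in
lemma finiteDimensional_of_generated [Algebra.IsIntegral A B] : FiniteDimensional F K := by
  have h1 : FiniteDimensional F (IntermediateField.adjoin F
      (Set.range fun ij : d × d => algebraMap B K (W ij.1 ij.2))) := by
    apply IntermediateField.finiteDimensional_adjoin
    rintro _ ⟨ij, rfl⟩
    have : IsIntegral A (algebraMap B K (W ij.1 ij.2)) :=
      (Algebra.IsIntegral.isIntegral (R := A) (W ij.1 ij.2)).algebraMap
    exact this.tower_top
  rw [intermediateField_eq_top F K W hgen _ fun i j =>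
    IntermediateField.subset_adjoin F _ (Set.mem_range_self (i, j))] at h1
  exact Module.Finite.equiv (IntermediateField.topEquiv (F := F) (E := K)).toLinearEquiv

include hgen hF hdet in
lemma isSeparable_of_solution [Algebra.IsIntegral A B] : Algebra.IsSeparable F K := by
  have := finiteDimensional_of_generated F K W hgen
  rw [← separableClosure.eq_top_iff]
  apply intermediateField_eq_top F K W hgen
  set E := separableClosure F K with hE
  obtain ⟨p, hp⟩ := CharP.exists k
  obtain ⟨m, hp', hm⟩ := FiniteField.card k p
  have : Fact p.Prime := ⟨hp'⟩
  have : CharP E p := charP_of_injective_algebraMap (algebraMap k E).injective p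
  have : ExpChar E p := ExpChar.prime hp'
  have hpow : ∀ ij : d × d, ∃ n : ℕ, algebraMap B K (W ij.1 ij.2) ^ p ^ n ∈ E := by
    intro ij
    obtain ⟨n, y, hy⟩ := IsPurelyInseparable.pow_mem E p (algebraMap B K (W ij.1 ij.2))
    exact ⟨n, hy ▸ y.2⟩
  choose n hn using hpow
  set N := Finset.univ.sup n with hN
  set V := (IsScalarTower.toAlgHom k B K).mapMatrix W with hV
  have hFr := frobPow_map_solution U W x hF (IsScalarTower.toAlgHom k B K)
  have hVE : ∀ i j, (frobPow k K N).mapMatrix V i j ∈ E := by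
    intro i j
    have hle : n (i, j) ≤ m * N :=
      (Finset.le_sup (Finset.mem_univ _)).trans (Nat.le_mul_of_pos_left _ m.pos)
    have hexp : Fintype.card k ^ N = p ^ n (i, j) * p ^ (m * N - n (i, j)) := by
      rw [hm, ← pow_mul, ← pow_add, Nat.add_sub_cancel' hle]
    have h1 : (frobPow k K N).mapMatrix V i j =
        (algebraMap B K (W i j) ^ p ^ n (i, j)) ^ p ^ (m * N - n (i, j)) := by
      rw [← pow_mul, ← hexp, ← frobPow_apply]
      rfl
    rw [h1]
    exact pow_mem (hn (i, j)) (p ^ (m * N - n (i, j)))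
  have hy := frobPow_mapMatrix U hFr N
  set Y : Matrix d d F := aeval (extMat F U) (normPoly k (algebraMap A F x) N)
  have hxK : (IsScalarTower.toAlgHom k B K) (algebraMap A B x) =
      (IsScalarTower.toAlgHom k F K) (algebraMap A F x) := by
    simp only [IsScalarTower.coe_toAlgHom']
    rw [← IsScalarTower.algebraMap_apply, ← IsScalarTower.algebraMap_apply]
  have hYK : aeval (extMat K U) (normPoly k ((IsScalarTower.toAlgHom k B K) (algebraMap A B x)) N) =
      (IsScalarTower.toAlgHom k F K).mapMatrix Y := by
    rw [mapMatrix_aeval, hxK]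
    congr 1
    simp [normPoly, Polynomial.map_prod]
  rw [hYK] at hy
  have hdV : V.det ≠ 0 := by
    rw [hV, ← AlgHom.map_det]
    simpa using hdet
  have hdY : algebraMap F K Y.det ≠ 0 := by
    intro h0
    have h1 := congrArg Matrix.det hy
    have h2 : ((IsScalarTower.toAlgHom k F K).mapMatrix Y).det = 0 := by
      rw [← AlgHom.map_det]; exact h0
    rw [Matrix.det_mul, h2, zero_mul, ← AlgHom.map_det, frobPow_apply] at h1
    exact hdV (pow_eq_zero_iff (by positivity) |>.mp h1)
  have hadj : algebraMap F K Y.det • V =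
      (algebraMap F K).mapMatrix Y.adjugate * (frobPow k K N).mapMatrix V := by
    rw [hy, ← mul_assoc]
    have : (algebraMap F K).mapMatrix Y.adjugate * (IsScalarTower.toAlgHom k F K).mapMatrix Y =
        algebraMap F K Y.det • 1 := by
      have h2 := congrArg (algebraMap F K).mapMatrix (Matrix.adjugate_mul Y)
      rw [map_mul] at h2
      refine h2.trans ?_
      ext i j
      simp only [RingHom.mapMatrix_apply, Matrix.map_apply, Matrix.smul_apply, Matrix.one_apply,
        smul_eq_mul]
      split_ifs <;> simp
    rw [this, smul_mul_assoc, one_mul]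
  intro i j
  have h3 : algebraMap F K Y.det * V i j ∈ E := by
    have := congrFun (congrFun hadj i) j
    rw [Matrix.smul_apply, smul_eq_mul] at this
    rw [this, Matrix.mul_apply]
    exact sum_mem fun l _ => mul_mem (E.algebraMap_mem _) (hVE l j)
  have h4 := E.mul_mem (E.inv_mem (E.algebraMap_mem Y.det)) h3
  rwa [inv_mul_cancel_left₀ hdY] at h4

include hgen hF hdet in
lemma isGalois_of_solution [Algebra.IsIntegral A B] : IsGalois F K := by
  have hfd := finiteDimensional_of_generated F K W hgen
  have hsep := isSeparable_of_solution U F K W x hgen hF hdet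
  let Ω := AlgebraicClosure K
  let K' : IntermediateField F Ω := (IsScalarTower.toAlgHom F K Ω).fieldRange
  have hcl : IsAlgClosure F Ω := ⟨inferInstance, Algebra.IsAlgebraic.trans F K Ω⟩
  have hno : Normal F Ω := IsAlgClosure.normal F Ω
  let e : K ≃ₐ[F] K' := AlgEquiv.ofInjectiveField (IsScalarTower.toAlgHom F K Ω)
  have hrange : ∀ σ : K →ₐ[F] Ω, ∀ y, σ y ∈ K' := by
    intro σ
    have htop : K'.comap σ = ⊤ := by
      apply intermediateField_eq_top F K W hgen
      have h1 := frobPow_map_solution U W x hF (IsScalarTower.toAlgHom k B Ω)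
      have h2 := frobPow_map_solution U W x hF
        ((σ.restrictScalars k).comp (IsScalarTower.toAlgHom k B K))
      have hx : ((σ.restrictScalars k).comp (IsScalarTower.toAlgHom k B K)) (algebraMap A B x) =
          (IsScalarTower.toAlgHom k B Ω) (algebraMap A B x) := by
        simp only [AlgHom.comp_apply, IsScalarTower.coe_toAlgHom', AlgHom.restrictScalars_apply]
        rw [← IsScalarTower.algebraMap_apply A B K, ← IsScalarTower.algebraMap_apply A B Ω,
          IsScalarTower.algebraMap_apply A F K, AlgHom.commutes, IsScalarTower.algebraMap_apply A K Ω,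
          IsScalarTower.algebraMap_apply A F K, ← IsScalarTower.algebraMap_apply F K Ω]
      rw [hx] at h2
      obtain ⟨b, hb⟩ := exists_eq_mul_extMat h1 h2 (by
        rw [← AlgHom.map_det]
        simp only [IsScalarTower.coe_toAlgHom']
        rw [IsScalarTower.algebraMap_apply B K Ω]
        simpa using hdet)
      intro i j
      have := congrFun (congrFun hb i) j
      change σ (algebraMap B K (W i j)) ∈ K'
      change σ (algebraMap B K (W i j)) = _ at this
      rw [this, Matrix.mul_apply]
      refine sum_mem fun l _ => mul_mem ?_ ?_
      · exact ⟨algebraMap B K (W i l), (IsScalarTower.algebraMap_apply B K Ω _).symm⟩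
      · refine ⟨algebraMap k K (b l j), ?_⟩
        exact (IsScalarTower.algebraMap_apply k K Ω _).symm
    intro y
    have : y ∈ K'.comap σ := htop ▸ trivial
    exact this
  have hnK' : Normal F K' := by
    rw [IntermediateField.normal_iff_forall_fieldRange_le]
    rintro σ _ ⟨y, rfl⟩
    obtain ⟨z, rfl⟩ := e.surjective y
    exact hrange (σ.comp e.toAlgHom) z
  have : Normal F K := Normal.of_algEquiv e.symm
  exact ⟨⟩

end Fields

/-- An element whose `q^n`-th powers all lie in a finitely generated module is integral. -/
lemma isIntegral_of_pow_mem {A S : Type*} [CommRing A] [IsNoetherianRing A] [CommRing S]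
    [Algebra A S] {q : ℕ} (hq : 1 < q) {x : S} (N : Submodule A S) (hN : N.FG)
    (h : ∀ n, x ^ q ^ n ∈ N) : IsIntegral A x := by
  have : IsNoetherian A N := isNoetherian_of_fg_of_noetherian N hN
  let f : ℕ →o Submodule A N :=
    ⟨fun n => Submodule.span A ((fun i => (⟨x ^ q ^ i, h i⟩ : N)) '' Set.Iio n), fun m n hmn =>
      Submodule.span_mono (Set.image_mono (Set.Iio_subset_Iio hmn))⟩
  obtain ⟨n, hn⟩ := monotone_stabilizes_iff_noetherian.mpr this f
  have h1 : (⟨x ^ q ^ n, h n⟩ : N) ∈ f n := by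
    rw [hn (n + 1) (Nat.le_succ n)]
    exact Submodule.subset_span ⟨n, Nat.lt_succ_self n, rfl⟩
  have h2 : f n ≤ ((degreeLT A (q ^ n)).map (aeval x).toLinearMap).comap N.subtype := by
    refine Submodule.span_le.mpr ?_
    rintro _ ⟨i, hi, rfl⟩
    refine ⟨X ^ q ^ i, ?_, by simp⟩
    refine mem_degreeLT.mpr ((degree_X_pow_le _).trans_lt ?_)
    exact_mod_cast Nat.pow_lt_pow_right hq hi
  obtain ⟨P, hP, hPx⟩ := h2 h1
  refine ⟨X ^ q ^ n - P, monic_X_pow_sub (mem_degreeLT.mp hP), ?_⟩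
  rw [← aeval_def, map_sub, map_pow, aeval_X, sub_eq_zero]
  exact hPx.symm

section Fields

variable {k : Type*} [Field k] [Fintype k] {d : Type*} [Fintype d] [DecidableEq d]
  (U : Matrix d d k) {A : Type*} [CommRing A] [IsDomain A] [Algebra k A] [IsIntegrallyClosed A]
  {B : Type*} [CommRing B] [IsDomain B] [Algebra k B] [Algebra A B] [IsScalarTower k A B]
  (F K : Type*) [Field F] [Algebra A F] [IsFractionRing A F] [Field K] [Algebra B K]
  [IsFractionRing B K] [Algebra A K] [IsScalarTower A B K] [Algebra F K] [IsScalarTower A F K]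
  [Algebra k F] [IsScalarTower k A F] [Algebra k K] [IsScalarTower k B K] [IsScalarTower k F K]
  (W : Matrix d d B) (x : A)
  (hgen : Algebra.adjoin A (Set.range fun ij : d × d => W ij.1 ij.2) = ⊤)
  (hF : (frobPow k B 1).mapMatrix W = (1 + algebraMap A B x • extMat B U) * W)
  (hdet : W.det ≠ 0)

include F K hgen hF hdet in
lemma exists_deck_group [Algebra.IsIntegral A B] :
    ∃ (Γ : Subgroup (Matrix d d k)ˣ) (γ : Γ → (B →ₐ[A] B)),
      (∀ g, (γ g).mapMatrix W = W * extMat B ((g : (Matrix d d k)ˣ) : Matrix d d k)) ∧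
      ∀ y : B, ∃ a : A, algebraMap A B a = ∑ g, γ g y := by
  have hgal := isGalois_of_solution U F K W x hgen hF hdet
  have hfd := finiteDimensional_of_generated F K W hgen
  have hiK : Function.Injective (algebraMap B K) := IsFractionRing.injective B K
  let ι : B →ₐ[A] K := IsScalarTower.toAlgHom A B K
  set V := (IsScalarTower.toAlgHom k B K).mapMatrix W with hV
  have hVdet : V.det ≠ 0 := by
    rw [hV, ← AlgHom.map_det]
    simpa using hdet
  have hFr := frobPow_map_solution U W x hF (IsScalarTower.toAlgHom k B K)
  have hσ : ∀ σ : Gal(K/F), ∃ b : Matrix d d k, V.map σ = V * extMat K b := by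
    intro σ
    have h2 := frobPow_map_solution U W x hF
      (((σ : K →ₐ[F] K).restrictScalars k).comp (IsScalarTower.toAlgHom k B K))
    have hx : (((σ : K →ₐ[F] K).restrictScalars k).comp (IsScalarTower.toAlgHom k B K))
        (algebraMap A B x) = (IsScalarTower.toAlgHom k B K) (algebraMap A B x) := by
      simp only [AlgHom.comp_apply, IsScalarTower.coe_toAlgHom', AlgHom.restrictScalars_apply]
      rw [← IsScalarTower.algebraMap_apply A B K, IsScalarTower.algebraMap_apply A F K,
        AlgHom.commutes]
    rw [hx] at h2
    exact exists_eq_mul_extMat hFr h2 hVdet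
  choose b hb using hσ
  have hcancel : ∀ M M' : Matrix d d k, V * extMat K M = V * extMat K M' → M = M' := by
    intro M M' h
    apply extMat_injective (S := K)
    have hu : IsUnit V.det := isUnit_iff_ne_zero.mpr hVdet
    have := congrArg (fun Z => V⁻¹ * Z) h
    simpa only [Matrix.nonsing_inv_mul_cancel_left _ _ hu] using this
  have hb1 : b 1 = 1 := by
    apply hcancel
    rw [← hb, extMat_one, mul_one]
    ext i j; simp
  have hbmul : ∀ σ τ, b (σ * τ) = b σ * b τ := by
    intro σ τ
    apply hcancel
    rw [← hb, extMat_mul, ← mul_assoc, ← hb]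
    have h1 : V.map (σ * τ : Gal(K/F)) = (V.map τ).map σ := by ext i j; simp
    rw [h1, hb τ]
    ext i j
    simp only [Matrix.map_apply, Matrix.mul_apply, map_sum, map_mul]
    refine Finset.sum_congr rfl fun l _ => ?_
    rw [IsScalarTower.algebraMap_apply k F K, AlgEquiv.commutes]
  let ρ : Gal(K/F) →* (Matrix d d k)ˣ := MonoidHom.toHomUnits ⟨⟨b, hb1⟩, hbmul⟩
  have hρ : ∀ σ, ((ρ σ : (Matrix d d k)ˣ) : Matrix d d k) = b σ := fun σ => rfl
  have hinj : Function.Injective ρ := by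
    rw [injective_iff_map_eq_one]
    intro σ h
    have hbσ : b σ = 1 := by rw [← hρ, h]; rfl
    have hVσ : V.map σ = V := by rw [hb, hbσ, extMat_one, mul_one]
    have heq : ((σ : K →ₐ[F] K).restrictScalars A).comp ι = ι := by
      refine AlgHom.ext_of_adjoin_eq_top hgen ?_
      rintro _ ⟨ij, rfl⟩
      exact congrFun (congrFun hVσ ij.1) ij.2
    ext y
    obtain ⟨u, v, -, rfl⟩ := IsFractionRing.div_surjective (A := B) y
    have hu : ∀ z : B, σ (algebraMap B K z) = algebraMap B K z := fun z => DFunLike.congr_fun heq z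
    rw [map_div₀, hu, hu]; rfl
  have hmem : ∀ (σ : Gal(K/F)) (y : B), σ (ι y) ∈ ι.range := by
    intro σ y
    have hy : y ∈ Algebra.adjoin A (Set.range fun ij : d × d => W ij.1 ij.2) := by
      rw [hgen]; trivial
    induction hy using Algebra.adjoin_induction with
    | mem x hx =>
      obtain ⟨ij, rfl⟩ := hx
      have := congrFun (congrFun (hb σ) ij.1) ij.2
      change σ (ι _) = _ at this
      rw [this, Matrix.mul_apply]
      refine sum_mem fun l _ => mul_mem ⟨W ij.1 l, rfl⟩ ⟨algebraMap k B (b σ l ij.2), ?_⟩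
      exact (IsScalarTower.algebraMap_apply k B K _).symm
    | algebraMap r =>
      rw [AlgHom.commutes, IsScalarTower.algebraMap_apply A F K, AlgEquiv.commutes,
        ← IsScalarTower.algebraMap_apply A F K]
      exact ι.range.algebraMap_mem r
    | add x y _ _ hx hy => rw [map_add, map_add]; exact add_mem hx hy
    | mul x y _ _ hx hy => rw [map_mul, map_mul]; exact mul_mem hx hy
  let e : B ≃ₐ[A] ι.range := AlgEquiv.ofInjective ι hiK
  let δ : Gal(K/F) → (B →ₐ[A] B) := fun σ => (e.symm : ι.range →ₐ[A] B).comp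
    ((((σ : K →ₐ[F] K).restrictScalars A).comp ι).codRestrict ι.range (hmem σ))
  have hδ : ∀ σ y, ι (δ σ y) = σ (ι y) := by
    intro σ y
    have : e (δ σ y) = ⟨σ (ι y), hmem σ y⟩ := AlgEquiv.apply_symm_apply e _
    exact congrArg Subtype.val this
  let eΓ := MonoidHom.ofInjective hinj
  refine ⟨ρ.range, fun g => δ (eΓ.symm g), ?_, ?_⟩
  · intro g
    have hg : ((g : (Matrix d d k)ˣ) : Matrix d d k) = b (eΓ.symm g) := by
      rw [← hρ]
      congr 1
      have := eΓ.apply_symm_apply g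
      exact congrArg Subtype.val this.symm
    rw [hg]
    ext i j
    apply hiK
    have h1 := congrFun (congrFun (hb (eΓ.symm g)) i) j
    change ι (δ _ (W i j)) = _
    rw [hδ]
    refine h1.trans ?_
    rw [Matrix.mul_apply, Matrix.mul_apply, map_sum]
    refine Finset.sum_congr rfl fun l _ => ?_
    rw [map_mul]
    congr 1
    exact IsScalarTower.algebraMap_apply k B K _
  · intro y
    have h1 : IsIntegral A (Algebra.trace F K (ι y)) := by
      apply Algebra.isIntegral_trace
      exact (Algebra.IsIntegral.isIntegral (R := A) y).map ι
    obtain ⟨a, ha⟩ := IsIntegrallyClosed.isIntegral_iff.mp h1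
    refine ⟨a, hiK ?_⟩
    have h2 := trace_eq_sum_automorphisms (K := F) (ι y)
    rw [← ha] at h2
    rw [← IsScalarTower.algebraMap_apply A B K, IsScalarTower.algebraMap_apply A F K, h2, map_sum]
    refine Finset.sum_nbij' (fun σ => eΓ σ) (fun g => eΓ.symm g) (fun _ _ => by simp)
      (fun _ _ => by simp) (fun σ _ => eΓ.symm_apply_apply σ)
      (fun g _ => eΓ.apply_symm_apply g) fun σ _ => ?_
    change σ (ι y) = ι (δ (eΓ.symm (eΓ σ)) y)
    rw [hδ, MulEquiv.symm_apply_apply]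

end Fields

/-- Homomorphisms to an algebraically closed field extend along integral injections. -/
lemma exists_extension_of_isIntegral {A B Ω : Type*} [CommRing A] [CommRing B]
    [Algebra A B] [Algebra.IsIntegral A B] (hinj : Function.Injective (algebraMap A B)) [Field Ω]
    [IsAlgClosed Ω] (φ : A →+* Ω) : ∃ θ : B →+* Ω, θ.comp (algebraMap A B) = φ := by
  set P := RingHom.ker φ with hP
  have hPp : P.IsPrime := RingHom.ker_isPrime φ
  obtain ⟨Q, -, hQ, hQP⟩ := Ideal.exists_ideal_over_prime_of_isIntegral (S := B) P ⊥ (by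
    rw [← RingHom.ker_eq_comap_bot, (RingHom.injective_iff_ker_eq_bot _).mp hinj]
    exact bot_le)
  have hlies : Q.LiesOver P := ⟨hQP.symm⟩
  let : Algebra (A ⧸ P) Ω := (RingHom.kerLift φ).toAlgebra
  have hinj' : Function.Injective (algebraMap (A ⧸ P) Ω) := RingHom.kerLift_injective φ
  have : IsDomain (A ⧸ P) := Ideal.Quotient.isDomain P
  have : IsDomain (B ⧸ Q) := Ideal.Quotient.isDomain Q
  have : Module.IsTorsionFree (A ⧸ P) Ω :=
    Module.isTorsionFree_iff_faithfulSMul.mpr ((faithfulSMul_iff_algebraMap_injective _ _).mpr hinj')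
  have : Module.IsTorsionFree (A ⧸ P) (B ⧸ Q) :=
    Module.isTorsionFree_iff_faithfulSMul.mpr (Ideal.Quotient.instFaithfulSMul Q P)
  have : Algebra.IsIntegral (A ⧸ P) (B ⧸ Q) := inferInstance
  have : Algebra.IsAlgebraic (A ⧸ P) (B ⧸ Q) := inferInstance
  let ψ : (B ⧸ Q) →ₐ[A ⧸ P] Ω := IsAlgClosed.lift
  refine ⟨(ψ : (B ⧸ Q) →+* Ω).comp (Ideal.Quotient.mk Q), ?_⟩
  ext a
  have h1 : ψ (algebraMap (A ⧸ P) (B ⧸ Q) (Ideal.Quotient.mk P a)) =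
    algebraMap (A ⧸ P) Ω (Ideal.Quotient.mk P a) := ψ.commutes _
  exact h1

section Points

variable {k : Type*} [Field k] [Fintype k] {d : Type*} [Fintype d] [DecidableEq d]
  (U : Matrix d d k)
  {B : Type*} [CommRing B] [IsDomain B] [Algebra k B] [Algebra k[X] B] [IsScalarTower k k[X] B]
  (W : Matrix d d B)
  (hgen : Algebra.adjoin k[X] (Set.range fun ij : d × d => W ij.1 ij.2) = ⊤)
  (hF : (frobPow k B 1).mapMatrix W = (1 + algebraMap k[X] B X • extMat B U) * W)
  (hdet : W.det ≠ 0) (hcomm : extMat B U * W = W * extMat B U)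
  (Γ : Subgroup (Matrix d d k)ˣ) (γ : Γ → (B →ₐ[k[X]] B))
  (hγ : ∀ g, (γ g).mapMatrix W = W * extMat B ((g : (Matrix d d k)ˣ) : Matrix d d k))
  (htr : ∀ y : B, ∃ a : k[X], algebraMap k[X] B a = ∑ g, γ g y)
  {Ω : Type*} [Field Ω] [Algebra k Ω]

/-- A point at which the covering is unramified. -/
def IsGood (U : Matrix d d k) (α : Ω) : Prop := (1 + α • extMat Ω U).det ≠ 0

lemma isScalarTower_apply_eq_aeval (θ : B →ₐ[k] Ω) (a : k[X]) :
    θ (algebraMap k[X] B a) = aeval (θ (algebraMap k[X] B X)) a := by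
  have : θ.comp (IsScalarTower.toAlgHom k k[X] B) = aeval (θ (algebraMap k[X] B X)) := by
    ext; simp
  exact DFunLike.congr_fun this a

include hF hdet in
lemma det_map_ne_zero (θ : B →ₐ[k] Ω) (hα : IsGood U (θ (algebraMap k[X] B X))) :
    (θ.mapMatrix W).det ≠ 0 := by
  have h1 := det_pow_card hF
  have h2 : W.det ^ (Fintype.card k - 1) = (1 + algebraMap k[X] B X • extMat B U).det := by
    have h3 : Fintype.card k = Fintype.card k - 1 + 1 :=
      (Nat.sub_add_cancel Fintype.card_pos).symm
    rw [h3, pow_succ] at h1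
    exact mul_right_cancel₀ hdet h1
  intro h0
  apply hα
  have h4 := congrArg θ h2
  rw [map_pow, AlgHom.map_det, AlgHom.map_det, h0, zero_pow
    (Nat.sub_ne_zero_of_lt Fintype.one_lt_card), map_add, map_one, mapMatrix_smul, extMat_map] at h4
  exact h4.symm

include hγ in
lemma mapMatrix_comp_deck (θ : B →ₐ[k] Ω) (g : Γ) :
    (θ.comp ((γ g).restrictScalars k)).mapMatrix W =
      θ.mapMatrix W * extMat Ω ((g : (Matrix d d k)ˣ) : Matrix d d k) := by
  have := congrArg θ.mapMatrix (hγ g)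
  rw [map_mul, extMat_map] at this
  exact this

lemma mul_extMat_injective {V : Matrix d d Ω} (hV : V.det ≠ 0) {M M' : Matrix d d k}
    (h : V * extMat Ω M = V * extMat Ω M') : M = M' := by
  apply extMat_injective (S := Ω)
  have hu : IsUnit V.det := isUnit_iff_ne_zero.mpr hV
  have := congrArg (fun Z => V⁻¹ * Z) h
  simpa only [Matrix.nonsing_inv_mul_cancel_left _ _ hu] using this

lemma comp_deck_X (θ : B →ₐ[k] Ω) (g : Γ) :
    (θ.comp ((γ g).restrictScalars k)) (algebraMap k[X] B X) = θ (algebraMap k[X] B X) := by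
  simp

include hF hdet hγ in
lemma comp_deck_injective (θ : B →ₐ[k] Ω) (hα : IsGood U (θ (algebraMap k[X] B X))) {g h : Γ}
    (hgh : θ.comp ((γ g).restrictScalars k) = θ.comp ((γ h).restrictScalars k)) : g = h := by
  have h1 := congrArg (fun φ : B →ₐ[k] Ω => φ.mapMatrix W) hgh
  beta_reduce at h1
  rw [mapMatrix_comp_deck W Γ γ hγ, mapMatrix_comp_deck W Γ γ hγ] at h1
  exact Subtype.ext (Units.ext (mul_extMat_injective (det_map_ne_zero U W hF hdet θ hα) h1))

include hgen hF hdet hγ htr in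
/-- The deck group acts transitively on the fibres. -/
lemma exists_eq_comp_deck (θ θ' : B →ₐ[k] Ω) (hα : IsGood U (θ (algebraMap k[X] B X)))
    (hθ : θ' (algebraMap k[X] B X) = θ (algebraMap k[X] B X)) :
    ∃ g, θ' = θ.comp ((γ g).restrictScalars k) := by
  have h1 : γ 1 = AlgHom.id k[X] B := by
    refine AlgHom.ext_of_adjoin_eq_top hgen ?_
    rintro _ ⟨ij, rfl⟩
    have := congrFun (congrFun (hγ 1) ij.1) ij.2
    rw [show (((1 : Γ) : (Matrix d d k)ˣ) : Matrix d d k) = 1 from rfl, extMat_one, mul_one] at this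
    exact this
  have hα' : IsGood U (θ' (algebraMap k[X] B X)) := hθ ▸ hα
  by_contra! hne
  let m : (B →ₐ[k] Ω) → (B →* Ω) := fun φ => (φ : B →* Ω)
  have hm : Function.Injective m := fun φ φ' h => by
    ext b; exact DFunLike.congr_fun h b
  let l : (B →* Ω) →₀ Ω := ∑ g, Finsupp.single (m (θ.comp ((γ g).restrictScalars k))) 1 -
    ∑ g, Finsupp.single (m (θ'.comp ((γ g).restrictScalars k))) 1
  have hl : l = 0 := by
    apply linearIndependent_iff.mp (linearIndependent_monoidHom B Ω)
    simp only [l, map_sub, map_sum, Finsupp.linearCombination_single, one_smul]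
    ext y
    obtain ⟨a, ha⟩ := htr y
    have e1 : ∑ g, θ (γ g y) = aeval (θ (algebraMap k[X] B X)) a := by
      rw [← map_sum, ← ha, isScalarTower_apply_eq_aeval]
    have e2 : ∑ g, θ' (γ g y) = aeval (θ (algebraMap k[X] B X)) a := by
      rw [← map_sum, ← ha, isScalarTower_apply_eq_aeval, hθ]
    simp only [Pi.sub_apply, Finset.sum_apply, Pi.zero_apply]
    exact sub_eq_zero.mpr (e1.trans e2.symm)
  have h2 := DFunLike.congr_fun hl (m θ')
  simp only [l, Finsupp.sub_apply, Finsupp.finsetSum_apply, Finsupp.coe_zero, Pi.zero_apply,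
    Finsupp.single_apply] at h2
  rw [Finset.sum_eq_zero (fun g _ => if_neg fun h => hne g (hm h).symm), Finset.sum_eq_single 1] at h2
  · rw [if_pos (by rw [h1]; rfl)] at h2
    simp at h2
  · intro g _ hg
    refine if_neg fun h => hg ?_
    apply comp_deck_injective U W hF hdet Γ γ hγ θ' hα'
    rw [hm h, h1]; rfl
  · intro h; exact absurd (Finset.mem_univ _) h

include hgen hF hdet hγ htr hcomm in
/-- The Frobenius at a point is the element of the deck group given by the norm. -/
lemma exists_frob_eq (θ : B →ₐ[k] Ω) (hα : IsGood U (θ (algebraMap k[X] B X))) {n : ℕ}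
    (hn : θ (algebraMap k[X] B X) ^ Fintype.card k ^ n = θ (algebraMap k[X] B X)) :
    ∃ g : Γ, (frobPow k Ω n).comp θ = θ.comp ((γ g).restrictScalars k) ∧
      extMat Ω ((g : (Matrix d d k)ˣ) : Matrix d d k) =
        aeval (extMat Ω U) (normPoly k (θ (algebraMap k[X] B X)) n) := by
  obtain ⟨g, hg⟩ := exists_eq_comp_deck U W hgen hF hdet Γ γ hγ htr θ ((frobPow k Ω n).comp θ) hα
    (by rw [AlgHom.comp_apply, frobPow_apply, hn])
  refine ⟨g, hg, ?_⟩
  have h1 := congrArg (fun φ : B →ₐ[k] Ω => φ.mapMatrix W) hg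
  beta_reduce at h1
  rw [mapMatrix_comp_deck W Γ γ hγ] at h1
  have h2 := frobPow_mapMatrix U (frobPow_map_solution U W X hF θ) n
  have h3 : extMat Ω U * θ.mapMatrix W = θ.mapMatrix W * extMat Ω U := by
    have := congrArg θ.mapMatrix hcomm
    rwa [map_mul, map_mul, extMat_map] at this
  set V := θ.mapMatrix W
  have h4 : ∀ Q : Polynomial Ω, aeval (extMat Ω U) Q * V = V * aeval (extMat Ω U) Q := by
    intro Q
    induction Q using Polynomial.induction_on' with
    | add p q hp hq => rw [map_add, add_mul, mul_add, hp, hq]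
    | monomial n a =>
      rw [aeval_monomial, mul_assoc, (show Commute (extMat Ω U) V from h3).pow_left n |>.eq,
        ← mul_assoc, ← mul_assoc, Algebra.commutes]
  rw [h4] at h2
  have h5 : V * extMat Ω ((g : (Matrix d d k)ˣ) : Matrix d d k) =
      V * aeval (extMat Ω U) (normPoly k (θ (algebraMap k[X] B X)) n) := h1.symm.trans h2
  have hu : IsUnit V.det := isUnit_iff_ne_zero.mpr (det_map_ne_zero U W hF hdet θ hα)
  have := congrArg (fun Z => V⁻¹ * Z) h5
  simpa only [Matrix.nonsing_inv_mul_cancel_left _ _ hu] using this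

include hgen hF hdet hγ htr hcomm in
/-- The number of points with prescribed norm is bounded by Stepanov's method. -/
lemma card_norm_eq_le [IsAlgClosed Ω] [Module.Finite k[X] B] {ι : Type*} [Fintype ι]
    (ω : Module.Basis ι k[X] B) (τ : B →ₐ[k[X]] PowerSeries k) (hτ : Function.Injective τ) :
    (∀ (n : ℕ) (α : Ω), α ^ Fintype.card k ^ n = α → IsGood U α → ∃ g ∈ Γ,
      extMat Ω (g : Matrix d d k) = aeval (extMat Ω U) (normPoly k α n)) ∧
    ∃ C e₀ : ℕ, ∀ e ≥ e₀, ∀ g ∈ Γ, ∀ T : Finset Ω, (∀ α ∈ T, α ^ Fintype.card k ^ (2 * e) = α ∧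
      IsGood U α ∧ extMat Ω (g : Matrix d d k) = aeval (extMat Ω U) (normPoly k α (2 * e))) →
      T.card * Fintype.card Γ ≤ Fintype.card k ^ (2 * e) + C * Fintype.card k ^ e := by
  have hinj : Function.Injective (algebraMap k[X] B) := by
    intro a b h
    have := congrArg τ h
    rw [AlgHom.commutes, AlgHom.commutes] at this
    exact coe_injective k this
  have hθ : ∀ α : Ω, ∃ θ : B →ₐ[k] Ω, θ (algebraMap k[X] B X) = α := by
    intro α
    obtain ⟨θ, h⟩ := exists_extension_of_isIntegral hinj (aeval (R := k) α : k[X] →ₐ[k] Ω).toRingHom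
    refine ⟨⟨θ, fun r => ?_⟩, ?_⟩
    · have := RingHom.congr_fun h (C r)
      simp only [RingHom.comp_apply] at this
      refine Eq.trans ?_ (this.trans (aeval_C _ _))
      rw [IsScalarTower.algebraMap_apply k k[X] B]; rfl
    · exact (RingHom.congr_fun h X).trans (aeval_X _)
  choose θ hθ using hθ
  constructor
  · intro n α hn hα
    obtain ⟨g, -, hg⟩ := exists_frob_eq U W hgen hF hdet hcomm Γ γ hγ htr (θ α)
      (by rwa [hθ]) (by rwa [hθ])
    rw [hθ] at hg
    exact ⟨g, g.2, hg⟩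
  · have hS := fun g : Γ => card_frob_eq_le ω τ hτ (γ g) Ω
    choose C e₀ hC using hS
    refine ⟨Finset.univ.sup C, Finset.univ.sup e₀, fun e he g hg T hT => ?_⟩
    have hα : ∀ α ∈ T, IsGood U (θ α (algebraMap k[X] B X)) := fun α h => by
      rw [hθ]; exact (hT α h).2.1
    set f : Ω × Γ → (B →ₐ[k] Ω) := fun x => (θ x.1).comp ((γ x.2).restrictScalars k) with hf
    have hfX : ∀ x, f x (algebraMap k[X] B X) = x.1 := fun x => by
      rw [hf]; simp only; rw [comp_deck_X, hθ]
    have hfinj : Set.InjOn f (T ×ˢ (Finset.univ : Finset Γ) : Finset (Ω × Γ)) := by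
      rintro ⟨α, g⟩ h1 ⟨β, g'⟩ h2 h
      have hab : α = β := by
        have := DFunLike.congr_fun h (algebraMap k[X] B X)
        rwa [hfX, hfX] at this
      subst hab
      rw [Finset.mem_coe, Finset.mem_product] at h1
      exact congrArg _ (comp_deck_injective U W hF hdet Γ γ hγ (θ α) (hα α h1.1) h)
    have hcard : ((T ×ˢ (Finset.univ : Finset Γ)).image f).card = T.card * Fintype.card Γ := by
      rw [Finset.card_image_of_injOn hfinj, Finset.card_product, Finset.card_univ]
    rw [← hcard]
    refine (hC ⟨g, hg⟩ e ((Finset.le_sup (Finset.mem_univ _)).trans he) _ ?_).trans ?_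
    · intro φ hφ b
      obtain ⟨⟨α, g'⟩, hx, rfl⟩ := Finset.mem_image.mp hφ
      rw [Finset.mem_product] at hx
      have hTα := hT α hx.1
      have hX := hfX (α, g')
      obtain ⟨g'', h1, h2⟩ := exists_frob_eq U W hgen hF hdet hcomm Γ γ hγ htr (f (α, g'))
        (by rw [hX]; exact hTα.2.1) (n := 2 * e) (by rw [hX]; exact hTα.1)
      rw [hX] at h2
      have h3 : (⟨g, hg⟩ : Γ) = g'' :=
        Subtype.ext (Units.ext (extMat_injective (S := Ω) (hTα.2.2.trans h2.symm)))
      rw [h3, ← frobPow_apply]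
      exact DFunLike.congr_fun h1 b
    · gcongr
      exact Finset.le_sup (Finset.mem_univ _)

end Points

lemma normPoly_map {k S S' : Type*} [Fintype k] [CommRing S] [CommRing S'] (φ : S →+* S') (x : S)
    (n : ℕ) : (normPoly k x n).map φ = normPoly k (φ x) n := by
  simp only [normPoly, Polynomial.map_prod, Polynomial.map_add, Polynomial.map_one,
    Polynomial.map_mul, map_C, map_X, map_pow, Polynomial.map_pow]

section Distribution

variable {k : Type*} [Field k] [Fintype k] {d : Type*} [Fintype d] [DecidableEq d]
  (U : Matrix d d k)

/-- The `k[X]`-algebra generated by the entries of the power series solution. -/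
abbrev solAlg : Subalgebra k[X] (PowerSeries k) :=
  Algebra.adjoin k[X] (Set.range fun ij : d × d => sol U ij.1 ij.2)

/-- The power series solution as a matrix over the algebra generated by its entries. -/
def solMat : Matrix d d (solAlg U) := fun i j => ⟨sol U i j, Algebra.subset_adjoin ⟨(i, j), rfl⟩⟩

lemma algebraMap_X_eq : algebraMap k[X] (PowerSeries k) X = PowerSeries.X := coe_X

lemma isIntegral_sol (i j : d) : IsIntegral k[X] (sol U i j) := by
  refine isIntegral_of_pow_mem (Fintype.one_lt_card (α := k))
    (Submodule.span k[X] (Set.range fun ij : d × d => sol U ij.1 ij.2))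
    (Submodule.fg_span (Set.finite_range _)) fun n => ?_
  have h1 := frobPow_mapMatrix U (frobPow_sol U) n
  have h2 : aeval (extMat (PowerSeries k) U) (normPoly k (PowerSeries.X : PowerSeries k) n) =
      (IsScalarTower.toAlgHom k k[X] (PowerSeries k)).mapMatrix
        (aeval (extMat k[X] U) (normPoly k (X : k[X]) n)) := by
    rw [mapMatrix_aeval]
    rw [normPoly_map]
    exact congrArg (fun z => aeval _ (normPoly k z n)) algebraMap_X_eq.symm
  rw [h2] at h1
  have h3 := congrFun (congrFun h1 i) j
  rw [Matrix.mul_apply] at h3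
  simp only [AlgHom.mapMatrix_apply, Matrix.map_apply, frobPow_apply] at h3
  rw [h3]
  refine sum_mem fun l _ => ?_
  rw [IsScalarTower.coe_toAlgHom', ← Algebra.smul_def]
  exact Submodule.smul_mem _ _ (Submodule.subset_span ⟨(l, j), rfl⟩)

instance finite_solAlg : Module.Finite k[X] (solAlg U) :=
  Algebra.finite_adjoin_of_finite_of_isIntegral (Set.finite_range _) (by
    rintro _ ⟨ij, rfl⟩
    exact isIntegral_sol U ij.1 ij.2)

lemma adjoin_solMat :
    Algebra.adjoin k[X] (Set.range fun ij : d × d => solMat U ij.1 ij.2) = ⊤ := by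
  rw [← Algebra.adjoin_adjoin_coe_preimage]
  congr 1
  ext x
  constructor
  · rintro ⟨ij, rfl⟩; exact ⟨ij, rfl⟩
  · rintro ⟨ij, h⟩; exact ⟨ij, Subtype.ext h⟩

lemma frobPow_solMat : (frobPow k (solAlg U) 1).mapMatrix (solMat U) =
    (1 + algebraMap k[X] (solAlg U) X • extMat (solAlg U) U) * solMat U := by
  have h := frobPow_sol U
  let φ : solAlg U →ₐ[k] PowerSeries k := (solAlg U).val.restrictScalars k
  have hφ : Function.Injective φ := Subtype.val_injective
  apply (show Function.Injective φ.mapMatrix from fun M N hMN => by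
    ext i j : 1; exact hφ (congrFun (congrFun hMN i) j))
  rw [map_mul, map_add, map_one, mapMatrix_smul, extMat_map]
  have h1 : φ (algebraMap k[X] (solAlg U) X) = PowerSeries.X := algebraMap_X_eq
  have h2 : φ.mapMatrix (solMat U) = sol U := rfl
  rw [h1, h2, ← h]
  ext i j : 1
  simp only [AlgHom.mapMatrix_apply, Matrix.map_apply, frobPow_apply, map_pow]
  rfl

lemma solMat_comm :
    extMat (solAlg U) U * solMat U = solMat U * extMat (solAlg U) U := by
  let φ : solAlg U →ₐ[k] PowerSeries k := (solAlg U).val.restrictScalars k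
  have hφ : Function.Injective φ := Subtype.val_injective
  apply (show Function.Injective φ.mapMatrix from fun M N hMN => by
    ext i j : 1; exact hφ (congrFun (congrFun hMN i) j))
  rw [map_mul, map_mul, extMat_map]
  exact sol_comm U

lemma det_solMat_ne_zero : (solMat U).det ≠ 0 := by
  intro h
  let φ : solAlg U →ₐ[k] PowerSeries k := (solAlg U).val.restrictScalars k
  have := congrArg φ h
  rw [AlgHom.map_det, map_zero] at this
  exact det_sol_ne_zero U this

/-- Distribution of the norms `∏_{i<n} (1 + α^(q^i) U)`. -/
theorem exists_norm_distribution (Ω : Type*) [Field Ω] [IsAlgClosed Ω] [Algebra k Ω] :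
    ∃ Γ : Subgroup (Matrix d d k)ˣ,
    (∀ (n : ℕ) (α : Ω), α ^ Fintype.card k ^ n = α → IsGood U α → ∃ g ∈ Γ,
      extMat Ω (g : Matrix d d k) = aeval (extMat Ω U) (normPoly k α n)) ∧
    ∃ C e₀ : ℕ, ∀ e ≥ e₀, ∀ g ∈ Γ, ∀ T : Finset Ω, (∀ α ∈ T, α ^ Fintype.card k ^ (2 * e) = α ∧
      IsGood U α ∧ extMat Ω (g : Matrix d d k) = aeval (extMat Ω U) (normPoly k α (2 * e))) →
      T.card * Fintype.card Γ ≤ Fintype.card k ^ (2 * e) + C * Fintype.card k ^ e := by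
  let F := FractionRing k[X]
  let K := FractionRing (solAlg U)
  have hinj : Function.Injective (algebraMap k[X] (solAlg U)) := by
    intro a b h
    exact coe_injective k (congrArg Subtype.val h)
  have : FaithfulSMul k[X] (solAlg U) := (faithfulSMul_iff_algebraMap_injective _ _).mpr hinj
  have : Module.IsTorsionFree k[X] (solAlg U) := Module.isTorsionFree_iff_faithfulSMul.mpr this
  have : FaithfulSMul k[X] K := inferInstance
  let : Algebra F K := FractionRing.liftAlgebra k[X] K
  have : IsScalarTower k[X] F K := FractionRing.isScalarTower_liftAlgebra k[X] K
  have : IsScalarTower k F K := by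
    refine IsScalarTower.of_algebraMap_eq fun r => ?_
    rw [IsScalarTower.algebraMap_apply k k[X] F, ← IsScalarTower.algebraMap_apply k[X] F K,
      ← IsScalarTower.algebraMap_apply k k[X] K]
  obtain ⟨Γ, γ, hγ, htr⟩ := exists_deck_group U F K (solMat U) X (adjoin_solMat U)
    (frobPow_solMat U) (det_solMat_ne_zero U)
  exact ⟨Γ, card_norm_eq_le U (solMat U) (adjoin_solMat U) (frobPow_solMat U)
    (det_solMat_ne_zero U) (solMat_comm U) Γ γ hγ htr
    (Module.Free.chooseBasis k[X] (solAlg U)) (solAlg U).val Subtype.val_injective⟩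

end Distribution

section FrobeniusOrbit

variable {k : Type*} [Field k] [Fintype k] {Ω : Type*} [Field Ω] [Algebra k Ω]

lemma frob_iterate (α : Ω) (l : ℕ) : (frobPow k Ω 1)^[l] α = α ^ Fintype.card k ^ l := by
  induction l with
  | zero => simp
  | succ l ih => rw [Function.iterate_succ_apply', ih, frobPow_apply, ← pow_mul, pow_one, pow_succ]

lemma aeval_pow_card_pow {P : k[X]} {α : Ω} (h : aeval α P = 0) (l : ℕ) :
    aeval (α ^ Fintype.card k ^ l) P = 0 := by
  rw [← frobPow_apply, aeval_algHom_apply, h, map_zero]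

/-- A polynomial fixed by Frobenius has coefficients in the base field. -/
lemma exists_map_eq_of_frob {S : Type*} [CommRing S] [IsDomain S] [Algebra k S]
    {P : S[X]} (hP : P.map (frobPow k S 1 : S →+* S) = P) :
    ∃ Q : k[X], Q.map (algebraMap k S) = P := by
  rw [← mem_lifts, lifts_iff_coeff_lifts]
  intro n
  have := congrArg (fun R => R.coeff n) hP
  simp only [coeff_map, RingHom.coe_coe, frobPow_apply, pow_one] at this
  exact exists_algebraMap_of_pow_card this

lemma prod_orbit_map_frob {α : Ω} {n : ℕ} (hα : α ^ Fintype.card k ^ n = α) :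
    (∏ l ∈ Finset.range n, (X - C (α ^ Fintype.card k ^ l))).map (frobPow k Ω 1 : Ω →+* Ω) =
      ∏ l ∈ Finset.range n, (X - C (α ^ Fintype.card k ^ l)) := by
  rw [Polynomial.map_prod]
  have h1 : ∀ l, (X - C (α ^ Fintype.card k ^ l)).map (frobPow k Ω 1 : Ω →+* Ω) =
      X - C (α ^ Fintype.card k ^ (l + 1)) := fun l => by
    simp only [Polynomial.map_sub, map_X, map_C, RingHom.coe_coe, frobPow_apply, ← pow_mul, pow_one,
      ← pow_succ]
  rw [Finset.prod_congr rfl fun l _ => h1 l]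
  cases n with
  | zero => simp
  | succ n =>
    rw [Finset.prod_range_succ, Finset.prod_range_succ', hα, pow_zero, pow_one]

/-- The minimal polynomial over a finite field is the product over the Frobenius orbit. -/
lemma map_minpoly_eq_prod {α : Ω} {n : ℕ} (hn : 0 < n) (hα : α ^ Fintype.card k ^ n = α) :
    (minpoly k α).map (algebraMap k Ω) =
      ∏ l ∈ Finset.range (minpoly k α).natDegree, (X - C (α ^ Fintype.card k ^ l)) ∧
    0 < (minpoly k α).natDegree ∧
    ∀ m, α ^ Fintype.card k ^ m = α ↔ (minpoly k α).natDegree ∣ m := by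
  set f : Ω → Ω := ⇑(frobPow k Ω 1) with hf
  have hper : ∀ m, Function.IsPeriodicPt f m α ↔ α ^ Fintype.card k ^ m = α := fun m => by
    rw [Function.IsPeriodicPt, Function.IsFixedPt, frob_iterate]
  set d := Function.minimalPeriod f α with hd
  have hdpos : 0 < d := Function.IsPeriodicPt.minimalPeriod_pos hn ((hper n).mpr hα)
  have hαd : α ^ Fintype.card k ^ d = α := (hper d).mp (Function.isPeriodicPt_minimalPeriod f α)
  obtain ⟨Q, hQ⟩ := exists_map_eq_of_frob (prod_orbit_map_frob hαd)
  set P := ∏ l ∈ Finset.range d, (X - C (α ^ Fintype.card k ^ l)) with hP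
  have hPm : P.Monic := monic_prod_of_monic _ _ fun l _ => monic_X_sub_C _
  have hQ0 : aeval α Q = 0 := by
    rw [← eval_map_algebraMap, hQ, hP, eval_prod]
    refine Finset.prod_eq_zero (Finset.mem_range.mpr hdpos) ?_
    simp
  have hQm : Q.Monic := by
    have := (algebraMap k Ω).injective
    rw [← hQ] at hPm
    exact monic_of_injective this hPm
  have hint : IsIntegral k α := ⟨Q, hQm, by rw [← aeval_def]; exact hQ0⟩
  have h1 : (minpoly k α).map (algebraMap k Ω) ∣ P := by
    rw [← hQ]; exact Polynomial.map_dvd _ (minpoly.dvd k α hQ0)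
  have h2 : P ∣ (minpoly k α).map (algebraMap k Ω) := by
    refine Finset.prod_dvd_of_coprime ?_ fun l _ => ?_
    · intro l hl m hm hlm
      refine isCoprime_X_sub_C_of_isUnit_sub (sub_ne_zero.mpr fun h => hlm ?_).isUnit
      rw [← frob_iterate, ← frob_iterate] at h
      exact Function.iterate_injOn_Iio_minimalPeriod (by simpa using hl) (by simpa using hm) h
    · rw [dvd_iff_isRoot, IsRoot.def, eval_map_algebraMap]
      exact aeval_pow_card_pow (minpoly.aeval k α) l
  have h3 : (minpoly k α).map (algebraMap k Ω) = P :=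
    eq_of_monic_of_associated ((minpoly.monic hint).map _) hPm (associated_of_dvd_dvd h1 h2)
  have h4 : (minpoly k α).natDegree = d := by
    rw [← natDegree_map (algebraMap k Ω), h3, hP, natDegree_prod_of_monic _ _ fun l _ =>
      monic_X_sub_C _]
    simp only [natDegree_X_sub_C, Finset.sum_const, Finset.card_range, smul_eq_mul, mul_one]
  refine ⟨by rw [h4, h3], by rw [h4]; exact hdpos, fun m => ?_⟩
  rw [h4, ← hper]
  exact Function.isPeriodicPt_iff_minimalPeriod_dvd

/-- The characteristic polynomial of `α` viewed in the field extension of degree `n`. -/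
def normChar (k : Type*) [Field k] {Ω : Type*} [Field Ω] [Algebra k Ω] (n : ℕ) (α : Ω) : k[X] :=
  minpoly k α ^ (n / (minpoly k α).natDegree)

lemma map_normChar {α : Ω} {n : ℕ} (hn : 0 < n) (hα : α ^ Fintype.card k ^ n = α) :
    (normChar k n α).map (algebraMap k Ω) =
      ∏ l ∈ Finset.range n, (X - C (α ^ Fintype.card k ^ l)) := by
  obtain ⟨h1, h2, h3⟩ := map_minpoly_eq_prod hn hα
  obtain ⟨m, hm⟩ := (h3 n).mp hα
  set d := (minpoly k α).natDegree with hd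
  rw [normChar, Polynomial.map_pow, h1, ← hd]
  have h4 : n / d = m := by rw [hm, Nat.mul_div_cancel_left _ h2]
  rw [h4, hm]
  clear h4 hm
  have hαd : ∀ m, α ^ Fintype.card k ^ (d * m) = α := fun m => (h3 _).mpr (dvd_mul_right d m)
  induction m with
  | zero => simp
  | succ m ih =>
    rw [pow_succ, ih, mul_add, mul_one, Finset.prod_range_add]
    congr 1
    refine Finset.prod_congr rfl fun l _ => ?_
    rw [pow_add (Fintype.card k), pow_mul α, hαd]

lemma monic_minpoly {α : Ω} {n : ℕ} (hn : 0 < n) (hα : α ^ Fintype.card k ^ n = α) :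
    (minpoly k α).Monic := by
  obtain ⟨h1, h2, h3⟩ := map_minpoly_eq_prod hn hα
  by_contra h
  rw [minpoly.eq_zero (fun hi => h (minpoly.monic hi))] at h2
  simp at h2

lemma normChar_monic {α : Ω} {n : ℕ} (hn : 0 < n) (hα : α ^ Fintype.card k ^ n = α) :
    (normChar k n α).Monic := (monic_minpoly hn hα).pow _

lemma natDegree_normChar {α : Ω} {n : ℕ} (hn : 0 < n) (hα : α ^ Fintype.card k ^ n = α) :
    (normChar k n α).natDegree = n := by
  obtain ⟨h1, h2, h3⟩ := map_minpoly_eq_prod hn hα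
  rw [normChar, natDegree_pow, Nat.div_mul_cancel ((h3 n).mp hα)]

end FrobeniusOrbit

section Fixed

variable (k : Type*) [Field k] [Fintype k] (Ω : Type*) [Field Ω] [Algebra k Ω]

/-- The elements of `Ω` in the extension of degree `n` of `k`. -/
def fixedFinset (n : ℕ) : Finset Ω :=
  (X ^ Fintype.card k ^ n - X : Polynomial Ω).roots.toFinset

variable {k Ω}

lemma mem_fixedFinset {n : ℕ} (hn : 0 < n) {α : Ω} :
    α ∈ fixedFinset k Ω n ↔ α ^ Fintype.card k ^ n = α := by
  rw [fixedFinset, Multiset.mem_toFinset, mem_roots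
    (FiniteField.X_pow_card_pow_sub_X_ne_zero Ω hn.ne' Fintype.one_lt_card)]
  simp [sub_eq_zero]

lemma card_fixedFinset [IsAlgClosed Ω] {n : ℕ} (hn : 0 < n) :
    (fixedFinset k Ω n).card = Fintype.card k ^ n := by
  obtain ⟨p, hp⟩ := CharP.exists k
  obtain ⟨m, hp', hm⟩ := FiniteField.card k p
  have : Fact p.Prime := ⟨hp'⟩
  have : CharP Ω p := charP_of_injective_algebraMap (algebraMap k Ω).injective p
  have hcard : Fintype.card k ^ n = p ^ (m * n : ℕ) := by rw [hm, ← pow_mul]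
  have hmn : (m * n : ℕ) ≠ 0 := (Nat.mul_pos m.pos hn).ne'
  have hnodup : (X ^ Fintype.card k ^ n - X : Polynomial Ω).roots.Nodup := by
    apply nodup_roots
    rw [hcard]
    exact galois_poly_separable p _ (dvd_pow_self p hmn)
  rw [fixedFinset, Multiset.toFinset_card_of_nodup hnodup,
    ← (IsAlgClosed.splits _).natDegree_eq_card_roots,
    FiniteField.X_pow_card_pow_sub_X_natDegree_eq Ω hn.ne' Fintype.one_lt_card]

end Fixed

section MonicFin

variable (k : Type*) [Field k] [Fintype k]

/-- The finite set of monic polynomials of degree `n` over a finite field. -/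
def monicFin (n : ℕ) : Finset k[X] :=
  (Finset.univ : Finset (Fin n → k)).image fun c => X ^ n + ∑ i : Fin n, C (c i) * X ^ (i : ℕ)

variable {k}

lemma mem_monicFin {n : ℕ} {F : k[X]} : F ∈ monicFin k n ↔ F.Monic ∧ F.natDegree = n := by
  simp only [monicFin, Finset.mem_image, Finset.mem_univ, true_and]
  constructor
  · rintro ⟨c, rfl⟩
    have hlt : (∑ i : Fin n, C (c i) * X ^ (i : ℕ)).degree < ((n : ℕ) : WithBot ℕ) := by
      rw [← mem_degreeLT]
      refine Submodule.sum_mem _ fun i _ => mem_degreeLT.mpr ?_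
      exact (degree_C_mul_X_pow_le _ _).trans_lt (by exact_mod_cast i.2)
    refine ⟨monic_X_pow_add hlt, ?_⟩
    rw [natDegree_add_eq_left_of_degree_lt (by simpa using hlt), natDegree_X_pow]
  · rintro ⟨hF, rfl⟩
    refine ⟨fun i => F.coeff i, ?_⟩
    conv_rhs => rw [hF.as_sum]
    rw [Finset.sum_range]

lemma natDegree_of_mem_monicFin {n : ℕ} {F : k[X]} (hF : F ∈ monicFin k n) : F.natDegree = n :=
  (mem_monicFin.mp hF).2

lemma monic_of_mem_monicFin {n : ℕ} {F : k[X]} (hF : F ∈ monicFin k n) : F.Monic :=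
  (mem_monicFin.mp hF).1

lemma monicFin_zero : monicFin k 0 = {1} := by
  ext F
  rw [mem_monicFin, Finset.mem_singleton]
  refine ⟨fun ⟨h1, h2⟩ => ?_, by rintro rfl; simp⟩
  exact h1.natDegree_eq_zero.mp h2

end MonicFin

section Newton

variable {k : Type*} [Field k] [Fintype k] {Ω : Type*} [Field Ω] [Algebra k Ω]

lemma exists_pow_card_pow_eq {α : Ω} (hα : IsIntegral k α) :
    ∃ n, 0 < n ∧ α ^ Fintype.card k ^ n = α := by
  have hfin : (Set.range fun l : ℕ => α ^ Fintype.card k ^ l).Finite := by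
    refine ((minpoly k α).rootSet_finite Ω).subset ?_
    rintro _ ⟨l, rfl⟩
    rw [mem_rootSet]
    exact ⟨minpoly.ne_zero hα, aeval_pow_card_pow (minpoly.aeval k α) l⟩
  obtain ⟨a, b, hab, h⟩ : ∃ a b : ℕ, a < b ∧ α ^ Fintype.card k ^ a = α ^ Fintype.card k ^ b := by
    by_contra! hne
    refine Set.infinite_range_of_injective (f := fun l : ℕ => α ^ Fintype.card k ^ l) ?_ hfin
    intro a b h
    rcases lt_trichotomy a b with hab | hab | hab
    · exact absurd h (hne a b hab)
    · exact hab
    · exact absurd h.symm (hne b a hab)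
  refine ⟨b - a, by omega, ?_⟩
  have h2 : frobPow k Ω a (α ^ Fintype.card k ^ (b - a)) = frobPow k Ω a α := by
    rw [frobPow_apply, frobPow_apply, ← pow_mul, ← pow_add, Nat.sub_add_cancel hab.le, h]
  exact (frobPow k Ω a : Ω →+* Ω).injective h2

lemma rootMultiplicity_map_eq {α : Ω} (hα : IsIntegral k α) {F : k[X]} (hF : F ≠ 0) :
    (F.map (algebraMap k Ω)).rootMultiplicity α = multiplicity (minpoly k α) F := by
  have hfin : FiniteMultiplicity (minpoly k α) F :=
    finiteMultiplicity_of_degree_pos_of_monic (minpoly.degree_pos hα) (minpoly.monic hα) hF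
  obtain ⟨G, hG, hdvd⟩ := hfin.exists_eq_pow_mul_and_not_dvd
  have hG0 : G ≠ 0 := by rintro rfl; exact hF (by rw [hG, mul_zero])
  have hm0 : (minpoly k α).map (algebraMap k Ω) ≠ 0 :=
    (Polynomial.map_ne_zero_iff (algebraMap k Ω).injective).mpr (minpoly.ne_zero hα)
  have hsep : ((minpoly k α).map (algebraMap k Ω)).Separable :=
    (PerfectField.separable_of_irreducible (minpoly.irreducible hα)).map
  have h1 : ((minpoly k α).map (algebraMap k Ω)).rootMultiplicity α = 1 := by
    refine le_antisymm (rootMultiplicity_le_one_of_separable hsep α) ?_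
    rw [Nat.one_le_iff_ne_zero, ← Nat.pos_iff_ne_zero, rootMultiplicity_pos hm0, IsRoot.def,
      eval_map_algebraMap, minpoly.aeval]
  have h2 : (G.map (algebraMap k Ω)).rootMultiplicity α = 0 := by
    refine rootMultiplicity_eq_zero fun h => hdvd ?_
    rw [IsRoot.def, eval_map_algebraMap] at h
    exact minpoly.dvd k α h
  have hmG : G.map (algebraMap k Ω) ≠ 0 :=
    (Polynomial.map_ne_zero_iff (algebraMap k Ω).injective).mpr hG0
  conv_lhs => rw [hG]
  rw [Polynomial.map_mul, Polynomial.map_pow, rootMultiplicity_mul (mul_ne_zero (pow_ne_zero _ hm0) hmG), h2,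
    add_zero]
  generalize multiplicity (minpoly k α) F = v
  induction v with
  | zero => rw [pow_zero]; exact rootMultiplicity_eq_zero (by simp)
  | succ v ih => rw [pow_succ, rootMultiplicity_mul (mul_ne_zero (pow_ne_zero _ hm0) hm0), ih, h1]

lemma card_normChar_dvd (α : Ω) {F : k[X]} (hF : F ≠ 0) :
    ((Finset.Icc 1 F.natDegree).filter
      fun i => α ∈ fixedFinset k Ω i ∧ normChar k i α ∣ F).card =
      (F.map (algebraMap k Ω)).rootMultiplicity α := by
  by_cases hr : aeval α F = 0
  · have hα : IsIntegral k α := by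
      rw [← isAlgebraic_iff_isIntegral]; exact ⟨F, hF, hr⟩
    obtain ⟨n, hn, hαn⟩ := exists_pow_card_pow_eq hα
    obtain ⟨-, hd, hdvd⟩ := map_minpoly_eq_prod hn hαn
    have hfin : FiniteMultiplicity (minpoly k α) F :=
      finiteMultiplicity_of_degree_pos_of_monic (minpoly.degree_pos hα) (minpoly.monic hα) hF
    rw [rootMultiplicity_map_eq hα hF]
    set d := (minpoly k α).natDegree with hdd
    set v := multiplicity (minpoly k α) F with hv
    have : (Finset.Icc 1 F.natDegree).filter
        (fun i => α ∈ fixedFinset k Ω i ∧ normChar k i α ∣ F) =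
        (Finset.Icc 1 v).image (fun m => d * m) := by
      ext i
      simp only [Finset.mem_filter, Finset.mem_Icc, Finset.mem_image]
      constructor
      · rintro ⟨⟨hi1, hi2⟩, hi3, hi4⟩
        rw [mem_fixedFinset (by omega), hdvd] at hi3
        obtain ⟨m, rfl⟩ := hi3
        rw [normChar, ← hdd, Nat.mul_div_cancel_left _ hd, hfin.pow_dvd_iff_le_multiplicity] at hi4
        refine ⟨m, ⟨?_, hi4⟩, rfl⟩
        rcases Nat.eq_zero_or_pos m with rfl | h
        · simp at hi1
        · exact h
      · rintro ⟨m, ⟨hm1, hm2⟩, rfl⟩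
        have hpos : 0 < d * m := Nat.mul_pos hd hm1
        have hdv : minpoly k α ^ m ∣ F := hfin.pow_dvd_iff_le_multiplicity.mpr hm2
        refine ⟨⟨hpos, ?_⟩, ?_, ?_⟩
        · have := natDegree_le_of_dvd hdv hF
          rwa [natDegree_pow, mul_comm, ← hdd] at this
        · rw [mem_fixedFinset hpos, hdvd]; exact dvd_mul_right _ _
        · rwa [normChar, ← hdd, Nat.mul_div_cancel_left _ hd]
    rw [this, Finset.card_image_of_injective _ (fun a b h => Nat.eq_of_mul_eq_mul_left hd h)]
    simp
  · rw [rootMultiplicity_eq_zero (by rwa [IsRoot.def, eval_map_algebraMap]), Finset.card_eq_zero,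
      Finset.filter_eq_empty_iff]
    rintro i hi ⟨h1, h2⟩
    rw [Finset.mem_Icc] at hi
    rw [mem_fixedFinset (by omega)] at h1
    apply hr
    obtain ⟨-, hd, hdvd⟩ := map_minpoly_eq_prod (show 0 < i by omega) h1
    have h3 : minpoly k α ∣ normChar k i α :=
      dvd_pow_self _ (Nat.div_pos (Nat.le_of_dvd (by omega) ((hdvd i).mp h1)) hd).ne'
    obtain ⟨G, rfl⟩ := h3.trans h2
    rw [map_mul, minpoly.aeval, zero_mul]

variable (k Ω) in
/-- The power sums attached to a multiplicative function `Ψ`. -/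
def powerSum (Ψ : k[X] → ℂ) (n : ℕ) : ℂ := ∑ α ∈ fixedFinset k Ω n, Ψ (normChar k n α)

/-- The coefficients of the `L`-series attached to `Ψ`. -/
def lCoeff (Ψ : k[X] → ℂ) (n : ℕ) : ℂ := ∑ F ∈ monicFin k n, Ψ F

lemma sum_card_normChar_dvd [IsAlgClosed Ω] {F : k[X]} (hF : F ≠ 0) :
    ∑ i ∈ Finset.Icc 1 F.natDegree,
      ((fixedFinset k Ω i).filter fun α => normChar k i α ∣ F).card = F.natDegree := by
  set R := (F.map (algebraMap k Ω)).roots.toFinset with hR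
  have hF' : F.map (algebraMap k Ω) ≠ 0 :=
    (Polynomial.map_ne_zero_iff (algebraMap k Ω).injective).mpr hF
  have hsub : ∀ i ∈ Finset.Icc 1 F.natDegree,
      ((fixedFinset k Ω i).filter fun α => normChar k i α ∣ F).card =
      ∑ α ∈ R, if α ∈ fixedFinset k Ω i ∧ normChar k i α ∣ F then 1 else 0 := fun i hi => by
    rw [← Finset.sum_filter, ← Finset.card_eq_sum_ones]
    congr 1
    ext α
    simp only [Finset.mem_filter]
    refine ⟨fun h => ⟨?_, h⟩, fun h => h.2⟩
    rw [hR, Multiset.mem_toFinset, ← Multiset.count_pos, count_roots, ← card_normChar_dvd α hF,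
      Finset.card_pos]
    exact ⟨i, Finset.mem_filter.mpr ⟨hi, h⟩⟩
  rw [Finset.sum_congr rfl hsub, Finset.sum_comm]
  calc _ = ∑ α ∈ R, (F.map (algebraMap k Ω)).roots.count α := by
        refine Finset.sum_congr rfl fun α _ => ?_
        rw [← Finset.sum_filter, ← Finset.card_eq_sum_ones, card_normChar_dvd α hF, count_roots]
    _ = _ := by
        rw [hR, Multiset.toFinset_sum_count_eq, ← (IsAlgClosed.splits _).natDegree_eq_card_roots,
          natDegree_map]

/-- Newton's identities for the `L`-series of a multiplicative function. -/
lemma newton_lCoeff [IsAlgClosed Ω] {Ψ : k[X] → ℂ}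
    (hΨ : ∀ F G : k[X], F.Monic → G.Monic → Ψ (F * G) = Ψ F * Ψ G) (n : ℕ) :
    (n : ℂ) * lCoeff Ψ n = ∑ i ∈ Finset.Icc 1 n, powerSum k Ω Ψ i * lCoeff Ψ (n - i) := by
  have key : ∀ i ∈ Finset.Icc 1 n, powerSum k Ω Ψ i * lCoeff Ψ (n - i) =
      ∑ F ∈ monicFin k n, ∑ α ∈ (fixedFinset k Ω i).filter fun α => normChar k i α ∣ F, Ψ F := by
    intro i hi
    rw [Finset.mem_Icc] at hi
    rw [powerSum, lCoeff, Finset.sum_mul]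
    simp_rw [Finset.sum_filter]
    rw [Finset.sum_comm]
    refine Finset.sum_congr rfl fun α hα => ?_
    rw [mem_fixedFinset (by omega)] at hα
    have hm := normChar_monic (show 0 < i by omega) hα
    have hdeg := natDegree_normChar (show 0 < i by omega) hα
    rw [← Finset.sum_filter, Finset.mul_sum]
    refine Finset.sum_bij (fun G _ => normChar k i α * G) ?_ ?_ ?_ ?_
    · intro G hG
      rw [mem_monicFin] at hG
      rw [Finset.mem_filter, mem_monicFin]
      refine ⟨⟨hm.mul hG.1, ?_⟩, dvd_mul_right _ _⟩
      rw [hm.natDegree_mul hG.1, hdeg, hG.2]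
      omega
    · intro G _ G' _ h
      exact mul_left_cancel₀ hm.ne_zero h
    · intro F hF
      rw [Finset.mem_filter, mem_monicFin] at hF
      obtain ⟨⟨hF1, hF2⟩, G, rfl⟩ := hF
      have hG : G.Monic := hm.of_mul_monic_left hF1
      refine ⟨G, ?_, rfl⟩
      rw [hm.natDegree_mul hG, hdeg] at hF2
      rw [mem_monicFin]
      exact ⟨hG, by omega⟩
    · intro G hG
      rw [hΨ _ _ hm (monic_of_mem_monicFin hG)]
  rw [Finset.sum_congr rfl key, Finset.sum_comm, lCoeff, Finset.mul_sum]
  refine Finset.sum_congr rfl fun F hF => ?_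
  rw [mem_monicFin] at hF
  simp only [Finset.sum_const, nsmul_eq_mul]
  rw [← Finset.sum_mul, ← Nat.cast_sum, ← hF.2, sum_card_normChar_dvd hF.1.ne_zero]

end Newton

section LogDerivative

/-- The negated power sums of a multiset, as a power series without constant term. -/
def negPowerSeries (W : Multiset ℂ) : PowerSeries ℂ :=
  PowerSeries.mk fun n => if n = 0 then 0 else -(W.map fun ω => ω ^ n).sum

lemma negPowerSeries_cons (ω : ℂ) (W : Multiset ℂ) :
    negPowerSeries (ω ::ₘ W) = negPowerSeries {ω} + negPowerSeries W := by
  ext n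
  simp only [negPowerSeries, PowerSeries.coeff_mk, map_add]
  split_ifs
  · simp
  · simp; ring

lemma one_sub_mul_negPowerSeries (ω : ℂ) :
    (1 - PowerSeries.C ω * PowerSeries.X) * negPowerSeries {ω} =
      -(PowerSeries.C ω * PowerSeries.X) := by
  ext n
  rw [sub_mul, one_mul, mul_assoc, map_sub, PowerSeries.coeff_C_mul, map_neg,
    PowerSeries.coeff_C_mul]
  rcases n with _ | _ | n
  · simp [negPowerSeries]
  · simp [negPowerSeries, PowerSeries.coeff_X, PowerSeries.coeff_succ_X_mul]
  · simp [negPowerSeries, PowerSeries.coeff_X, PowerSeries.coeff_succ_X_mul, pow_succ]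
    ring

lemma X_mul_derivative_prod (W : Multiset ℂ) :
    PowerSeries.X * ((W.map fun ω => (1 - C ω * X : ℂ[X])).prod.derivative : PowerSeries ℂ) =
      ((W.map fun ω => (1 - C ω * X : ℂ[X])).prod : PowerSeries ℂ) * negPowerSeries W := by
  induction W using Multiset.induction_on with
  | empty =>
    have : negPowerSeries 0 = 0 := by ext n; simp [negPowerSeries]
    simp [this]
  | cons ω W ih =>
    rw [Multiset.map_cons, Multiset.prod_cons, derivative_mul, negPowerSeries_cons]
    have h1 : ((1 - C ω * X : ℂ[X]) : PowerSeries ℂ) = 1 - PowerSeries.C ω * PowerSeries.X := by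
      simp
    have h2 : ((derivative (1 - C ω * X : ℂ[X]) : ℂ[X]) : PowerSeries ℂ) = - PowerSeries.C ω := by
      simp
    rw [Polynomial.coe_add, Polynomial.coe_mul, Polynomial.coe_mul, Polynomial.coe_mul, h1, h2]
    have h3 := one_sub_mul_negPowerSeries ω
    linear_combination (1 - PowerSeries.C ω * PowerSeries.X) * ih -
      ((W.map fun ω => (1 - C ω * X : ℂ[X])).prod : PowerSeries ℂ) * h3

lemma exists_prod_one_sub {A : ℂ[X]} (hA : A.coeff 0 = 1) :
    ∃ W : Multiset ℂ, W.card ≤ A.natDegree ∧ A = (W.map fun ω => (1 - C ω * X : ℂ[X])).prod := by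
  have hA0 : A ≠ 0 := by rintro rfl; simp at hA
  have hm : A.reverse.Monic := by
    rw [Monic, reverse_leadingCoeff, trailingCoeff_eq_coeff_zero (by rw [hA]; exact one_ne_zero), hA]
  refine ⟨A.reverse.roots, (card_roots' _).trans (reverse_natDegree_le A), ?_⟩
  have h1 : (A.reverse.roots.map fun ω => (X - C ω : ℂ[X])).prod = A.reverse :=
    ((IsAlgClosed.splits A.reverse).eq_prod_roots_of_monic hm).symm
  have h2 : A.reverse.reverse = A := by
    rw [reverse, reverse_natDegree, natTrailingDegree_eq_zero.mpr (Or.inr (by rw [hA]; exact one_ne_zero)),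
      Nat.sub_zero, reverse, reflect_reflect]
  have h3 : ∀ W : Multiset ℂ, (W.map fun ω => (X - C ω : ℂ[X])).prod.reverse =
      (W.map fun ω => (1 - C ω * X : ℂ[X])).prod := fun W => by
    induction W using Multiset.induction_on with
    | empty => simpa using reverse_C (1 : ℂ)
    | cons ω W ih =>
      rw [Multiset.map_cons, Multiset.prod_cons, reverse_mul_of_domain, ih, Multiset.map_cons,
        Multiset.prod_cons]
      congr 1
      rw [reverse, natDegree_X_sub_C, reflect_sub, reflect_one_X, reflect_C, pow_one]
  rw [← h3, h1, h2]

/-- If the coefficients `a` are those of a polynomial, the associated power sums are honest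
(negated) power sums of its inverse roots. -/
lemma exists_powerSums {a S : ℕ → ℂ} {D : ℕ} (ha0 : a 0 = 1) (haD : ∀ n, D ≤ n → a n = 0)
    (hN : ∀ n : ℕ, (n : ℂ) * a n = ∑ i ∈ Finset.Icc 1 n, S i * a (n - i)) :
    ∃ W : Multiset ℂ, W.card ≤ D ∧ ∀ n, 0 < n → S n = -(W.map fun ω => ω ^ n).sum := by
  set A : ℂ[X] := ∑ i ∈ Finset.range D, C (a i) * X ^ i with hA
  have hc : ∀ n, A.coeff n = a n := fun n => by
    rw [hA, finsetSum_coeff]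
    simp only [coeff_C_mul_X_pow, Finset.sum_ite_eq, Finset.mem_range]
    split_ifs with h
    · rfl
    · exact (haD n (not_lt.mp h)).symm
  have hdeg : A.natDegree ≤ D := natDegree_le_iff_coeff_eq_zero.mpr fun n hn => by
    rw [hc, haD n hn.le]
  obtain ⟨W, hW, hAW⟩ := exists_prod_one_sub (A := A) (by rw [hc, ha0])
  refine ⟨W, hW.trans hdeg, fun n hn => ?_⟩
  have h1 := X_mul_derivative_prod W
  rw [← hAW] at h1
  set T : PowerSeries ℂ := PowerSeries.mk fun n => if n = 0 then 0 else S n with hS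
  have h2 : PowerSeries.X * (A.derivative : PowerSeries ℂ) = (A : PowerSeries ℂ) * T := by
    rw [mul_comm _ T]
    ext n
    have hR : PowerSeries.coeff n (T * (A : PowerSeries ℂ)) =
        ∑ i ∈ Finset.range n, S (i + 1) * a (n - (i + 1)) := by
      rw [PowerSeries.coeff_mul, Finset.Nat.sum_antidiagonal_eq_sum_range_succ_mk,
        Finset.sum_range_succ']
      simp [hS, hc]
    rw [hR]
    have := hN n
    rw [← Finset.Ico_add_one_right_eq_Icc, Finset.sum_Ico_eq_sum_range] at this
    rcases n with _ | n
    · simp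
    · rw [PowerSeries.coeff_succ_X_mul, Polynomial.coeff_coe, coeff_derivative, hc, mul_comm]
      push_cast at this
      rw [this]
      simp [add_comm]
  have hAne : (A : PowerSeries ℂ) ≠ 0 := fun h => by
    have := congrArg (PowerSeries.coeff 0) h
    rw [Polynomial.coeff_coe, hc, ha0] at this
    simp at this
  have h3 := mul_left_cancel₀ hAne (h2.symm.trans h1)
  have h4 := congrArg (PowerSeries.coeff n) h3
  simpa [hS, negPowerSeries, hn.ne'] using h4

end LogDerivative

section Bounded

/-- If all large power sums of a finite family are bounded, its members have norm at most one. -/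
lemma norm_le_one_of_bounded_powerSums {W : Multiset ℂ} {B : ℝ} {e₀ : ℕ}
    (h : ∀ e ≥ e₀, ‖(W.map fun ω => ω ^ e).sum‖ ≤ B) {ω : ℂ} (hω : ω ∈ W) : ‖ω‖ ≤ 1 := by
  set T := W.toFinset with hT
  have hsum : ∀ g : ℂ → ℂ, (W.map g).sum = ∑ μ ∈ T, (W.count μ : ℂ) * g μ := fun g => by
    rw [Finset.sum_multiset_map_count]
    simp [hT]
  set P : ℂ[X] := ∏ μ ∈ T.erase ω, (X - C μ) with hP
  have hPω : P.eval ω ≠ 0 := by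
    rw [hP, eval_prod, Finset.prod_ne_zero_iff]
    intro μ hμ
    rw [eval_sub, eval_X, eval_C, sub_ne_zero]
    exact (Finset.ne_of_mem_erase hμ).symm
  have hωT : ω ∈ T := by rwa [hT, Multiset.mem_toFinset]
  have key : ∀ e, (W.count ω : ℂ) * (P.eval ω * ω ^ e) =
      ∑ j ∈ Finset.range (P.natDegree + 1), P.coeff j * (W.map fun ω => ω ^ (e + j)).sum := by
    intro e
    calc _ = ∑ μ ∈ T, (W.count μ : ℂ) * (P.eval μ * μ ^ e) := by
          rw [Finset.sum_eq_single_of_mem ω hωT]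
          intro μ hμ hne
          have : P.eval μ = 0 := by
            rw [hP, eval_prod]
            exact Finset.prod_eq_zero (Finset.mem_erase.mpr ⟨hne, hμ⟩) (by simp)
          rw [this, zero_mul, mul_zero]
      _ = _ := by
          simp_rw [hsum, Finset.mul_sum]
          rw [Finset.sum_comm]
          refine Finset.sum_congr rfl fun μ _ => ?_
          rw [eval_eq_sum_range, Finset.sum_mul, Finset.mul_sum]
          refine Finset.sum_congr rfl fun j _ => ?_
          rw [pow_add]
          ring
  set M : ℝ := ∑ j ∈ Finset.range (P.natDegree + 1), ‖P.coeff j‖ * B with hM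
  have hbound : ∀ e ≥ e₀, ‖(W.count ω : ℂ) * P.eval ω‖ * ‖ω‖ ^ e ≤ M := fun e he => by
    rw [← norm_pow, ← norm_mul, mul_assoc, key]
    refine (norm_sum_le _ _).trans (Finset.sum_le_sum fun j _ => ?_)
    rw [norm_mul]
    exact mul_le_mul_of_nonneg_left (h _ (by omega)) (norm_nonneg _)
  by_contra! hgt
  have hpos : 0 < ‖(W.count ω : ℂ) * P.eval ω‖ := by
    rw [norm_pos_iff]
    refine mul_ne_zero ?_ hPω
    rw [Nat.cast_ne_zero, ← Nat.pos_iff_ne_zero, Multiset.count_pos]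
    exact hω
  obtain ⟨e, he⟩ := pow_unbounded_of_one_lt (M / ‖(W.count ω : ℂ) * P.eval ω‖) hgt
  have h1 := hbound (max e e₀) (le_max_right _ _)
  have h2 : ‖ω‖ ^ e ≤ ‖ω‖ ^ max e e₀ := pow_le_pow_right₀ hgt.le (le_max_left _ _)
  rw [div_lt_iff₀ hpos] at he
  nlinarith

/-- The Riemann hypothesis from bounds along an arithmetic progression of degrees. -/
lemma norm_le_sqrt_of_powerSums {W : Multiset ℂ} {q : ℝ} (hq : 0 < q) {r : ℕ} (hr : 0 < r)
    {B : ℝ} {e₀ : ℕ} (h : ∀ e ≥ e₀, ‖(W.map fun ω => ω ^ (2 * r * e)).sum‖ ≤ B * q ^ (r * e))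
    {ω : ℂ} (hω : ω ∈ W) : ‖ω‖ ≤ √q := by
  have key : ‖ω ^ (2 * r) / (q : ℂ) ^ r‖ ≤ 1 := by
    refine norm_le_one_of_bounded_powerSums (W := W.map fun ω => ω ^ (2 * r) / (q : ℂ) ^ r)
      (B := B) (e₀ := e₀) (fun e he => ?_) (Multiset.mem_map_of_mem _ hω)
    rw [Multiset.map_map]
    have : ((fun ω : ℂ => ω ^ e) ∘ fun ω => ω ^ (2 * r) / (q : ℂ) ^ r) =
        fun ω => ω ^ (2 * r * e) * ((q : ℂ) ^ (r * e))⁻¹ := by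
      funext ω
      simp only [Function.comp_apply]
      rw [div_pow, ← pow_mul, ← pow_mul, div_eq_mul_inv]
    rw [this, Multiset.sum_map_mul_right, norm_mul, norm_inv, norm_pow, Complex.norm_real,
      Real.norm_of_nonneg hq.le, ← div_eq_mul_inv, div_le_iff₀ (by positivity)]
    exact h e he
  rw [norm_div, norm_pow, norm_pow, Complex.norm_real, Real.norm_of_nonneg hq.le,
    div_le_one (by positivity), pow_mul] at key
  exact Real.le_sqrt_of_sq_le ((pow_le_pow_iff_left₀ (by positivity) hq.le hr.ne').mp key)

end Bounded

section HomEval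

variable {k : Type*} [CommRing k] {R : Type*} [CommRing R] [Algebra k R]

/-- Evaluation at `(a, b)` of the homogenization of degree `n` of a polynomial. -/
def homEval (a b : R) (n : ℕ) (F : k[X]) : R := MvPolynomial.aeval ![a, b] (F.homogenize n)

lemma homEval_eq_sum (a b : R) (n : ℕ) (F : k[X]) :
    homEval a b n F = ∑ ij ∈ Finset.HasAntidiagonal.antidiagonal n, algebraMap k R (F.coeff ij.1) * (a ^ ij.1 * b ^ ij.2) := by
  rw [homEval, homogenize, map_sum]
  refine Finset.sum_congr rfl fun ij _ => ?_
  rw [MvPolynomial.aeval_monomial, Finsupp.prod_fintype _ _ (by simp), Fin.prod_univ_two]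
  simp

lemma homEval_mul (a b : R) {m n : ℕ} {F G : k[X]} (hF : F.natDegree ≤ m) (hG : G.natDegree ≤ n) :
    homEval a b (m + n) (F * G) = homEval a b m F * homEval a b n G := by
  rw [homEval, homogenize_mul _ _ hF hG, map_mul]; rfl

lemma homEval_one (a b : R) : homEval a b 0 (1 : k[X]) = 1 := by
  simp [homEval]

lemma homEval_X_sub_C (a b : R) (x : k) : homEval a b 1 (X - C x) = a - algebraMap k R x * b := by
  rw [homEval_eq_sum, Finset.Nat.antidiagonal_succ]
  simp [coeff_X, coeff_C]
  ring

lemma homEval_prod_X_sub_C (a b : R) {ι : Type*} (s : Finset ι) (x : ι → k) :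
    homEval a b s.card (∏ i ∈ s, (X - C (x i))) = ∏ i ∈ s, (a - algebraMap k R (x i) * b) := by
  induction s using Finset.cons_induction with
  | empty => simp [homEval_one]
  | cons i s hi ih =>
    rw [Finset.prod_cons, Finset.prod_cons, Finset.card_cons, add_comm s.card, homEval_mul _ _
      (natDegree_X_sub_C_le _), homEval_X_sub_C, ih]
    refine (natDegree_prod_le _ _).trans ?_
    rw [Finset.card_eq_sum_ones]
    exact Finset.sum_le_sum fun i _ => natDegree_X_sub_C_le _

lemma homEval_prod {ι : Type*} (a b : R) (s : Finset ι) (F : ι → k[X]) {n : ℕ}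
    (hF : ∀ i ∈ s, (F i).natDegree ≤ n) :
    homEval a b (s.card * n) (∏ i ∈ s, F i) = ∏ i ∈ s, homEval a b n (F i) := by
  have := homogenize_finsetProd (n := fun _ => n) hF
  rw [Finset.sum_const, smul_eq_mul] at this
  rw [homEval, this, map_prod]
  rfl

lemma homEval_smul (c a b : R) (n : ℕ) (F : k[X]) :
    homEval (c * a) (c * b) n F = c ^ n * homEval a b n F := by
  rw [homEval_eq_sum, homEval_eq_sum, Finset.mul_sum]
  refine Finset.sum_congr rfl fun ij hij => ?_
  rw [Finset.HasAntidiagonal.mem_antidiagonal] at hij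
  rw [← hij, mul_pow, mul_pow, pow_add]
  ring

lemma map_homEval {k' : Type*} [CommRing k'] {S : Type*} [CommRing S] [Algebra k' S]
    (σ : k →+* k') (φ : R →+* S) (h : ∀ x, φ (algebraMap k R x) = algebraMap k' S (σ x))
    (a b : R) (n : ℕ) (F : k[X]) :
    φ (homEval a b n F) = homEval (φ a) (φ b) n (F.map σ) := by
  rw [homEval_eq_sum, homEval_eq_sum, map_sum]
  refine Finset.sum_congr rfl fun ij hij => ?_
  simp [h]

end HomEval

section NormDescent

open TensorProduct

variable (k₀ k' R₀ : Type*) [Field k₀] [Fintype k₀] [Field k'] [Algebra k₀ k'] [CommRing R₀]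
  [Algebra k₀ R₀]

/-- The Frobenius power acting on the coefficients of a scalar extension. -/
def frobTensor (i : ℕ) : k' ⊗[k₀] R₀ →ₐ[k₀] k' ⊗[k₀] R₀ :=
  Algebra.TensorProduct.map (frobPow k₀ k' i) (AlgHom.id k₀ R₀)

variable {k₀ k' R₀}

lemma frobTensor_tmul (i : ℕ) (x : k') (r : R₀) :
    frobTensor k₀ k' R₀ i (x ⊗ₜ r) = (x ^ Fintype.card k₀ ^ i) ⊗ₜ r := by
  simp [frobTensor, frobPow_apply]

lemma frobTensor_comp (i j : ℕ) (a : k' ⊗[k₀] R₀) :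
    frobTensor k₀ k' R₀ i (frobTensor k₀ k' R₀ j a) = frobTensor k₀ k' R₀ (i + j) a := by
  induction a using TensorProduct.induction_on with
  | zero => simp
  | add x y hx hy => simp only [map_add, hx, hy]
  | tmul x r => rw [frobTensor_tmul, frobTensor_tmul, frobTensor_tmul, ← pow_mul, ← pow_add, add_comm]

lemma frobTensor_eq_self {r : ℕ} (hr : ∀ x : k', x ^ Fintype.card k₀ ^ r = x) (a : k' ⊗[k₀] R₀) :
    frobTensor k₀ k' R₀ r a = a := by
  induction a using TensorProduct.induction_on with
  | zero => simp
  | add x y hx hy => simp only [map_add, hx, hy]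
  | tmul x s => rw [frobTensor_tmul, hr]

lemma exists_includeRight_of_frobTensor {a : k' ⊗[k₀] R₀} (ha : frobTensor k₀ k' R₀ 1 a = a) :
    ∃ s : R₀, Algebra.TensorProduct.includeRight s = a := by
  set b := Module.Free.chooseBasis k₀ R₀
  set B := Algebra.TensorProduct.basis k' b with hB
  have h1 : ∀ a : k' ⊗[k₀] R₀, ∀ i, B.repr (frobTensor k₀ k' R₀ 1 a) i =
      B.repr a i ^ Fintype.card k₀ := fun a i => by
    induction a using TensorProduct.induction_on with
    | zero => simp [Fintype.card_ne_zero]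
    | add x y hx hy =>
      rw [map_add, map_add, map_add, Finsupp.add_apply, Finsupp.add_apply, hx, hy]
      have := map_add (frobPow k₀ k' 1) (B.repr x i) (B.repr y i)
      simp only [frobPow_apply, pow_one] at this
      rw [this]
    | tmul x r =>
      rw [frobTensor_tmul, hB, Algebra.TensorProduct.basis_repr_tmul,
        Algebra.TensorProduct.basis_repr_tmul]
      simp only [Finsupp.smul_apply, Finsupp.mapRange_apply, smul_eq_mul, mul_pow, pow_one]
      rw [← map_pow, FiniteField.pow_card]
  have h2 := h1 a
  rw [ha] at h2
  choose c hc using fun i => exists_algebraMap_of_pow_card (h2 i).symm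
  refine ⟨∑ i ∈ (B.repr a).support, c i • b i, ?_⟩
  rw [map_sum]
  conv_rhs => rw [← B.linearCombination_repr a, Finsupp.linearCombination_apply, Finsupp.sum]
  refine Finset.sum_congr rfl fun i _ => ?_
  rw [map_smul, ← hc, hB, Algebra.TensorProduct.basis_apply, Algebra.TensorProduct.includeRight_apply,
    algebraMap_smul]

lemma includeRight_tensor_injective :
    Function.Injective (Algebra.TensorProduct.includeRight : R₀ →ₐ[k₀] k' ⊗[k₀] R₀) :=
  Algebra.TensorProduct.includeRight_injective (algebraMap k₀ k').injective

/-- The norm from a scalar extension of a finite field down to the base. -/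
lemma exists_normDescent {r : ℕ} (hr : ∀ x : k', x ^ Fintype.card k₀ ^ r = x) :
    ∃ N : k' ⊗[k₀] R₀ →* R₀, ∀ a, Algebra.TensorProduct.includeRight (N a) =
      ∏ i ∈ Finset.range r, frobTensor k₀ k' R₀ i a := by
  have h1 : ∀ a : k' ⊗[k₀] R₀, ∃ s : R₀, Algebra.TensorProduct.includeRight s =
      ∏ i ∈ Finset.range r, frobTensor k₀ k' R₀ i a := fun a => by
    apply exists_includeRight_of_frobTensor
    rw [map_prod]
    simp_rw [frobTensor_comp, add_comm 1]
    have h0 : frobTensor k₀ k' R₀ 0 a = frobTensor k₀ k' R₀ r a := by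
      rw [frobTensor_eq_self hr, frobTensor_eq_self (fun x => by simp)]
    cases r with
    | zero => simp
    | succ r =>
      rw [Finset.prod_range_succ, Finset.prod_range_succ' _ r, h0]
  choose N hN using h1
  refine ⟨⟨⟨N, ?_⟩, ?_⟩, hN⟩
  · apply includeRight_tensor_injective (k₀ := k₀) (k' := k')
    rw [hN, map_one]
    exact Finset.prod_eq_one fun i _ => map_one _
  · intro a b
    apply includeRight_tensor_injective (k₀ := k₀) (k' := k')
    rw [hN, map_mul, hN, hN, ← Finset.prod_mul_distrib]
    simp

end NormDescent

section Twist

open TensorProduct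

variable {k₀ k' Ω : Type*} [Field k₀] [Fintype k₀] [Field k'] [Fintype k'] [Algebra k₀ k']
  [Field Ω] [Algebra k₀ Ω] [Algebra k' Ω] [IsScalarTower k₀ k' Ω]

lemma prod_range_mul_eq {M : Type*} [CommMonoid M] (f : ℕ → M) (r m : ℕ) :
    ∏ l ∈ Finset.range (r * m), f l =
      ∏ i ∈ Finset.range r, ∏ s ∈ Finset.range m, f (r * s + i) := by
  induction m with
  | zero => simp
  | succ m ih =>
    simp_rw [Finset.prod_range_succ, Finset.prod_mul_distrib]
    rw [mul_add, mul_one, Finset.prod_range_add, ih]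

/-- The characteristic polynomial over the small field is the norm of the one over the big field. -/
lemma map_normChar_mul {r m : ℕ} (hr : Fintype.card k' = Fintype.card k₀ ^ r) (hr0 : 0 < r)
    (hm : 0 < m) {α : Ω} (hα : α ^ Fintype.card k' ^ m = α) :
    (normChar k₀ (r * m) α).map (algebraMap k₀ k') =
      ∏ i ∈ Finset.range r, (normChar k' m α).map (frobPow k₀ k' i : k' →+* k') := by
  apply Polynomial.map_injective (algebraMap k' Ω) (algebraMap k' Ω).injective
  have hα0 : α ^ Fintype.card k₀ ^ (r * m) = α := by rwa [pow_mul, ← hr]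
  rw [Polynomial.map_map, ← IsScalarTower.algebraMap_eq, map_normChar (Nat.mul_pos hr0 hm) hα0,
    Polynomial.map_prod, prod_range_mul_eq]
  refine Finset.prod_congr rfl fun i _ => ?_
  have hcomm : (algebraMap k' Ω).comp (frobPow k₀ k' i : k' →+* k') =
      (frobPow k₀ Ω i : Ω →+* Ω).comp (algebraMap k' Ω) := by
    ext x; simp [frobPow_apply]
  rw [Polynomial.map_map, hcomm, ← Polynomial.map_map, map_normChar hm hα, Polynomial.map_prod]
  refine Finset.prod_congr rfl fun s _ => ?_
  simp only [Polynomial.map_sub, map_X, map_C, RingHom.coe_coe, frobPow_apply]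
  rw [← pow_mul, hr, ← pow_mul, pow_add]

/-- A descent of the norm polynomial of `α - t`. -/
def twistPoly (t : k') (m : ℕ) (α : Ω) : k'[X] :=
  homEval (1 - C t * X) (-X) m (normChar k' m α)

lemma map_twistPoly (t : k') {m : ℕ} (hm : 0 < m) {α : Ω} (hα : α ^ Fintype.card k' ^ m = α) :
    (twistPoly t m α).map (algebraMap k' Ω) = normPoly k' (α - algebraMap k' Ω t) m := by
  have h := map_homEval (k := k') (S := Ω [X]) (algebraMap k' Ω) (mapRingHom (algebraMap k' Ω))
    (fun x => by simp) (1 - C t * X) (-X) m (normChar k' m α)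
  rw [coe_mapRingHom] at h
  rw [twistPoly, h, map_normChar hm hα]
  have h2 := homEval_prod_X_sub_C (k := Ω) (((1 - C t * X : k'[X])).map (algebraMap k' Ω))
    ((-X : k'[X]).map (algebraMap k' Ω)) (Finset.range m) (fun l => α ^ Fintype.card k' ^ l)
  rw [Finset.card_range] at h2
  rw [h2, normPoly]
  refine Finset.prod_congr rfl fun l _ => ?_
  have h3 := map_sub (frobPow k' Ω l) α (algebraMap k' Ω t)
  simp only [frobPow_apply, ← map_pow, FiniteField.pow_card_pow] at h3
  rw [h3]
  simp
  ring

variable {R₀ : Type*} [CommRing R₀] [Algebra k₀ R₀]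

lemma unit_pow_mul_aeval_twistPoly (t : k') (c₀ c₁ : R₀) (c : (k' ⊗[k₀] R₀)ˣ)
    (hc : (c : k' ⊗[k₀] R₀) = 1 ⊗ₜ c₀ - t • 1 ⊗ₜ c₁) (m : ℕ) (α : Ω) :
    (c : k' ⊗[k₀] R₀) ^ m * aeval (-(1 ⊗ₜ c₁) * ((c⁻¹ : (k' ⊗[k₀] R₀)ˣ) : k' ⊗[k₀] R₀))
      (twistPoly t m α) = homEval (1 ⊗ₜ c₀) (1 ⊗ₜ c₁) m (normChar k' m α) := by
  set u := -(1 ⊗ₜ c₁ : k' ⊗[k₀] R₀) * ((c⁻¹ : (k' ⊗[k₀] R₀)ˣ) : k' ⊗[k₀] R₀) with hu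
  have hcu : (c : k' ⊗[k₀] R₀) * u = -(1 ⊗ₜ c₁) := by
    rw [hu, mul_comm, mul_assoc, Units.inv_mul, mul_one]
  have h := map_homEval (k := k') (RingHom.id k') (aeval u : k'[X] →ₐ[k'] k' ⊗[k₀] R₀).toRingHom
    (fun x => by simp) (1 - C t * X) (-X) m (normChar k' m α)
  rw [Polynomial.map_id] at h
  have h' : aeval u (twistPoly t m α) =
      homEval (1 - t • u) (-u) m (normChar k' m α) := by
    rw [twistPoly]
    refine h.trans ?_
    simp [Algebra.smul_def]
  rw [h', ← homEval_smul]
  congr 1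
  · rw [mul_sub, mul_smul_comm, hcu, hc]; simp
  · rw [mul_neg, hcu, neg_neg]

lemma includeRight_homEval {r m : ℕ} (hr : Fintype.card k' = Fintype.card k₀ ^ r) (hr0 : 0 < r)
    (hm : 0 < m) {α : Ω} (hα : α ^ Fintype.card k' ^ m = α) (c₀ c₁ : R₀) :
    (1 ⊗ₜ homEval c₀ c₁ (r * m) (normChar k₀ (r * m) α) : k' ⊗[k₀] R₀) =
      ∏ i ∈ Finset.range r, frobTensor k₀ k' R₀ i
        (homEval (1 ⊗ₜ c₀) (1 ⊗ₜ c₁) m (normChar k' m α)) := by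
  have h1 := map_homEval (k := k₀) (R := R₀) (k' := k') (S := k' ⊗[k₀] R₀) (algebraMap k₀ k')
    (Algebra.TensorProduct.includeRight : R₀ →ₐ[k₀] k' ⊗[k₀] R₀).toRingHom
    (fun x => by simp [Algebra.TensorProduct.algebraMap_apply, Algebra.TensorProduct.tmul_one_eq_one_tmul])
    c₀ c₁ (r * m) (normChar k₀ (r * m) α)
  refine h1.trans ?_
  rw [map_normChar_mul hr hr0 hm hα]
  have h2 := homEval_prod (k := k') (1 ⊗ₜ c₀ : k' ⊗[k₀] R₀) (1 ⊗ₜ c₁) (Finset.range r)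
    (fun i => (normChar k' m α).map (frobPow k₀ k' i : k' →+* k')) (n := m)
    (fun i _ => natDegree_map_le.trans (natDegree_normChar hm hα).le)
  rw [Finset.card_range] at h2
  refine h2.trans (Finset.prod_congr rfl fun i _ => ?_)
  have h3 := map_homEval (k := k') (R := k' ⊗[k₀] R₀) (k' := k') (S := k' ⊗[k₀] R₀)
    (frobPow k₀ k' i : k' →+* k') (frobTensor k₀ k' R₀ i : k' ⊗[k₀] R₀ →+* k' ⊗[k₀] R₀)
    (fun x => by
      simp [Algebra.TensorProduct.algebraMap_apply, frobTensor_tmul, frobPow_apply])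
    (1 ⊗ₜ c₀) (1 ⊗ₜ c₁) m (normChar k' m α)
  simp only [RingHom.coe_coe, frobTensor_tmul, one_pow] at h3
  exact h3.symm

end Twist

section Regular

variable {k : Type*} [Field k] [Fintype k] {Ω : Type*} [Field Ω] [Algebra k Ω]
  {R : Type*} [CommRing R] [Algebra k R] {d : Type*} [Fintype d] [DecidableEq d]
  (b : Module.Basis d k R)

lemma extMat_leftMulMatrix_aeval (u : R) (E : k[X]) :
    extMat Ω (Algebra.leftMulMatrix b (aeval u E)) =
      aeval (extMat Ω (Algebra.leftMulMatrix b u)) (E.map (algebraMap k Ω)) := by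
  have h := mapMatrix_aeval (Algebra.ofId k Ω) (Algebra.leftMulMatrix b u) E
  have h1 : extMat k (Algebra.leftMulMatrix b u) = Algebra.leftMulMatrix b u := by
    ext i j; simp
  rw [h1, aeval_algHom_apply] at h
  exact h

lemma isUnit_of_isUnit_leftMulMatrix {a : R} (h : IsUnit (Algebra.leftMulMatrix b a)) :
    IsUnit a := by
  obtain ⟨V, hV⟩ := h.exists_right_inv
  refine IsUnit.of_mul_eq_one (b.equivFun.symm (V.mulVec (b.repr 1))) ?_
  apply b.repr.injective
  apply DFunLike.coe_injective
  rw [← Algebra.leftMulMatrix_mulVec_repr]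
  have : ⇑(b.repr (b.equivFun.symm (V.mulVec (b.repr 1)))) = V.mulVec (b.repr 1) := by
    rw [← Module.Basis.equivFun_apply, LinearEquiv.apply_symm_apply]
  rw [this, Matrix.mulVec_mulVec, hV, Matrix.one_mulVec]

lemma isGood_of_isUnit {u : R} {β : Ω} {m : ℕ} (hm : 0 < m) {E : k[X]}
    (hE : E.map (algebraMap k Ω) = normPoly k β m) (h : IsUnit (aeval u E)) :
    IsGood (Algebra.leftMulMatrix b u) β := by
  have h1 : IsUnit (extMat Ω (Algebra.leftMulMatrix b (aeval u E))) :=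
    (h.map (Algebra.leftMulMatrix b)).map (algebraMap k Ω).mapMatrix
  rw [extMat_leftMulMatrix_aeval, hE] at h1
  have h2 : (1 + C β * X : Polynomial Ω) ∣ normPoly k β m := by
    have := Finset.dvd_prod_of_mem (fun i => 1 + C (β ^ Fintype.card k ^ i) * X)
      (Finset.mem_range.mpr hm)
    rw [normPoly]; simpa using this
  obtain ⟨G, hG⟩ := h2
  rw [hG, map_mul] at h1
  have h4 := (Matrix.isUnit_iff_isUnit_det _).mp h1
  rw [Matrix.det_mul] at h4
  have h3 := isUnit_of_mul_isUnit_left h4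
  have h5 : aeval (extMat Ω (Algebra.leftMulMatrix b u)) (1 + C β * X : Polynomial Ω) =
      1 + β • extMat Ω (Algebra.leftMulMatrix b u) := by
    simp [Algebra.smul_def]
  rw [h5] at h3
  exact h3.ne_zero

lemma exists_mem_of_isGood {u : R} {β : Ω} {m : ℕ} {E : k[X]}
    (hE : E.map (algebraMap k Ω) = normPoly k β m) (g : Matrix d d k) :
    extMat Ω g = aeval (extMat Ω (Algebra.leftMulMatrix b u)) (normPoly k β m) ↔
      g = Algebra.leftMulMatrix b (aeval u E) := by
  rw [← hE, ← extMat_leftMulMatrix_aeval]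
  exact ⟨fun h => extMat_injective h, fun h => by rw [h]⟩

/-- The number of bad points is at most the size of the matrix. -/
lemma card_bad_le (U : Matrix d d k) (T : Finset Ω) (hT : ∀ β ∈ T, ¬ IsGood U β) :
    T.card ≤ Fintype.card d := by
  set P : Polynomial Ω := ((X : Polynomial Ω) • ((extMat Ω U).map (C : Ω →+* Polynomial Ω) : Matrix d d (Polynomial Ω)) +
    ((1 : Matrix d d Ω).map (C : Ω →+* Polynomial Ω) : Matrix d d (Polynomial Ω))).det with hP
  have heval : ∀ β, P.eval β = (1 + β • extMat Ω U).det := fun β => by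
    have h := (evalRingHom β).map_det ((X : Polynomial Ω) •
      ((extMat Ω U).map (C : Ω →+* Polynomial Ω) : Matrix d d (Polynomial Ω)) +
      ((1 : Matrix d d Ω).map (C : Ω →+* Polynomial Ω) : Matrix d d (Polynomial Ω)))
    rw [coe_evalRingHom] at h
    refine h.trans (congrArg Matrix.det ?_)
    ext i j
    simp only [evalRingHom]
    rcases eq_or_ne i j with rfl | h
    · simp; ring
    · simp [h]; ring
  have hP0 : P ≠ 0 := fun h => by
    have := heval 0
    rw [h] at this
    simp at this
  calc T.card ≤ P.roots.toFinset.card := by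
        refine Finset.card_le_card fun β hβ => ?_
        rw [Multiset.mem_toFinset, mem_roots hP0, IsRoot.def, heval]
        exact not_not.mp (hT β hβ)
    _ ≤ P.natDegree := (Multiset.toFinset_card_le _).trans (card_roots' P)
    _ ≤ _ := natDegree_det_X_add_C_le _ _

end Regular

/-- The values at `u` of the norm polynomials which are units lie in, and are equidistributed over,
a subgroup of the group of units. -/
theorem exists_unit_distribution {k : Type*} [Field k] [Fintype k] (Ω : Type*) [Field Ω]
    [IsAlgClosed Ω] [Algebra k Ω] {R : Type*} [CommRing R] [Algebra k R] {d : Type*} [Fintype d]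
    [DecidableEq d] (b : Module.Basis d k R) (u : R) :
    ∃ Δ : Subgroup Rˣ,
    (∀ (n : ℕ) (β : Ω) (E : k[X]), 0 < n → β ^ Fintype.card k ^ n = β →
      E.map (algebraMap k Ω) = normPoly k β n → IsUnit (aeval u E) →
      ∃ g ∈ Δ, (g : R) = aeval u E) ∧
    (∀ (n : ℕ) (T : Finset Ω), (∀ β ∈ T, β ^ Fintype.card k ^ n = β ∧
      ∃ E : k[X], E.map (algebraMap k Ω) = normPoly k β n ∧ ¬ IsUnit (aeval u E)) →
      T.card ≤ Fintype.card d) ∧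
    ∃ B e₀ : ℕ, ∀ e ≥ e₀, ∀ g ∈ Δ, ∀ T : Finset Ω, (∀ β ∈ T, β ^ Fintype.card k ^ (2 * e) = β ∧
      ∃ E : k[X], E.map (algebraMap k Ω) = normPoly k β (2 * e) ∧ (g : R) = aeval u E) →
      T.card * Nat.card Δ ≤ Fintype.card k ^ (2 * e) + B * Fintype.card k ^ e := by
  obtain ⟨Γ, h1, B, e₀, h2⟩ := exists_norm_distribution (Algebra.leftMulMatrix b u) Ω
  have hLM : Function.Injective (Algebra.leftMulMatrix b) := Algebra.leftMulMatrix_injective b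
  let L : Rˣ →* (Matrix d d k)ˣ := Units.map (Algebra.leftMulMatrix b : R →* Matrix d d k)
  have hL : Function.Injective L := Units.map_injective hLM
  refine ⟨Γ.comap L, fun n β E hn hβ hE hu => ?_, fun n T hT => ?_, B, max e₀ 1,
    fun e he g hg T hT => ?_⟩
  · obtain ⟨g, hg, hgE⟩ := h1 n β hβ (isGood_of_isUnit b hn hE hu)
    rw [exists_mem_of_isGood b hE] at hgE
    refine ⟨hu.unit, ?_, rfl⟩
    rw [Subgroup.mem_comap]
    convert hg
    ext1
    rw [hgE]
    rfl
  · refine card_bad_le (Algebra.leftMulMatrix b u) T fun β hβ hgood => ?_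
    obtain ⟨h, E, hE, hu⟩ := hT β hβ
    obtain ⟨g, hg, hgE⟩ := h1 n β h hgood
    rw [exists_mem_of_isGood b hE] at hgE
    exact hu (isUnit_of_isUnit_leftMulMatrix b (hgE ▸ g.isUnit))
  · have hcard : Nat.card (Γ.comap L) ≤ Fintype.card Γ := by
      rw [← Nat.card_eq_fintype_card]
      refine Nat.card_le_card_of_injective (fun x : Γ.comap L => (⟨L x.1, x.2⟩ : Γ)) ?_
      intro x y h
      exact Subtype.ext (hL (congrArg Subtype.val h))
    refine (Nat.mul_le_mul_left _ hcard).trans (h2 e (le_trans (le_max_left _ _) he) (L g) hg T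
      fun β hβ => ?_)
    obtain ⟨h, E, hE, hu⟩ := hT β hβ
    have he' : 0 < 2 * e := by have := le_trans (le_max_right _ _) he; omega
    refine ⟨h, isGood_of_isUnit b he' hE (hu ▸ g.isUnit), ?_⟩
    rw [exists_mem_of_isGood b hE, ← hu]
    rfl

/-- An upper bound for the sizes of the fibres over a group gives cancellation in sums of
characters. -/
lemma norm_sum_le_of_card_fiber_le {ι G : Type*} [Group G] [Fintype G] (s : Finset ι) (φ : ι → G)
    (ψ : G →* ℂ) (hψ : ∃ g, ψ g ≠ 1) {M : ℝ}
    (hM : ∀ g, ((s.filter fun i => φ i = g).card : ℝ) * Fintype.card G ≤ M) :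
    ‖∑ i ∈ s, ψ (φ i)‖ ≤ M - s.card := by
  have hsum : ∑ g, ψ g = 0 := by
    obtain ⟨g₀, hg₀⟩ := hψ
    have h : ψ g₀ * ∑ g, ψ g = ∑ g, ψ g := by
      rw [Finset.mul_sum]
      simp_rw [← map_mul]
      exact Fintype.sum_equiv (Equiv.mulLeft g₀) _ _ fun g => rfl
    have h2 : (ψ g₀ - 1) * ∑ g, ψ g = 0 := by rw [sub_mul, h, one_mul, sub_self]
    exact (mul_eq_zero.mp h2).resolve_left (sub_ne_zero.mpr hg₀)
  have hnorm : ∀ g, ‖ψ g‖ = 1 := fun g => by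
    refine Complex.norm_eq_one_of_pow_eq_one (n := Fintype.card G) ?_ Fintype.card_ne_zero
    rw [← map_pow, pow_card_eq_one, map_one]
  have hG : (0 : ℝ) < Fintype.card G := by exact_mod_cast Fintype.card_pos
  have h1 : ∑ i ∈ s, ψ (φ i) = ∑ g, ((s.filter fun i => φ i = g).card : ℂ) * ψ g := by
    rw [← Finset.sum_fiberwise s φ]
    refine Finset.sum_congr rfl fun g _ => ?_
    rw [← nsmul_eq_mul, ← Finset.sum_const]
    exact Finset.sum_congr rfl fun i hi => by rw [(Finset.mem_filter.mp hi).2]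
  have h2 : ∑ i ∈ s, ψ (φ i) =
      -∑ g, (((M / Fintype.card G - (s.filter fun i => φ i = g).card : ℝ)) : ℂ) * ψ g := by
    rw [h1]
    simp only [Complex.ofReal_sub, sub_mul, Finset.sum_sub_distrib, ← Finset.mul_sum, hsum]
    simp
  have h3 : ∑ g, ((s.filter fun i => φ i = g).card : ℝ) = s.card := by
    exact_mod_cast (Finset.card_eq_sum_card_fiberwise fun i _ => Finset.mem_coe.mpr (Finset.mem_univ (φ i))).symm
  rw [h2, norm_neg]
  refine (norm_sum_le _ _).trans ?_
  calc _ = ∑ g, (M / Fintype.card G - (s.filter fun i => φ i = g).card : ℝ) := by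
        refine Finset.sum_congr rfl fun g _ => ?_
        rw [norm_mul, hnorm, mul_one, Complex.norm_real, Real.norm_of_nonneg]
        rw [sub_nonneg, le_div_iff₀ hG]
        exact hM g
    _ ≤ M - s.card := by
        apply le_of_eq
        rw [Finset.sum_sub_distrib, h3, Finset.sum_const, Finset.card_univ, nsmul_eq_mul]
        field_simp

section HomChar

variable {k : Type*} [Field k] {R : Type*} [CommRing R] [Algebra k R]

/-- A multiplicative character evaluated at the homogenization of a polynomial. -/
def homChar (χ : MulChar R ℂ) (c₀ c₁ : R) (F : k[X]) : ℂ := χ (homEval c₀ c₁ F.natDegree F)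

lemma homEval_mul_natDegree (c₀ c₁ : R) {F G : k[X]} (hF : F.Monic) (hG : G.Monic) :
    homEval c₀ c₁ (F * G).natDegree (F * G) =
      homEval c₀ c₁ F.natDegree F * homEval c₀ c₁ G.natDegree G := by
  rw [hF.natDegree_mul hG, homEval_mul _ _ le_rfl le_rfl]

lemma homChar_mul (χ : MulChar R ℂ) (c₀ c₁ : R) (F G : k[X]) (hF : F.Monic) (hG : G.Monic) :
    homChar χ c₀ c₁ (F * G) = homChar χ c₀ c₁ F * homChar χ c₀ c₁ G := by
  rw [homChar, homEval_mul_natDegree _ _ hF hG, map_mul]; rfl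

lemma homChar_one (χ : MulChar R ℂ) (c₀ c₁ : R) : homChar χ c₀ c₁ (1 : k[X]) = 1 := by
  rw [homChar, natDegree_one, homEval_one, map_one]

lemma homChar_pow (χ : MulChar R ℂ) (c₀ c₁ : R) {F : k[X]} (hF : F.Monic) (n : ℕ) :
    homChar χ c₀ c₁ (F ^ n) = homChar χ c₀ c₁ F ^ n := by
  induction n with
  | zero => simp [homChar_one]
  | succ n ih => rw [pow_succ, homChar_mul _ _ _ _ _ (hF.pow n) hF, ih, pow_succ]

lemma norm_mulChar_le_one [Finite R] (χ : MulChar R ℂ) (a : R) : ‖χ a‖ ≤ 1 := by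
  by_cases h : IsUnit a
  · obtain ⟨v, rfl⟩ := h
    refine (Complex.norm_eq_one_of_pow_eq_one (n := Nat.card Rˣ) ?_ Nat.card_pos.ne').le
    rw [← map_pow, ← Units.val_pow_eq_pow_val, pow_card_eq_one', Units.val_one, map_one]
  · rw [MulChar.map_nonunit _ h]; simp

lemma norm_homChar_le_one [Finite R] (χ : MulChar R ℂ) (c₀ c₁ : R) (F : k[X]) :
    ‖homChar χ c₀ c₁ F‖ ≤ 1 := norm_mulChar_le_one _ _

end HomChar

section Twisted

open TensorProduct

variable {k₀ k' Ω : Type*} [Field k₀] [Fintype k₀] [Field k'] [Fintype k'] [Algebra k₀ k']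
  [Field Ω] [IsAlgClosed Ω] [Algebra k₀ Ω] [Algebra k' Ω] [IsScalarTower k₀ k' Ω]
  {R₀ : Type*} [CommRing R₀] [Finite R₀] [Algebra k₀ R₀]

lemma mulChar_pow_eq (χ : MulChar R₀ ℂ) {r : ℕ} (hr0 : 0 < r) (hrx : ∀ x : R₀ˣ, x ^ r = x)
    (a : R₀) : χ a ^ r = χ a := by
  by_cases h : IsUnit a
  · obtain ⟨v, rfl⟩ := h
    rw [← map_pow, ← Units.val_pow_eq_pow_val, hrx]
  · rw [MulChar.map_nonunit _ h, zero_pow hr0.ne']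

theorem powerSum_bound_or (χ : MulChar R₀ ℂ) {r : ℕ}
    (hr : Fintype.card k' = Fintype.card k₀ ^ r) (hr0 : 0 < r) (hrx : ∀ x : R₀ˣ, x ^ r = x)
    (c₀ c₁ : R₀) (t : k') (c : (k' ⊗[k₀] R₀)ˣ)
    (hc : (c : k' ⊗[k₀] R₀) = 1 ⊗ₜ c₀ - t • 1 ⊗ₜ c₁) :
    (∃ B e₀ : ℕ, ∀ e ≥ e₀, ‖powerSum k₀ Ω (homChar χ c₀ c₁) (r * (2 * e))‖ ≤
      B * (Fintype.card k₀ : ℝ) ^ (r * e)) ∨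
    ∃ z : ℂ, z ≠ 0 ∧ ∀ F : k₀[X], F.Monic → IsUnit (homEval c₀ c₁ F.natDegree F) →
      homChar χ c₀ c₁ F = z ^ F.natDegree := by
  obtain ⟨N, hN⟩ := exists_normDescent (R₀ := R₀) (k₀ := k₀) (k' := k') (r := r)
    (fun x => by rw [← hr, FiniteField.pow_card])
  have : Module.Finite k₀ R₀ := Module.Finite.of_finite
  set u := -(1 ⊗ₜ c₁ : k' ⊗[k₀] R₀) * ((c⁻¹ : (k' ⊗[k₀] R₀)ˣ) : k' ⊗[k₀] R₀) with hu
  obtain ⟨Δ, h1, h2, B, e₀, h3⟩ := exists_unit_distribution Ω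
    (Module.finBasis k' (k' ⊗[k₀] R₀)) u
  have : Finite (k' ⊗[k₀] R₀) := Module.finite_of_finite k'
  have key : ∀ (m : ℕ) (α : Ω), 0 < m → α ^ Fintype.card k' ^ m = α →
      homEval c₀ c₁ (r * m) (normChar k₀ (r * m) α) =
        N c ^ m * N (aeval u (twistPoly t m α)) := fun m α hm hα => by
    apply includeRight_tensor_injective (k₀ := k₀) (k' := k')
    rw [← map_pow, ← map_mul, hN, unit_pow_mul_aeval_twistPoly t c₀ c₁ c hc]
    exact includeRight_homEval hr hr0 hm hα c₀ c₁
  have hunit : ∀ a, IsUnit (N a) → IsUnit a := fun a ha => by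
    have h := ha.map (Algebra.TensorProduct.includeRight : R₀ →ₐ[k₀] k' ⊗[k₀] R₀)
    rw [hN] at h
    have h0 := isUnit_of_dvd_unit (Finset.dvd_prod_of_mem _ (Finset.mem_range.mpr hr0)) h
    have h00 : frobTensor k₀ k' R₀ 0 a = a := frobTensor_eq_self (by simp) a
    rwa [h00] at h0
  have hshift : ∀ (m : ℕ) (α : Ω), α ^ Fintype.card k' ^ m = α →
      (α - algebraMap k' Ω t) ^ Fintype.card k' ^ m = α - algebraMap k' Ω t := fun m α hα => by
    have h := map_sub (frobPow k' Ω m) α (algebraMap k' Ω t)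
    simp only [frobPow_apply, ← map_pow, FiniteField.pow_card_pow] at h
    rw [h, hα]
  have : Finite Δ := Subtype.finite
  let : Fintype Δ := Fintype.ofFinite Δ
  let ψ : Δ →* ℂ := χ.toMonoidHom.comp (N.comp ((Units.coeHom _).comp Δ.subtype))
  have hψ : ∀ g : Δ, ψ g = χ (N ((g : (k' ⊗[k₀] R₀)ˣ) : k' ⊗[k₀] R₀)) := fun g => rfl
  by_cases hΔ : ∃ g, ψ g ≠ 1
  · left
    set d := Module.finrank k' (k' ⊗[k₀] R₀) with hd
    refine ⟨B + d, max e₀ 1, fun e he => ?_⟩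
    have he0 : e₀ ≤ e := (le_max_left _ _).trans he
    have hm : 0 < 2 * e := by have := (le_max_right _ _).trans he; omega
    set m := 2 * e with hme
    have hrm : 0 < r * m := Nat.mul_pos hr0 hm
    set S := fixedFinset k₀ Ω (r * m) with hS
    have hmem : ∀ α ∈ S, α ^ Fintype.card k' ^ m = α := fun α hα => by
      rw [hS, mem_fixedFinset hrm] at hα
      rwa [hr, ← pow_mul]
    set S₁ := S.filter fun α => IsUnit (aeval u (twistPoly t m α)) with hS₁
    have hex : ∀ α : Ω, ∃ g : Δ, α ∈ S₁ →
        ((g : (k' ⊗[k₀] R₀)ˣ) : k' ⊗[k₀] R₀) = aeval u (twistPoly t m α) := fun α => by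
      by_cases hα : α ∈ S₁
      · rw [hS₁, Finset.mem_filter] at hα
        obtain ⟨g, hg, hgE⟩ := h1 m (α - algebraMap k' Ω t) (twistPoly t m α) hm
          (hshift m α (hmem α hα.1)) (map_twistPoly t hm (hmem α hα.1)) hα.2
        exact ⟨⟨g, hg⟩, fun _ => hgE⟩
      · exact ⟨1, fun h => absurd h hα⟩
    choose φ hφ using hex
    have hsum : powerSum k₀ Ω (homChar χ c₀ c₁) (r * m) = χ (N c) ^ m * ∑ α ∈ S₁, ψ (φ α) := by
      rw [powerSum, Finset.mul_sum, hS₁, Finset.sum_filter]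
      refine Finset.sum_congr rfl fun α hα => ?_
      have hα0 := hα
      rw [mem_fixedFinset hrm] at hα0
      rw [homChar, natDegree_normChar hrm hα0, key m α hm (hmem α hα), map_mul, map_pow]
      split_ifs with h
      · rw [hψ, hφ α (Finset.mem_filter.mpr ⟨hα, h⟩)]
      · rw [MulChar.map_nonunit _ fun h' => h (hunit _ h'), mul_zero]
    have hcardS : S.card = Fintype.card k' ^ m := by
      rw [hS, card_fixedFinset hrm, hr, ← pow_mul]
    have hS₁card : Fintype.card k' ^ m ≤ S₁.card + d := by
      rw [← hcardS, hS₁, ← Finset.card_filter_add_card_filter_not (s := S)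
        (fun α => IsUnit (aeval u (twistPoly t m α)))]
      refine Nat.add_le_add_left ?_ _
      rw [← Finset.card_map (addRightEmbedding (-algebraMap k' Ω t))]
      refine (h2 m _ fun β hβ => ?_).trans (by simp [hd])
      rw [Finset.mem_map] at hβ
      obtain ⟨α, hα, rfl⟩ := hβ
      rw [Finset.mem_filter] at hα
      simp only [addRightEmbedding_apply, ← sub_eq_add_neg]
      exact ⟨hshift m α (hmem α hα.1), _, map_twistPoly t hm (hmem α hα.1), hα.2⟩
    have hfib := norm_sum_le_of_card_fiber_le S₁ φ ψ hΔ
      (M := Fintype.card k' ^ m + B * Fintype.card k' ^ e) fun g => by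
        have h := h3 e he0 g g.2 ((S₁.filter fun α => φ α = g).map
          (addRightEmbedding (-algebraMap k' Ω t))) fun β hβ => by
            rw [Finset.mem_map] at hβ
            obtain ⟨α, hα, rfl⟩ := hβ
            rw [Finset.mem_filter] at hα
            have hαS := (Finset.mem_filter.mp hα.1).1
            simp only [addRightEmbedding_apply, ← sub_eq_add_neg]
            exact ⟨hshift m α (hmem α hαS), _, map_twistPoly t hm (hmem α hαS),
              by rw [← hα.2]; exact hφ α hα.1⟩
        rw [Finset.card_map, Nat.card_eq_fintype_card] at h
        rw [← hme] at h
        have h' : (((S₁.filter fun α => φ α = g).card : ℕ) : ℝ) * Fintype.card Δ ≤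
          Fintype.card k' ^ m + B * Fintype.card k' ^ e := by exact_mod_cast h
        convert h'
    rw [hsum, norm_mul, norm_pow]
    have hQ : (1 : ℝ) ≤ (Fintype.card k' : ℝ) ^ e :=
      one_le_pow₀ (by exact_mod_cast Fintype.card_pos)
    have hS₁card' : (Fintype.card k' : ℝ) ^ m ≤ S₁.card + d := by exact_mod_cast hS₁card
    have hc1 : ‖χ (N c)‖ ^ m ≤ 1 := pow_le_one₀ (norm_nonneg _) (norm_mulChar_le_one _ _)
    calc _ ≤ 1 * ‖∑ α ∈ S₁, ψ (φ α)‖ := by gcongr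
      _ ≤ Fintype.card k' ^ m + B * Fintype.card k' ^ e - S₁.card := by rw [one_mul]; exact hfib
      _ ≤ (B + d : ℝ) * Fintype.card k' ^ e := by
        have : (d : ℝ) * 1 ≤ d * (Fintype.card k' : ℝ) ^ e := by gcongr
        linarith
      _ = _ := by rw [hr]; push_cast; rw [← pow_mul]
  · right
    push Not at hΔ
    have hirr : ∀ P : k₀[X], P.Monic → Irreducible P → IsUnit (homEval c₀ c₁ P.natDegree P) →
        homChar χ c₀ c₁ P = χ (N c) ^ P.natDegree := fun P hP hPi hPu => by
      obtain ⟨α, hα⟩ := IsAlgClosed.exists_aeval_eq_zero Ω P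
        (degree_pos_of_irreducible hPi).ne'
      have hmin : P = minpoly k₀ α := minpoly.eq_of_irreducible_of_monic hPi hα hP
      have hint : IsIntegral k₀ α := ⟨P, hP, hα⟩
      obtain ⟨l, hl, hlα⟩ := exists_pow_card_pow_eq hint
      obtain ⟨-, hn, hdvd⟩ := map_minpoly_eq_prod hl hlα
      rw [← hmin] at hn hdvd
      set n := P.natDegree with hnP
      have hα1 : α ^ Fintype.card k' ^ n = α := by
        rw [hr, ← pow_mul]; exact (hdvd _).mpr (Dvd.intro_left _ rfl)
      have hnc : normChar k₀ (r * n) α = P ^ r := by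
        rw [normChar, ← hmin, ← hnP, Nat.mul_div_cancel _ hn]
      have hk := key n α hn hα1
      rw [hnc] at hk
      have hdeg : (P ^ r).natDegree = r * n := by rw [natDegree_pow]
      have hχ : homChar χ c₀ c₁ P = χ (homEval c₀ c₁ (r * n) (P ^ r)) := by
        rw [← hdeg]
        exact (mulChar_pow_eq χ hr0 hrx _).symm.trans (homChar_pow χ c₀ c₁ hP r).symm
      have hu1 : IsUnit (homEval c₀ c₁ (r * n) (P ^ r)) := by
        by_contra h
        rw [MulChar.map_nonunit _ h] at hχ
        exact (hPu.map χ).ne_zero hχ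
      rw [hk] at hu1
      obtain ⟨g, hg, hgE⟩ := h1 n (α - algebraMap k' Ω t) (twistPoly t n α) hn
          (hshift n α hα1) (map_twistPoly t hn hα1) (hunit _ (isUnit_of_mul_isUnit_right hu1))
      have h4 := hΔ ⟨g, hg⟩
      rw [hψ] at h4
      simp only at h4
      rw [hχ, hk, ← hgE, map_mul, map_pow, h4, mul_one]
    refine ⟨χ (N c), ((c.isUnit.map N).map χ).ne_zero, fun F => ?_⟩
    induction hn : F.natDegree using Nat.strong_induction_on generalizing F with
    | _ n ih =>
      intro hF hFu
      rcases Nat.eq_zero_or_pos n with h0 | h0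
      · rw [h0] at hn ⊢
        rw [hF.natDegree_eq_zero.mp hn, homChar_one, pow_zero]
      · obtain ⟨P, hP, hPi, G, rfl⟩ := exists_monic_irreducible_factor F
          (fun h => by rw [natDegree_eq_zero_of_isUnit h] at hn; omega)
        have hG : G.Monic := hP.of_mul_monic_left hF
        rw [← hn, homEval_mul_natDegree _ _ hP hG] at hFu
        have hdeg := hP.natDegree_mul hG
        have hPpos := hPi.natDegree_pos
        rw [homChar_mul _ _ _ _ _ hP hG, hirr P hP hPi (isUnit_of_mul_isUnit_left hFu),
          ih G.natDegree (by omega) G rfl hG (isUnit_of_mul_isUnit_right hFu), ← hn, hdeg, pow_add]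

end Twisted

section PowerSumBound

variable {k : Type*} [Field k] [Fintype k] {R : Type*} [CommRing R] [Finite R] [Algebra k R]

open TensorProduct in
lemma exists_unit_twist {k' : Type*} [Field k'] [Algebra k k'] {F : k[X]} {t : k'}
    (ht : aeval t F = 0) (hF : F.Monic) {c₀ c₁ : R} (h : IsUnit (homEval c₀ c₁ F.natDegree F)) :
    IsUnit (1 ⊗ₜ c₀ - t • 1 ⊗ₜ c₁ : k' ⊗[k] R) := by
  have h1 := map_homEval (k := k) (R := R) (k' := k') (S := k' ⊗[k] R) (algebraMap k k')
    (Algebra.TensorProduct.includeRight : R →ₐ[k] k' ⊗[k] R).toRingHom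
    (fun x => by simp [Algebra.TensorProduct.algebraMap_apply,
      Algebra.TensorProduct.tmul_one_eq_one_tmul]) c₀ c₁ F.natDegree F
  have h2 := h.map (Algebra.TensorProduct.includeRight : R →ₐ[k] k' ⊗[k] R).toRingHom
  rw [h1] at h2
  obtain ⟨G, hG⟩ : X - C t ∣ F.map (algebraMap k k') := by
    rwa [dvd_iff_isRoot, IsRoot.def, eval_map_algebraMap]
  have hdeg : F.natDegree = 1 + G.natDegree := by
    have hm := hF.map (algebraMap k k')
    rw [hG] at hm
    have hGm : G.Monic := (monic_X_sub_C t).of_mul_monic_left hm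
    rw [← hF.natDegree_map (algebraMap k k'), hG, (monic_X_sub_C t).natDegree_mul hGm,
      natDegree_X_sub_C]
  rw [hG, hdeg, homEval_mul _ _ (natDegree_X_sub_C_le t) le_rfl, homEval_X_sub_C] at h2
  have h3 := isUnit_of_mul_isUnit_left h2
  rw [← Algebra.smul_def] at h3
  exact h3

lemma sum_pow_le_two_mul {q : ℕ} (hq : 2 ≤ q) (m : ℕ) :
    ∑ i ∈ Finset.Icc 1 m, q ^ i ≤ 2 * q ^ m := by
  induction m with
  | zero => simp
  | succ m ih =>
    rw [Finset.sum_Icc_succ_top (by omega), pow_succ]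
    nlinarith [Nat.one_le_pow m q (by omega)]

lemma pow_half_le_sqrt_pow {q : ℝ} (hq : 1 ≤ q) (n : ℕ) : q ^ (n / 2) ≤ √q ^ n := by
  have h : q ^ (n / 2) = √q ^ (2 * (n / 2)) := by rw [pow_mul, Real.sq_sqrt (by linarith)]
  rw [h]
  exact pow_le_pow_right₀ (Real.one_le_sqrt.mpr hq) (Nat.mul_div_le n 2)

/-- The power sums of a multiplicative function and its sums over irreducible polynomials. -/
lemma norm_sum_irreducible_sub_powerSum_le (Ω : Type*) [Field Ω] [IsAlgClosed Ω] [Algebra k Ω]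
    {Ψ : k[X] → ℂ} (hΨ : ∀ F, ‖Ψ F‖ ≤ 1) {n : ℕ} (hn : 0 < n) :
    ‖(n : ℂ) * ∑ P ∈ (monicFin k n).filter Irreducible, Ψ P - powerSum k Ω Ψ n‖ ≤
      2 * √(Fintype.card k : ℝ) ^ n := by
  have hq : 2 ≤ Fintype.card k := Fintype.one_lt_card
  set S := fixedFinset k Ω n with hS
  have hmem : ∀ α ∈ S, α ^ Fintype.card k ^ n = α := fun α hα => (mem_fixedFinset hn).mp hα
  have h1 : ∑ α ∈ S.filter (fun α => (minpoly k α).natDegree = n), Ψ (normChar k n α) =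
      (n : ℂ) * ∑ P ∈ (monicFin k n).filter Irreducible, Ψ P := by
    have hmaps : ∀ α ∈ S.filter (fun α => (minpoly k α).natDegree = n),
        minpoly k α ∈ (monicFin k n).filter Irreducible := fun α hα => by
      rw [Finset.mem_filter] at hα
      have hm := monic_minpoly hn (hmem α hα.1)
      have hint : IsIntegral k α := by
        by_contra h
        rw [minpoly.eq_zero h, natDegree_zero] at hα
        omega
      rw [Finset.mem_filter, mem_monicFin]
      exact ⟨⟨hm, hα.2⟩, minpoly.irreducible hint⟩
    rw [← Finset.sum_fiberwise_of_maps_to hmaps, Finset.mul_sum]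
    refine Finset.sum_congr rfl fun P hP => ?_
    rw [Finset.mem_filter, mem_monicFin] at hP
    obtain ⟨⟨hPm, hPd⟩, hPi⟩ := hP
    have hfib : (S.filter (fun α => (minpoly k α).natDegree = n)).filter
        (fun α => minpoly k α = P) = (P.aroots Ω).toFinset := by
      ext α
      rw [Finset.mem_filter, Finset.mem_filter, Multiset.mem_toFinset, mem_aroots]
      constructor
      · rintro ⟨-, rfl⟩
        exact ⟨hPm.ne_zero, minpoly.aeval _ _⟩
      · rintro ⟨-, hα⟩
        have hmin := (minpoly.eq_of_irreducible_of_monic hPi hα hPm).symm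
        obtain ⟨l, hl, hlα⟩ := exists_pow_card_pow_eq (k := k) (α := α) ⟨P, hPm, hα⟩
        obtain ⟨-, -, hd⟩ := map_minpoly_eq_prod hl hlα
        refine ⟨⟨?_, by rw [hmin, hPd]⟩, hmin⟩
        rw [hS, mem_fixedFinset hn, hd, hmin, hPd]
    have hcard : ((P.aroots Ω).toFinset).card = n := by
      rw [Multiset.toFinset_card_of_nodup (nodup_aroots_iff_of_splits hPm.ne_zero
        (IsAlgClosed.splits _) |>.mpr (PerfectField.separable_of_irreducible hPi)), aroots,
        ← (IsAlgClosed.splits _).natDegree_eq_card_roots, hPm.natDegree_map, hPd]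
    rw [hfib, ← hcard, ← nsmul_eq_mul, ← Finset.sum_const]
    refine Finset.sum_congr rfl fun α hα => ?_
    rw [← hfib, Finset.mem_filter, Finset.mem_filter] at hα
    rw [hcard, normChar, hα.1.2, Nat.div_self hn, pow_one, hα.2]
  rw [← h1, powerSum, ← hS, ← Finset.sum_filter_add_sum_filter_not S
    (fun α => (minpoly k α).natDegree = n), sub_add_cancel_left, norm_neg]
  refine (norm_sum_le _ _).trans ((Finset.sum_le_card_nsmul _ _ 1 fun α _ => hΨ _).trans ?_)
  rw [nsmul_eq_mul, mul_one]
  have hsub : S.filter (fun α => ¬ (minpoly k α).natDegree = n) ⊆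
      (Finset.Icc 1 (n / 2)).biUnion fun i => fixedFinset k Ω i := fun α hα => by
    rw [Finset.mem_filter] at hα
    obtain ⟨-, h0, hd⟩ := map_minpoly_eq_prod hn (hmem α hα.1)
    obtain ⟨c, hc⟩ := (hd n).mp (hmem α hα.1)
    rw [Finset.mem_biUnion]
    refine ⟨(minpoly k α).natDegree, ?_, (mem_fixedFinset h0).mpr ((hd _).mpr dvd_rfl)⟩
    rw [Finset.mem_Icc]
    refine ⟨h0, ?_⟩
    have hc2 : 2 ≤ c := by
      by_contra h
      have : c = 0 ∨ c = 1 := by omega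
      rcases this with rfl | rfl
      · omega
      · exact hα.2 (by omega)
    rw [Nat.le_div_iff_mul_le two_pos, hc]
    exact Nat.mul_le_mul_left _ hc2
  have hle : (S.filter (fun α => ¬ (minpoly k α).natDegree = n)).card ≤
      2 * Fintype.card k ^ (n / 2) := by
    refine (Finset.card_le_card hsub).trans (Finset.card_biUnion_le.trans
      (le_trans (le_of_eq ?_) (sum_pow_le_two_mul hq (n / 2))))
    exact Finset.sum_congr rfl fun i hi => card_fixedFinset (Finset.mem_Icc.mp hi).1
  calc _ ≤ ((2 * Fintype.card k ^ (n / 2) : ℕ) : ℝ) := by exact_mod_cast hle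
    _ = 2 * (Fintype.card k : ℝ) ^ (n / 2) := by push_cast; rfl
    _ ≤ _ := by
      gcongr
      exact pow_half_le_sqrt_pow (by exact_mod_cast (by omega : 1 ≤ Fintype.card k)) n

/-- The Riemann hypothesis bound for sums of a character over irreducible polynomials. -/
theorem norm_sum_irreducible_le (χ : MulChar R ℂ) (c₀ c₁ : R) {D : ℕ}
    (hD : ∀ n, D ≤ n → lCoeff (homChar χ c₀ c₁ : k[X] → ℂ) n = 0)
    (hunit : ∀ F : k[X], F.Monic → Irreducible F → D ≤ F.natDegree →
      IsUnit (homEval c₀ c₁ F.natDegree F)) {n : ℕ} (hn : 0 < n) :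
    ‖(n : ℂ) * ∑ P ∈ (monicFin k n).filter Irreducible, homChar χ c₀ c₁ P‖ ≤
      (D + 2) * √(Fintype.card k : ℝ) ^ n := by
  have hq : 2 ≤ Fintype.card k := Fintype.one_lt_card
  obtain ⟨p, hp⟩ := CharP.exists k
  have : Fact p.Prime := ⟨CharP.char_is_prime k p⟩
  set r := 1 + Nat.card Rˣ * D with hr
  have hr0 : 0 < r := by omega
  have hrD : D ≤ r := (Nat.le_mul_of_pos_left D (Nat.card_pos (α := Rˣ))).trans (by omega)
  have : NeZero r := ⟨hr0.ne'⟩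
  have hrx : ∀ x : Rˣ, x ^ r = x := fun x => by
    rw [hr, pow_add, pow_mul, pow_card_eq_one', one_pow, mul_one, pow_one]
  let k' := FiniteField.Extension k p r
  let : Fintype k' := Fintype.ofFinite k'
  have hcard : Fintype.card k' = Fintype.card k ^ r := by
    rw [← Nat.card_eq_fintype_card, FiniteField.natCard_extension, Nat.card_eq_fintype_card]
  let Ω := AlgebraicClosure k'
  obtain ⟨t, ht⟩ := Field.exists_primitive_element k k'
  have hint : IsIntegral k t := IsIntegral.of_finite k t
  have hdeg : (minpoly k t).natDegree = r := by
    rw [(Field.primitive_element_iff_minpoly_natDegree_eq k t).mp ht,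
      FiniteField.finrank_extension]
  have hmon := minpoly.monic hint
  have hirr := minpoly.irreducible hint
  have hF : IsUnit (homEval c₀ c₁ (minpoly k t).natDegree (minpoly k t)) :=
    hunit _ hmon hirr (hrD.trans hdeg.ge)
  obtain ⟨c, hc⟩ := exists_unit_twist (minpoly.aeval k t) hmon hF
  rcases powerSum_bound_or (Ω := Ω) χ hcard hr0 hrx c₀ c₁ t c hc with ⟨B, e₀, h⟩ | ⟨z, hz, h⟩
  · have ha0 : lCoeff (homChar χ c₀ c₁ : k[X] → ℂ) 0 = 1 := by
      rw [lCoeff, monicFin_zero, Finset.sum_singleton, homChar_one]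
    obtain ⟨W, hW, hS⟩ := exists_powerSums ha0 hD
      (newton_lCoeff (Ω := Ω) (homChar_mul (k := k) χ c₀ c₁))
    have hω : ∀ ω ∈ W, ‖ω‖ ≤ √(Fintype.card k : ℝ) := fun ω hω => by
      refine norm_le_sqrt_of_powerSums (by positivity) hr0 (B := B) (e₀ := max e₀ 1)
        (fun e he => ?_) hω
      have h1 := h e ((le_max_left _ _).trans he)
      have he1 : 0 < e := (le_max_right e₀ 1).trans he
      rw [hS _ (by positivity), norm_neg, show r * (2 * e) = 2 * r * e by ring] at h1
      exact h1
    have h1 := norm_sum_irreducible_sub_powerSum_le Ω (norm_homChar_le_one (k := k) χ c₀ c₁) hn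
    have h2 : ‖powerSum k Ω (homChar χ c₀ c₁) n‖ ≤ D * √(Fintype.card k : ℝ) ^ n := by
      rw [hS n hn, norm_neg]
      refine (Multiset.le_sum_of_subadditive norm norm_zero.le norm_add_le _).trans ?_
      rw [Multiset.map_map]
      refine (Multiset.sum_le_card_nsmul _ (√(Fintype.card k : ℝ) ^ n) fun x hx => ?_).trans ?_
      · obtain ⟨ω, h, rfl⟩ := Multiset.mem_map.mp hx
        simp only [Function.comp_apply, norm_pow]
        exact pow_le_pow_left₀ (norm_nonneg _) (hω ω h) n
      · rw [Multiset.card_map, nsmul_eq_mul]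
        gcongr
    rw [add_mul]
    have h3 := norm_sub_norm_le
      ((n : ℂ) * ∑ P ∈ (monicFin k n).filter Irreducible, homChar χ c₀ c₁ P)
      (powerSum k Ω (homChar χ c₀ c₁) n)
    linarith
  · exfalso
    have h0 := hD r hrD
    have h1 : lCoeff (homChar χ c₀ c₁ : k[X] → ℂ) r =
        ((monicFin k r).filter fun F => IsUnit (homEval c₀ c₁ F.natDegree F)).card * z ^ r := by
      rw [lCoeff, ← nsmul_eq_mul, ← Finset.sum_const, Finset.sum_filter]
      refine Finset.sum_congr rfl fun F hF => ?_
      rw [mem_monicFin] at hF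
      split_ifs with hu
      · rw [h F hF.1 hu, hF.2]
      · rw [homChar, MulChar.map_nonunit _ hu]
    rw [h1, mul_eq_zero] at h0
    have h2 := h0.resolve_right (pow_ne_zero _ hz)
    rw [Nat.cast_eq_zero, Finset.card_eq_zero] at h2
    refine Finset.notMem_empty (minpoly k t) (h2 ▸ ?_)
    rw [Finset.mem_filter, mem_monicFin]
    exact ⟨⟨hmon, hdeg⟩, hF⟩

end PowerSumBound

lemma isUnit_quotient_mk_iff {A : Type*} [CommRing A] {f g : A} :
    IsUnit (Ideal.Quotient.mk (Ideal.span {g}) f) ↔ IsCoprime f g := by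
  rw [isUnit_iff_exists_inv]
  constructor
  · rintro ⟨b, hb⟩
    obtain ⟨b, rfl⟩ := Ideal.Quotient.mk_surjective b
    rw [← map_mul, ← map_one (Ideal.Quotient.mk (Ideal.span {g})), Ideal.Quotient.eq,
      Ideal.mem_span_singleton] at hb
    obtain ⟨c, hc⟩ := hb
    exact ⟨b, -c, by linear_combination hc⟩
  · rintro ⟨a, b, h⟩
    refine ⟨Ideal.Quotient.mk _ a, ?_⟩
    rw [← map_mul, ← map_one (Ideal.Quotient.mk (Ideal.span {g})), Ideal.Quotient.eq,
      Ideal.mem_span_singleton]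
    exact ⟨-b, by linear_combination h⟩

lemma sum_comp_of_surjective {A B : Type*} [AddCommGroup A] [AddCommGroup B] [Fintype A] [Fintype B]
    (φ : A →+ B) (hφ : Function.Surjective φ) (h : B → ℂ) :
    (Fintype.card B : ℂ) * ∑ a, h (φ a) = Fintype.card A * ∑ b, h b := by
  choose s hs using hφ
  have h1 : ∀ b, ∑ a, h (φ a) = ∑ a, h (φ a + b) := fun b => by
    rw [← Equiv.sum_comp (Equiv.addRight (s b))]
    simp [hs]
  have h2 : ∑ b : B, ∑ a, h (φ a + b) = Fintype.card B * ∑ a, h (φ a) := by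
    rw [Finset.sum_congr rfl fun b _ => (h1 b).symm, Finset.sum_const, Finset.card_univ,
      nsmul_eq_mul]
  have h3 : ∀ a, ∑ b, h (φ a + b) = ∑ b, h b := fun a => Equiv.sum_comp (Equiv.addLeft (φ a)) h
  rw [← h2, Finset.sum_comm, Finset.sum_congr rfl fun a _ => h3 a, Finset.sum_const,
    Finset.card_univ, nsmul_eq_mul]

section PolyFin

variable (k : Type*) [Field k] [Fintype k]

/-- The finite set of polynomials of degree less than `m` over a finite field. -/
def polyFin (m : ℕ) : Finset k[X] :=
  (Finset.univ : Finset (Fin m → k)).map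
    ⟨fun a => ((degreeLTEquiv k m).symm a : k[X]),
      Subtype.val_injective.comp (degreeLTEquiv k m).symm.injective⟩

variable {k}

lemma mem_polyFin {m : ℕ} {f : k[X]} : f ∈ polyFin k m ↔ f.degree < m := by
  simp only [polyFin, Finset.mem_map, Finset.mem_univ, true_and, Function.Embedding.coeFn_mk]
  constructor
  · rintro ⟨a, rfl⟩
    exact mem_degreeLT.mp (Subtype.prop _)
  · intro hf
    exact ⟨degreeLTEquiv k m ⟨f, mem_degreeLT.mpr hf⟩, by simp⟩

lemma card_polyFin (m : ℕ) : (polyFin k m).card = Fintype.card k ^ m := by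
  simp [polyFin]

lemma mem_polyFin_succ {n : ℕ} {f : k[X]} : f ∈ polyFin k (n + 1) ↔ f.natDegree ≤ n := by
  rw [mem_polyFin, degree_lt_iff_coeff_zero, natDegree_le_iff_coeff_eq_zero]
  rfl

/-- A surjective additive map equidistributes the polynomials of bounded degree. -/
lemma sum_polyFin_comp {B : Type*} [AddCommGroup B] [Fintype B] (φ : k[X] →+ B) {m : ℕ}
    (hφ : ∀ b, ∃ f : k[X], f.degree < m ∧ φ f = b) (h : B → ℂ) :
    (Fintype.card B : ℂ) * ∑ f ∈ polyFin k m, h (φ f) = (Fintype.card k : ℂ) ^ m * ∑ b, h b := by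
  have := sum_comp_of_surjective
    ((φ.comp (degreeLT k m).subtype.toAddMonoidHom).comp
      (degreeLTEquiv k m).symm.toLinearMap.toAddMonoidHom) (fun b => by
        obtain ⟨f, h1, h2⟩ := hφ b
        exact ⟨degreeLTEquiv k m ⟨f, mem_degreeLT.mpr h1⟩, by simpa using h2⟩) h
  rw [Fintype.card_fun, Fintype.card_fin, Nat.cast_pow] at this
  rw [polyFin, Finset.sum_map, ← this]
  rfl

/-- The polynomials of degree exactly `n`. -/
def degFin (k : Type*) [Field k] [Fintype k] (n : ℕ) : Finset k[X] :=
  (polyFin k (n + 1)).filter fun f => f.coeff n ≠ 0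

lemma sum_polyFin_succ {M : Type*} [AddCommMonoid M] (n : ℕ) (h : k[X] → M) :
    ∑ f ∈ polyFin k (n + 1), h f = ∑ f ∈ polyFin k n, h f + ∑ f ∈ degFin k n, h f := by
  rw [← Finset.sum_filter_add_sum_filter_not _ fun f => f.coeff n = 0]
  congr 2
  ext f
  rw [Finset.mem_filter, mem_polyFin, mem_polyFin, degree_lt_iff_coeff_zero,
    degree_lt_iff_coeff_zero]
  constructor
  · rintro ⟨h1, h2⟩ m hm
    rcases hm.eq_or_lt with rfl | hm
    exacts [h2, h1 m hm]
  · exact fun h1 => ⟨fun m hm => h1 m (by omega), h1 n le_rfl⟩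

lemma polyFin_zero : polyFin k 0 = {0} := by
  ext f
  rw [mem_polyFin, Finset.mem_singleton, degree_lt_iff_coeff_zero]
  exact ⟨fun h => ext fun n => by simpa using h n (Nat.zero_le n), by rintro rfl; simp⟩

lemma sum_polyFin_eq {M : Type*} [AddCommMonoid M] (N : ℕ) (h : k[X] → M) :
    ∑ f ∈ polyFin k N, h f = h 0 + ∑ n ∈ Finset.range N, ∑ f ∈ degFin k n, h f := by
  induction N with
  | zero => simp [polyFin_zero]
  | succ N ih => rw [sum_polyFin_succ, ih, Finset.sum_range_succ, add_assoc]

lemma mem_degFin {n : ℕ} {f : k[X]} : f ∈ degFin k n ↔ f ≠ 0 ∧ f.natDegree = n := by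
  rw [degFin, Finset.mem_filter, mem_polyFin_succ]
  constructor
  · rintro ⟨h1, h2⟩
    exact ⟨by rintro rfl; simp at h2, le_antisymm h1 (le_natDegree_of_ne_zero h2)⟩
  · rintro ⟨h1, rfl⟩
    exact ⟨le_rfl, by simpa using h1⟩

lemma sum_degFin (n : ℕ) (h : k[X] → ℂ) :
    ∑ f ∈ degFin k n, h f = ∑ a : kˣ, ∑ P ∈ monicFin k n, h (C (a : k) * P) := by
  rw [← Finset.sum_product']
  refine Finset.sum_bij' (fun f hf => (Units.mk0 f.leadingCoeff
    (leadingCoeff_ne_zero.mpr (mem_degFin.mp hf).1), C f.leadingCoeff⁻¹ * f))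
    (fun x _ => C (x.1 : k) * x.2) ?_ ?_ ?_ ?_ ?_
  · intro f hf
    obtain ⟨h1, h2⟩ := mem_degFin.mp hf
    have h3 := leadingCoeff_ne_zero.mpr h1
    simp only [Finset.mem_product, Finset.mem_univ, true_and, mem_monicFin]
    refine ⟨?_, by rw [natDegree_C_mul (inv_ne_zero h3), h2]⟩
    rw [Monic, leadingCoeff_mul, leadingCoeff_C, inv_mul_cancel₀ h3]
  · rintro ⟨a, P⟩ hx
    simp only [Finset.mem_product, Finset.mem_univ, true_and, mem_monicFin] at hx
    rw [mem_degFin]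
    exact ⟨mul_ne_zero (by simp) hx.1.ne_zero, by rw [natDegree_C_mul (by simp), hx.2]⟩
  · intro f hf
    have h3 := leadingCoeff_ne_zero.mpr (mem_degFin.mp hf).1
    simp only [Units.val_mk0]
    rw [← mul_assoc, ← C_mul, mul_inv_cancel₀ h3, C_1, one_mul]
  · rintro ⟨a, P⟩ hx
    simp only [Finset.mem_product, Finset.mem_univ, true_and, mem_monicFin] at hx
    have h4 : (C (a : k) * P).leadingCoeff = a := by
      rw [leadingCoeff_mul, leadingCoeff_C, hx.1.leadingCoeff, mul_one]
    refine Prod.ext (Units.ext (by simpa using h4)) ?_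
    simp only [h4]
    rw [← mul_assoc, ← C_mul, inv_mul_cancel₀ (by simp), C_1, one_mul]
  · intro f hf
    have h3 := leadingCoeff_ne_zero.mpr (mem_degFin.mp hf).1
    simp only [Units.val_mk0]
    rw [← mul_assoc, ← C_mul, mul_inv_cancel₀ h3, C_1, one_mul]

end PolyFin

section ResidueRing

variable {k : Type*} [Field k]

/-- Residues modulo `g` at the finite places and modulo `X ^ j` at the infinite place. -/
abbrev ResRing (g : k[X]) (j : ℕ) : Type _ :=
  (k[X] ⧸ Ideal.span {g}) × (k[X] ⧸ Ideal.span {(X : k[X]) ^ j})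

/-- The residue of a polynomial of degree at most `n`. -/
def resMap (g : k[X]) (j n : ℕ) : k[X] →+ ResRing g j where
  toFun f := (Ideal.Quotient.mk _ f, Ideal.Quotient.mk _ (f.reflect n))
  map_zero' := by simp
  map_add' f f' := by simp [reflect_add]

lemma resMap_apply (g : k[X]) (j n : ℕ) (f : k[X]) :
    resMap g j n f = (Ideal.Quotient.mk _ f, Ideal.Quotient.mk _ (f.reflect n)) := rfl

/-- The homogeneous coordinates whose associated homogeneous evaluation is `resMap`. -/
abbrev pt₀ (g : k[X]) (j : ℕ) : ResRing g j := (Ideal.Quotient.mk _ X, 1)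

/-- The homogeneous coordinates whose associated homogeneous evaluation is `resMap`. -/
abbrev pt₁ (g : k[X]) (j : ℕ) : ResRing g j := (1, Ideal.Quotient.mk _ X)

lemma homEval_X_one {n : ℕ} {F : k[X]} (hF : F.natDegree ≤ n) : homEval X (1 : k[X]) n F = F := by
  rw [homEval_eq_sum, Finset.Nat.sum_antidiagonal_eq_sum_range_succ_mk]
  conv_rhs => rw [F.as_sum_range' (n + 1) (Nat.lt_succ_of_le hF)]
  refine Finset.sum_congr rfl fun i _ => ?_
  rw [one_pow, mul_one, algebraMap_eq, C_mul_X_pow_eq_monomial]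

lemma homEval_one_X (n : ℕ) (F : k[X]) (hF : F.natDegree ≤ n) :
    homEval (1 : k[X]) X n F = F.reflect n := by
  rw [homEval_eq_sum, Finset.Nat.sum_antidiagonal_eq_sum_range_succ_mk]
  ext m
  rw [coeff_reflect, finsetSum_coeff]
  simp only [one_pow, one_mul, algebraMap_eq, coeff_C_mul, coeff_X_pow]
  by_cases hm : m ≤ n
  · rw [revAt_le hm, Finset.sum_eq_single (n - m)]
    · rw [if_pos (by omega), mul_one]
    · intro i hi hne
      rw [Finset.mem_range] at hi
      rw [if_neg (by omega), mul_zero]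
    · intro hi
      exact absurd (Finset.mem_range.mpr (by omega)) hi
  · rw [revAt_eq_self_of_lt (by omega), coeff_eq_zero_of_natDegree_lt (by omega)]
    refine Finset.sum_eq_zero fun i hi => ?_
    rw [if_neg (by omega), mul_zero]

lemma homEval_pt (g : k[X]) (j : ℕ) {n : ℕ} {F : k[X]} (hF : F.natDegree ≤ n) :
    homEval (pt₀ g j) (pt₁ g j) n F = resMap g j n F := by
  refine Prod.ext ?_ ?_
  · have h1 := map_homEval (RingHom.id k) (RingHom.fst (k[X] ⧸ Ideal.span {g})
      (k[X] ⧸ Ideal.span {(X : k[X]) ^ j})) (fun _ => rfl) (pt₀ g j) (pt₁ g j) n F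
    have h2 := map_homEval (RingHom.id k) (Ideal.Quotient.mk (Ideal.span {g})) (fun _ => rfl)
      X (1 : k[X]) n F
    rw [homEval_X_one hF] at h2
    simpa [resMap_apply] using h1.trans h2.symm
  · have h1 := map_homEval (RingHom.id k) (RingHom.snd (k[X] ⧸ Ideal.span {g})
      (k[X] ⧸ Ideal.span {(X : k[X]) ^ j})) (fun _ => rfl) (pt₀ g j) (pt₁ g j) n F
    have h2 := map_homEval (RingHom.id k) (Ideal.Quotient.mk (Ideal.span {(X : k[X]) ^ j}))
      (fun _ => rfl) (1 : k[X]) X n F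
    rw [homEval_one_X n F hF] at h2
    simpa [resMap_apply] using h1.trans h2.symm

lemma isCoprime_X_pow_iff {j : ℕ} (hj : 0 < j) {f : k[X]} :
    IsCoprime f (X ^ j) ↔ f.coeff 0 ≠ 0 := by
  rw [IsCoprime.pow_right_iff hj, isCoprime_comm, irreducible_X.coprime_iff_not_dvd, X_dvd_iff]

lemma isUnit_resMap_iff (g : k[X]) {j : ℕ} (hj : 0 < j) (n : ℕ) (f : k[X]) :
    IsUnit (resMap g j n f) ↔ IsCoprime f g ∧ f.coeff n ≠ 0 := by
  rw [resMap_apply, Prod.isUnit_iff, isUnit_quotient_mk_iff, isUnit_quotient_mk_iff,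
    isCoprime_X_pow_iff hj, coeff_reflect, revAt_le (Nat.zero_le n), Nat.sub_zero]

lemma exists_resMap_eq {g : k[X]} (hg : g.Monic) {j m : ℕ} (hn : g.natDegree + j ≤ m + 1)
    (v : ResRing g j) : ∃ f : k[X], f.degree < (m + 1 : ℕ) ∧ resMap g j m f = v := by
  obtain ⟨a, b⟩ := v
  obtain ⟨a, rfl⟩ := Ideal.Quotient.mk_surjective a
  obtain ⟨b, rfl⟩ := Ideal.Quotient.mk_surjective b
  have hb : (b %ₘ X ^ j).degree < j := by
    simpa using degree_modByMonic_lt b (monic_X_pow (R := k) j)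
  set b' := b %ₘ X ^ j with hb'
  set w := (a - b'.reflect m) %ₘ g with hw
  have hwd : w.degree < g.natDegree := by
    rw [← degree_eq_natDegree hg.ne_zero]
    exact degree_modByMonic_lt _ hg
  refine ⟨b'.reflect m + w, ?_, ?_⟩
  · refine (degree_add_le _ _).trans_lt (max_lt ?_ ?_)
    · rw [degree_lt_iff_coeff_zero]
      intro i hi
      rw [coeff_reflect, revAt_eq_self_of_lt (by omega)]
      exact coeff_eq_zero_of_degree_lt (hb.trans_le (by exact_mod_cast by omega))
    · exact hwd.trans_le (by exact_mod_cast by omega)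
  · rw [resMap_apply]
    refine Prod.ext ?_ ?_
    · change Ideal.Quotient.mk _ _ = Ideal.Quotient.mk _ _
      rw [Ideal.Quotient.eq, Ideal.mem_span_singleton, hw, modByMonic_eq_sub_mul_div]
      exact ⟨-((a - b'.reflect m) /ₘ g), by ring⟩
    · change Ideal.Quotient.mk _ _ = Ideal.Quotient.mk _ _
      rw [Ideal.Quotient.eq, Ideal.mem_span_singleton, reflect_add, reflect_reflect]
      have h1 : X ^ j ∣ b' - b := by
        rw [hb', modByMonic_eq_sub_mul_div]
        exact ⟨-(b /ₘ X ^ j), by ring⟩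
      have h2 : X ^ j ∣ w.reflect m := by
        rw [X_pow_dvd_iff]
        intro i hi
        rw [coeff_reflect, revAt_le (by omega)]
        exact coeff_eq_zero_of_degree_lt (hwd.trans_le (by exact_mod_cast by omega))
      convert h1.add h2 using 1
      ring

end ResidueRing

section ResChar

variable {k : Type*} [Field k] [Fintype k] {g : k[X]} {j : ℕ}

lemma moduleFinite_quotient (hg : g.Monic) : Module.Finite k (k[X] ⧸ Ideal.span {g}) :=
  hg.finite_quotient

lemma finite_quotient (hg : g.Monic) : Finite (k[X] ⧸ Ideal.span {g}) :=
  have := moduleFinite_quotient hg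
  Module.finite_of_finite k

lemma natCard_quotient (hg : g.Monic) :
    Nat.card (k[X] ⧸ Ideal.span {g}) = Fintype.card k ^ g.natDegree := by
  have := finite_quotient hg
  let _ := Fintype.ofFinite (k[X] ⧸ Ideal.span {g})
  rw [Nat.card_eq_fintype_card, Module.card_eq_pow_finrank (K := k),
    finrank_quotient_span_eq_natDegree]

lemma finite_resRing (hg : g.Monic) (j : ℕ) : Finite (ResRing g j) :=
  have := finite_quotient hg
  have := finite_quotient (monic_X_pow (R := k) j)
  inferInstance

lemma natCard_resRing (hg : g.Monic) (j : ℕ) :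
    Nat.card (ResRing g j) = Fintype.card k ^ (g.natDegree + j) := by
  rw [Nat.card_prod, natCard_quotient hg, natCard_quotient (monic_X_pow j), natDegree_X_pow,
    pow_add]

lemma sum_polyFin_resMap (hg : g.Monic) [Fintype (ResRing g j)] {n : ℕ}
    (hn : g.natDegree + j ≤ n + 1) (h : ResRing g j → ℂ) :
    (Fintype.card k : ℂ) ^ (g.natDegree + j) * ∑ f ∈ polyFin k (n + 1), h (resMap g j n f) =
      (Fintype.card k : ℂ) ^ (n + 1) * ∑ v, h v := by
  rw [← sum_polyFin_comp (resMap g j n) (exists_resMap_eq hg hn) h,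
    ← Nat.card_eq_fintype_card (α := ResRing g j), natCard_resRing hg, Nat.cast_pow]

lemma sum_degFin_eq_sum_polyFin (hj : 0 < j) (n : ℕ) (h : ResRing g j → ℂ)
    (hh : ∀ v, ¬ IsUnit v → h v = 0) :
    ∑ f ∈ degFin k n, h (resMap g j n f) = ∑ f ∈ polyFin k (n + 1), h (resMap g j n f) := by
  rw [degFin, Finset.sum_filter]
  refine Finset.sum_congr rfl fun f _ => ?_
  split_ifs with hf
  · rfl
  · rw [hh]
    rw [isUnit_resMap_iff g hj]
    tauto

lemma resMap_C_mul (g : k[X]) (j n : ℕ) (a : k) (f : k[X]) :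
    resMap g j n (C a * f) = algebraMap k (ResRing g j) a * resMap g j n f := by
  refine Prod.ext ?_ ?_
  · simp only [resMap_apply, map_mul]; rfl
  · simp only [resMap_apply, reflect_C_mul, map_mul]; rfl

lemma sum_degFin_mulChar (χ : MulChar (ResRing g j) ℂ) (n : ℕ) (s : k[X] → Prop)
    (hs : ∀ (a : kˣ) (P : k[X]), s (C (a : k) * P) ↔ s P) :
    ∑ f ∈ (degFin k n).filter s, χ (resMap g j n f) =
      (∑ a : kˣ, χ (algebraMap k _ (a : k))) *
        ∑ P ∈ (monicFin k n).filter s, homChar χ (pt₀ g j) (pt₁ g j) P := by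
  rw [Finset.sum_filter, sum_degFin, Finset.sum_mul]
  refine Finset.sum_congr rfl fun a _ => ?_
  rw [Finset.mul_sum, Finset.sum_filter]
  refine Finset.sum_congr rfl fun P hP => ?_
  rw [hs]
  split_ifs
  · rw [resMap_C_mul, map_mul, homChar, homEval_pt g j le_rfl, natDegree_of_mem_monicFin hP]
  · rfl

lemma sum_units_eq_zero_or (χ : MulChar (ResRing g j) ℂ) :
    (∑ a : kˣ, χ (algebraMap k _ (a : k))) = 0 ∨
      (∑ a : kˣ, χ (algebraMap k _ (a : k))) = Fintype.card kˣ := by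
  set η : kˣ →* ℂ := (χ.toMonoidHom.comp (algebraMap k (ResRing g j) : k →* ResRing g j)).comp
    (Units.coeHom k) with hη
  have h1 : ∀ a : kˣ, χ (algebraMap k _ (a : k)) = η a := fun a => rfl
  simp only [h1]
  by_cases h : η = 1
  · right
    simp [h]
  · left
    exact sum_hom_units_eq_zero η h

lemma lCoeff_homChar_eq_zero (hg : g.Monic) (hj : 0 < j) {χ : MulChar (ResRing g j) ℂ}
    (hχ : χ ≠ 1) (h1 : (∑ a : kˣ, χ (algebraMap k _ (a : k))) = Fintype.card kˣ) {n : ℕ}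
    (hn : g.natDegree + j ≤ n + 1) : lCoeff (homChar χ (pt₀ g j) (pt₁ g j) : k[X] → ℂ) n = 0 := by
  have := finite_resRing hg j
  let _ := Fintype.ofFinite (ResRing g j)
  have h2 := sum_polyFin_resMap hg hn χ
  rw [MulChar.sum_eq_zero_of_ne_one hχ, mul_zero, ← sum_degFin_eq_sum_polyFin hj n χ
    (fun v => χ.map_nonunit)] at h2
  have h3 := sum_degFin_mulChar χ n (fun _ => True) (by simp)
  simp only [Finset.filter_true] at h3
  rw [h3, h1] at h2
  have h4 : (Fintype.card k : ℂ) ≠ 0 := by simp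
  have h5 : (Fintype.card kˣ : ℂ) ≠ 0 := by simp
  simpa [h4, h5, lCoeff] using h2

lemma isUnit_resMap_of_irreducible (hg : g.Monic) (hj : 0 < j) {F : k[X]} (hF : Irreducible F)
    (h : g.natDegree < F.natDegree) : IsUnit (resMap g j F.natDegree F) := by
  rw [isUnit_resMap_iff g hj]
  refine ⟨hF.coprime_iff_not_dvd.mpr fun hd => ?_, by simpa using hF.ne_zero⟩
  exact absurd (natDegree_le_of_dvd hd hg.ne_zero) (by omega)

lemma irreducible_C_mul_iff (a : kˣ) (P : k[X]) : Irreducible (C (a : k) * P) ↔ Irreducible P :=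
  irreducible_isUnit_mul (isUnit_C.mpr a.isUnit)

lemma norm_sum_irreducible_mulChar_le (hg : g.Monic) (hj : 0 < j) {χ : MulChar (ResRing g j) ℂ}
    (hχ : χ ≠ 1) {n : ℕ} (hn : 0 < n) :
    ‖(n : ℂ) * ∑ f ∈ (degFin k n).filter Irreducible, χ (resMap g j n f)‖ ≤
      Fintype.card k * ((g.natDegree + j + 2) * √(Fintype.card k : ℝ) ^ n) := by
  have := finite_resRing hg j
  rw [sum_degFin_mulChar χ n _ irreducible_C_mul_iff]
  rcases sum_units_eq_zero_or χ with h | h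
  · rw [h, zero_mul, mul_zero, norm_zero]
    positivity
  · rw [h, mul_left_comm, norm_mul]
    refine mul_le_mul ?_ ?_ (norm_nonneg _) (by positivity)
    · rw [Complex.norm_natCast]
      exact_mod_cast Fintype.card_le_of_injective _ Units.val_injective
    · have := norm_sum_irreducible_le χ (pt₀ g j) (pt₁ g j) (D := g.natDegree + j)
        (fun m hm => lCoeff_homChar_eq_zero hg hj hχ h (by omega)) (fun F _ hF hd => by
          rw [homEval_pt g j le_rfl]
          exact isUnit_resMap_of_irreducible hg hj hF (by omega)) hn
      exact_mod_cast this

lemma norm_card_irreducible_sub_le (n : ℕ) (hn : 0 < n) :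
    ‖(n : ℂ) * ∑ _P ∈ (monicFin k n).filter Irreducible, (1 : ℂ) - (Fintype.card k : ℂ) ^ n‖ ≤
      2 * √(Fintype.card k : ℝ) ^ n := by
  have := norm_sum_irreducible_sub_powerSum_le (k := k) (AlgebraicClosure k) (Ψ := fun _ => 1)
    (by simp) hn
  simpa [powerSum, card_fixedFinset hn] using this

lemma norm_card_irreducible_degFin_sub_le (n : ℕ) (hn : 0 < n) :
    ‖(n : ℂ) * ((degFin k n).filter Irreducible).card -
      (Fintype.card kˣ : ℂ) * (Fintype.card k : ℂ) ^ n‖ ≤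
      Fintype.card k * (2 * √(Fintype.card k : ℝ) ^ n) := by
  have h1 : ((((degFin k n).filter Irreducible).card : ℕ) : ℂ) = Fintype.card kˣ *
      ∑ P ∈ (monicFin k n).filter Irreducible, (1 : ℂ) := by
    rw [Finset.card_eq_sum_ones, Finset.sum_filter, Nat.cast_sum, sum_degFin]
    simp only [irreducible_C_mul_iff, Finset.sum_filter]
    simp
  rw [h1, mul_left_comm, ← mul_sub, norm_mul]
  refine mul_le_mul ?_ (norm_card_irreducible_sub_le n hn) (norm_nonneg _) (by positivity)
  rw [Complex.norm_natCast]
  exact_mod_cast Fintype.card_le_of_injective _ Units.val_injective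

end ResChar

section Parseval

variable {R : Type*} [CommRing R] [Finite R] [Fintype Rˣ] [Fintype (MulChar R ℂ)]

lemma card_mulChar : Fintype.card (MulChar R ℂ) = Fintype.card Rˣ := by
  rw [← Nat.card_eq_fintype_card, ← Nat.card_eq_fintype_card]
  exact MulChar.card_eq_card_units_of_hasEnoughRootsOfUnity R ℂ

lemma sum_mulChar_apply (a : R) :
    ∑ χ : MulChar R ℂ, χ a = if a = 1 then (Fintype.card Rˣ : ℂ) else 0 := by
  split_ifs with ha
  · simp [ha, card_mulChar]
  · obtain ⟨χ, hχ⟩ := MulChar.exists_apply_ne_one_of_hasEnoughRootsOfUnity R ℂ ha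
    refine eq_zero_of_mul_eq_self_left hχ ?_
    simp only [Finset.mul_sum, ← MulChar.mul_apply]
    exact Fintype.sum_bijective _ (Group.mulLeft_bijective χ) _ _ fun χ' ↦ rfl

lemma sum_mulChar_mul_star (v w : Rˣ) :
    ∑ χ : MulChar R ℂ, χ v * star (χ w) = if v = w then (Fintype.card Rˣ : ℂ) else 0 := by
  have h : ∀ χ : MulChar R ℂ, χ v * star (χ w) = χ ((v * w⁻¹ : Rˣ) : R) := fun χ => by
    rw [MulChar.star_apply', MulChar.inv_apply, Ring.inverse_unit, ← map_mul, Units.val_mul]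
  simp only [h]
  rw [sum_mulChar_apply]
  simp only [Units.val_eq_one, mul_inv_eq_one]

lemma sum_norm_sq_mulChar (m : Rˣ → ℂ) :
    ∑ χ : MulChar R ℂ, ‖∑ v : Rˣ, m v * χ v‖ ^ 2 = Fintype.card Rˣ * ∑ v : Rˣ, ‖m v‖ ^ 2 := by
  have hsq : ∀ z : ℂ, ((‖z‖ ^ 2 : ℝ) : ℂ) = z * star z := fun z => by
    rw [Complex.star_def, Complex.mul_conj, Complex.normSq_eq_norm_sq]
  apply Complex.ofReal_injective
  push_cast
  simp only [← Complex.ofReal_pow, hsq]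
  have h1 : ∀ χ : MulChar R ℂ, (∑ v : Rˣ, m v * χ v) * star (∑ v : Rˣ, m v * χ v) =
      ∑ v : Rˣ, ∑ w : Rˣ, m v * star (m w) * (χ v * star (χ w)) := fun χ => by
    rw [star_sum, Finset.sum_mul_sum]
    refine Finset.sum_congr rfl fun v _ => Finset.sum_congr rfl fun w _ => ?_
    rw [star_mul']
    ring
  simp only [h1]
  rw [Finset.sum_comm, Finset.mul_sum]
  refine Finset.sum_congr rfl fun v _ => ?_
  rw [Finset.sum_comm]
  simp only [← Finset.mul_sum, sum_mulChar_mul_star]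
  simp
  ring

/-- A function on the units whose character sums are all bounded is bounded in `ℓ¹`. -/
lemma sum_norm_le_of_mulChar (m : Rˣ → ℂ) {M : ℝ} (hM : 0 ≤ M)
    (h : ∀ χ : MulChar R ℂ, ‖∑ v : Rˣ, m v * χ v‖ ≤ M) :
    ∑ v : Rˣ, ‖m v‖ ≤ √(Fintype.card Rˣ : ℝ) * M := by
  have hc : (0 : ℝ) < Fintype.card Rˣ := by exact_mod_cast Fintype.card_pos
  have h1 : ∑ v : Rˣ, ‖m v‖ ^ 2 ≤ M ^ 2 := by
    refine le_of_mul_le_mul_left ?_ hc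
    rw [← sum_norm_sq_mulChar, ← card_mulChar, ← nsmul_eq_mul, ← Finset.card_univ]
    exact Finset.sum_le_card_nsmul _ _ _ fun χ _ => by gcongr; exact h χ
  have h2 : (∑ v : Rˣ, ‖m v‖) ^ 2 ≤ Fintype.card Rˣ * ∑ v : Rˣ, ‖m v‖ ^ 2 :=
    sq_sum_le_card_mul_sum_sq
  refine abs_le_of_sq_le_sq' ?_ (by positivity) |>.2
  rw [mul_pow, Real.sq_sqrt hc.le]
  exact h2.trans (by gcongr)

end Parseval

section UnitSums

variable {R : Type*} [CommRing R] [Fintype Rˣ]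

lemma sum_units_eq_sum [Fintype R] (h : R → ℂ) (hh : ∀ v, ¬ IsUnit v → h v = 0) :
    ∑ v : Rˣ, h v = ∑ v, h v := by
  have : ∑ v : Rˣ, h v = ∑ v ∈ Finset.univ.map ⟨Units.val, Units.val_injective⟩, h v := by
    rw [Finset.sum_map]; rfl
  rw [this]
  refine Finset.sum_subset (Finset.subset_univ _) fun v _ hv => hh v ?_
  rintro ⟨w, rfl⟩
  simp at hv

lemma exists_sum_eq_sum_units {A : Type*} (s : Finset A) (r : A → R) (hr : ∀ f ∈ s, IsUnit (r f)) :
    ∃ c : Rˣ → ℂ, ∀ h : R → ℂ, ∑ f ∈ s, h (r f) = ∑ v : Rˣ, c v * h v := by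
  refine ⟨fun v => ((s.filter fun f => r f = v).card : ℂ), fun h => ?_⟩
  have : ∀ v : Rˣ, ((s.filter fun f => r f = v).card : ℂ) * h v =
      ∑ f ∈ s, if r f = v then h (r f) else 0 := fun v => by
    rw [← Finset.sum_filter, ← nsmul_eq_mul, ← Finset.sum_const]
    exact Finset.sum_congr rfl fun f hf => by rw [(Finset.mem_filter.mp hf).2]
  simp only [this]
  rw [Finset.sum_comm]
  refine Finset.sum_congr rfl fun f hf => ?_
  obtain ⟨v, hv⟩ := hr f hf
  rw [Finset.sum_eq_single v]
  · rw [if_pos hv.symm]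
  · intro w _ hw
    rw [if_neg]
    rw [← hv]
    exact fun h => hw (Units.ext h.symm)
  · simp

end UnitSums

section Equidistribution

variable {k : Type*} [Field k] [Fintype k] {g : k[X]} {j : ℕ}

lemma norm_irreducible_equidistribution (hg : g.Monic) (hj : 0 < j) [Fintype (ResRing g j)ˣ]
    {n : ℕ} (hn : g.natDegree < n) {F : ResRing g j → ℂ} (hF : ∀ v, ‖F v‖ ≤ 1) :
    ‖(n : ℂ) * ∑ f ∈ (degFin k n).filter Irreducible, F (resMap g j n f) -
      (Fintype.card kˣ * (Fintype.card k : ℂ) ^ n / Fintype.card (ResRing g j)ˣ) *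
        ∑ v : (ResRing g j)ˣ, F v‖ ≤
      √(Fintype.card k : ℝ) ^ (g.natDegree + j) *
        (Fintype.card k * ((g.natDegree + j + 2) * √(Fintype.card k : ℝ) ^ n)) := by
  have := finite_resRing hg j
  let _ := Fintype.ofFinite (ResRing g j)
  let _ := Fintype.ofFinite (MulChar (ResRing g j) ℂ)
  set κ : ℂ := Fintype.card kˣ * (Fintype.card k : ℂ) ^ n / Fintype.card (ResRing g j)ˣ with hκ
  set s := (degFin k n).filter Irreducible with hs
  have hunit : ∀ f ∈ s, IsUnit (resMap g j n f) := fun f hf => by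
    obtain ⟨h1, h2⟩ := Finset.mem_filter.mp hf
    obtain ⟨_, rfl⟩ := mem_degFin.mp h1
    exact isUnit_resMap_of_irreducible hg hj h2 hn
  obtain ⟨c, hc⟩ := exists_sum_eq_sum_units s _ hunit
  set m : (ResRing g j)ˣ → ℂ := fun v => n * c v - κ with hm
  have hsum : ∀ h : ResRing g j → ℂ, n * ∑ f ∈ s, h (resMap g j n f) -
      κ * ∑ v : (ResRing g j)ˣ, h v = ∑ v, m v * h v := fun h => by
    rw [hc, Finset.mul_sum, Finset.mul_sum, ← Finset.sum_sub_distrib]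
    exact Finset.sum_congr rfl fun v _ => by simp only [hm]; ring
  have hc0 : (Fintype.card (ResRing g j)ˣ : ℂ) ≠ 0 := by simp
  have hbound : ∀ χ : MulChar (ResRing g j) ℂ, ‖∑ v : (ResRing g j)ˣ, m v * χ v‖ ≤
      Fintype.card k * ((g.natDegree + j + 2) * √(Fintype.card k : ℝ) ^ n) := fun χ => by
    rw [← hsum]
    by_cases hχ : χ = 1
    · have h1 : ∑ f ∈ s, χ (resMap g j n f) = s.card := by
        rw [Finset.sum_congr rfl fun f hf => by rw [hχ, MulChar.one_apply (hunit f hf)]]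
        simp
      have h2 : ∑ v : (ResRing g j)ˣ, χ v = Fintype.card (ResRing g j)ˣ := by
        simp [hχ, MulChar.one_apply]
      rw [h1, h2, hκ, div_mul_cancel₀ _ hc0]
      refine (norm_card_irreducible_degFin_sub_le n (by omega)).trans ?_
      gcongr
      linarith [Nat.cast_nonneg (α := ℝ) g.natDegree, Nat.cast_nonneg (α := ℝ) j]
    · rw [sum_units_eq_sum _ fun v => χ.map_nonunit, MulChar.sum_eq_zero_of_ne_one hχ, mul_zero,
        sub_zero]
      exact norm_sum_irreducible_mulChar_le hg hj hχ (by omega)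
  have hcard : √(Fintype.card (ResRing g j)ˣ : ℝ) ≤ √(Fintype.card k : ℝ) ^ (g.natDegree + j) := by
    refine Real.sqrt_le_iff.mpr ⟨by positivity, ?_⟩
    rw [← pow_mul, mul_comm, pow_mul, Real.sq_sqrt (Nat.cast_nonneg _)]
    have h1 := natCard_resRing hg j
    rw [Nat.card_eq_fintype_card] at h1
    exact_mod_cast h1 ▸ Fintype.card_le_of_injective _ Units.val_injective
  rw [hsum]
  calc ‖∑ v, m v * F v‖ ≤ ∑ v, ‖m v‖ := (norm_sum_le _ _).trans (Finset.sum_le_sum fun v _ => by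
        rw [norm_mul]; exact mul_le_of_le_one_right (norm_nonneg _) (hF v))
    _ ≤ _ := sum_norm_le_of_mulChar m (by positivity) hbound
    _ ≤ _ := by gcongr

/-- The number of polynomials of bounded degree which are coprime to `g`. -/
lemma card_polyFin_coprime (hg : g.Monic) {m : ℕ} (hm : g.natDegree ≤ m) :
    (Fintype.card k : ℂ) ^ g.natDegree *
      ((polyFin k m).filter fun f => IsCoprime f g).card =
      (Fintype.card k : ℂ) ^ m * Nat.card (k[X] ⧸ Ideal.span {g})ˣ := by
  have := finite_quotient hg
  let _ := Fintype.ofFinite (k[X] ⧸ Ideal.span {g})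
  have h1 := sum_polyFin_comp (m := m) (Ideal.Quotient.mk (Ideal.span {g})).toAddMonoidHom
    (fun b => by
      obtain ⟨b, rfl⟩ := Ideal.Quotient.mk_surjective b
      refine ⟨b %ₘ g, ?_, ?_⟩
      · refine (degree_modByMonic_lt b hg).trans_le ?_
        rw [degree_eq_natDegree hg.ne_zero]
        exact_mod_cast hm
      · change Ideal.Quotient.mk _ _ = Ideal.Quotient.mk _ _
        rw [Ideal.Quotient.eq, Ideal.mem_span_singleton, modByMonic_eq_sub_mul_div]
        exact ⟨-(b /ₘ g), by ring⟩) (fun v => if IsUnit v then 1 else 0)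
  rw [← sum_units_eq_sum _ (fun v hv => if_neg hv), ← Nat.card_eq_fintype_card (α := k[X] ⧸ Ideal.span {g}), natCard_quotient hg] at h1
  rw [Nat.card_eq_fintype_card, Finset.card_eq_sum_ones, Finset.sum_filter]
  push_cast at h1 ⊢
  convert h1 using 3
  · rw [← isUnit_quotient_mk_iff]
    congr 1
  · simp

lemma card_degFin_coprime (hg : g.Monic) {n : ℕ} (hn : g.natDegree ≤ n) :
    (Fintype.card k : ℂ) ^ g.natDegree *
      ((degFin k n).filter fun f => IsCoprime f g).card =
      Fintype.card kˣ * (Fintype.card k : ℂ) ^ n * Nat.card (k[X] ⧸ Ideal.span {g})ˣ := by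
  have h1 := card_polyFin_coprime hg (m := n + 1) (by omega)
  have h2 := card_polyFin_coprime hg hn
  have h3 : ((polyFin k (n + 1)).filter fun f => IsCoprime f g).card =
      ((polyFin k n).filter fun f => IsCoprime f g).card +
        ((degFin k n).filter fun f => IsCoprime f g).card := by
    simp only [Finset.card_eq_sum_ones, Finset.sum_filter]
    exact sum_polyFin_succ n _
  have h4 : (Fintype.card kˣ : ℂ) = Fintype.card k - 1 := by
    rw [Fintype.card_units, Nat.cast_sub Fintype.card_pos, Nat.cast_one]
  rw [h3, Nat.cast_add, mul_add, h2] at h1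
  rw [h4]
  linear_combination h1

/-- Irreducible polynomials of degree `n` are equidistributed with respect to a function which
only depends on the residue. -/
theorem norm_irreducible_sub_coprime_le (hg : g.Monic) (hj : 0 < j)
    {n : ℕ} (hn : g.natDegree < n) (hn' : g.natDegree + j ≤ n + 1) {W : k[X] → ℂ}
    (hW : ∀ f, ‖W f‖ ≤ 1)
    (hWr : ∀ f ∈ degFin k n, ∀ f' ∈ degFin k n, resMap g j n f = resMap g j n f' → W f = W f') :
    ‖(n : ℂ) * ∑ f ∈ (degFin k n).filter Irreducible, W f -
      ((Fintype.card k : ℂ) ^ g.natDegree / Nat.card (k[X] ⧸ Ideal.span {g})ˣ) *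
        ∑ f ∈ (degFin k n).filter (fun f => IsCoprime f g), W f‖ ≤
      √(Fintype.card k : ℝ) ^ (g.natDegree + j) *
        (Fintype.card k * ((g.natDegree + j + 2) * √(Fintype.card k : ℝ) ^ n)) := by
  have := finite_resRing hg j
  let _ := Fintype.ofFinite (ResRing g j)
  let _ := Fintype.ofFinite (ResRing g j)ˣ
  have := finite_quotient hg
  set F : ResRing g j → ℂ := fun v =>
    if h : ∃ f ∈ degFin k n, resMap g j n f = v then W h.choose else 0 with hF
  have hFW : ∀ f ∈ degFin k n, F (resMap g j n f) = W f := fun f hf => by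
    have h : ∃ f' ∈ degFin k n, resMap g j n f' = resMap g j n f := ⟨f, hf, rfl⟩
    simp only [hF]
    rw [dif_pos h]
    exact hWr _ h.choose_spec.1 _ hf h.choose_spec.2
  have hF1 : ∀ v, ‖F v‖ ≤ 1 := fun v => by
    simp only [hF]
    split_ifs
    · exact hW _
    · simp
  have hcop : ∀ h : ResRing g j → ℂ, (Fintype.card k : ℂ) ^ (g.natDegree + j) *
      ∑ f ∈ (degFin k n).filter (fun f => IsCoprime f g), h (resMap g j n f) =
      (Fintype.card k : ℂ) ^ (n + 1) * ∑ v : (ResRing g j)ˣ, h v := fun h => by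
    set h' : ResRing g j → ℂ := fun v => if IsUnit v then h v else 0 with hh'
    have h1 := sum_polyFin_resMap hg hn' h'
    rw [← sum_units_eq_sum h' (fun v hv => if_neg hv),
      ← sum_degFin_eq_sum_polyFin hj n h' (fun v hv => if_neg hv)] at h1
    convert h1 using 2
    · rw [Finset.sum_filter]
      refine Finset.sum_congr rfl fun f hf => ?_
      simp only [hh', isUnit_resMap_iff g hj, (Finset.mem_filter.mp hf).2, ne_eq,
        not_false_eq_true, and_true]
    · simp [hh']
  have hq : (Fintype.card k : ℂ) ≠ 0 := by simp
  have hG : (Fintype.card (ResRing g j)ˣ : ℂ) ≠ 0 := by simp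
  have hφ : (Nat.card (k[X] ⧸ Ideal.span {g})ˣ : ℂ) ≠ 0 := by
    exact_mod_cast Nat.card_pos.ne'
  have hmain : ((Fintype.card k : ℂ) ^ g.natDegree / Nat.card (k[X] ⧸ Ideal.span {g})ˣ) *
        ∑ f ∈ (degFin k n).filter (fun f => IsCoprime f g), W f =
      (Fintype.card kˣ * (Fintype.card k : ℂ) ^ n / Fintype.card (ResRing g j)ˣ) *
        ∑ v : (ResRing g j)ˣ, F v := by
    have h1 := hcop F
    have h2 := hcop fun _ => 1
    have h3 := card_degFin_coprime hg hn.le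
    rw [Finset.sum_congr rfl fun f hf => hFW f (Finset.mem_filter.mp hf).1] at h1
    simp only [Finset.sum_const, nsmul_eq_mul, mul_one, Finset.card_univ] at h2
    set A := ∑ f ∈ (degFin k n).filter (fun f => IsCoprime f g), W f
    set B : ℂ := (((degFin k n).filter fun f => IsCoprime f g).card : ℂ)
    rw [div_mul_eq_mul_div, div_mul_eq_mul_div, div_eq_div_iff hφ hG]
    refine mul_left_cancel₀ (pow_ne_zero (n + 1) hq) ?_
    linear_combination (-(Fintype.card k : ℂ) ^ g.natDegree * A) * h2 +
      (Fintype.card kˣ * (Fintype.card k : ℂ) ^ n * Nat.card (k[X] ⧸ Ideal.span {g})ˣ) * h1 +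
      (Fintype.card k : ℂ) ^ (g.natDegree + j) * A * h3
  rw [hmain]
  have := norm_irreducible_equidistribution hg hj hn hF1
  rwa [Finset.sum_congr rfl fun f hf => hFW f (Finset.mem_filter.mp hf).1] at this

end Equidistribution

section PrimeDivisors

variable {k : Type*} [Field k]

lemma exists_monic_irreducible_associated {z : k[X]} (hz : Irreducible z) :
    ∃ P : k[X], P.Monic ∧ Irreducible P ∧ Associated P z :=
  ⟨normalize z, monic_normalize hz.ne_zero, (normalize_associated z).symm.irreducible hz,
    normalize_associated z⟩

lemma isCoprime_of_monic_irreducible {P Q : k[X]} (hP : P.Monic) (hP' : Irreducible P)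
    (hQ : Q.Monic) (hQ' : Irreducible Q) (h : P ≠ Q) : IsCoprime P Q :=
  hP'.coprime_iff_not_dvd.mpr fun hd =>
    h (eq_of_monic_of_associated hP hQ (hP'.associated_of_dvd hQ' hd))

variable [Fintype k]

/-- The monic irreducible divisors of a nonzero polynomial. -/
def primeDiv (g : k[X]) : Finset k[X] :=
  (polyFin k (g.natDegree + 1)).filter fun P => P.Monic ∧ Irreducible P ∧ P ∣ g

lemma mem_primeDiv {g : k[X]} (hg : g ≠ 0) {P : k[X]} :
    P ∈ primeDiv g ↔ P.Monic ∧ Irreducible P ∧ P ∣ g := by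
  rw [primeDiv, Finset.mem_filter, mem_polyFin_succ, and_iff_right_iff_imp]
  exact fun h => natDegree_le_of_dvd h.2.2 hg

lemma isCoprime_iff_primeDiv {g : k[X]} (hg : g ≠ 0) {f : k[X]} :
    IsCoprime f g ↔ ∀ P ∈ primeDiv g, ¬ P ∣ f := by
  constructor
  · intro h P hP hPf
    obtain ⟨_, h2, h3⟩ := (mem_primeDiv hg).mp hP
    exact h2.not_isUnit (h.isUnit_of_dvd' hPf h3)
  · intro h
    refine isCoprime_of_irreducible_dvd (fun h => hg h.2) fun z hz hzf hzg => ?_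
    obtain ⟨P, hP, hP', hPz⟩ := exists_monic_irreducible_associated hz
    exact h P ((mem_primeDiv hg).mpr ⟨hP, hP', hPz.dvd.trans hzg⟩) (hPz.dvd.trans hzf)

lemma pairwise_primeDiv {g : k[X]} (hg : g ≠ 0) {T : Finset k[X]} (hT : T ⊆ primeDiv g) :
    (T : Set k[X]).Pairwise (Function.onFun IsCoprime id) := by
  intro P hP Q hQ hPQ
  obtain ⟨h1, h2, _⟩ := (mem_primeDiv hg).mp (hT hP)
  obtain ⟨h4, h5, _⟩ := (mem_primeDiv hg).mp (hT hQ)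
  exact isCoprime_of_monic_irreducible h1 h2 h4 h5 hPQ

lemma prod_primeDiv_dvd {g : k[X]} (hg : g ≠ 0) {T : Finset k[X]} (hT : T ⊆ primeDiv g) {f : k[X]} :
    (∏ P ∈ T, P) ∣ f ↔ ∀ P ∈ T, P ∣ f :=
  ⟨fun h _ hP => (Finset.dvd_prod_of_mem _ hP).trans h,
    Finset.prod_dvd_of_coprime (pairwise_primeDiv hg hT)⟩

lemma monic_prod_primeDiv {g : k[X]} (hg : g ≠ 0) {T : Finset k[X]} (hT : T ⊆ primeDiv g) :
    (∏ P ∈ T, P).Monic :=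
  monic_prod_of_monic _ _ fun _ hP => ((mem_primeDiv hg).mp (hT hP)).1

lemma prod_primeDiv_eq_iff {g : k[X]} (hg : g.Monic) {T : Finset k[X]} (hT : T ⊆ primeDiv g) :
    ∏ P ∈ T, P = g ↔ T = primeDiv g ∧ Squarefree g := by
  constructor
  · intro h
    refine ⟨hT.antisymm fun P hP => ?_, ?_⟩
    · obtain ⟨h1, h2, h3⟩ := (mem_primeDiv hg.ne_zero).mp hP
      rw [← h] at h3
      obtain ⟨Q, hQ, hPQ⟩ := (Prime.dvd_finsetProd_iff h2.prime _).mp h3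
      obtain ⟨h4, h5, _⟩ := (mem_primeDiv hg.ne_zero).mp (hT hQ)
      rwa [eq_of_monic_of_associated h1 h4 (h2.associated_of_dvd h5 hPQ)]
    · rw [← h]
      exact Finset.squarefree_prod_of_pairwise_isCoprime
        (fun P hP Q hQ hPQ => (pairwise_primeDiv hg.ne_zero hT hP hQ hPQ).isRelPrime)
        fun P hP => ((mem_primeDiv hg.ne_zero).mp (hT hP)).2.1.squarefree
  · rintro ⟨rfl, hs⟩
    obtain ⟨r, hr⟩ := (prod_primeDiv_dvd hg.ne_zero hT).mpr fun P hP =>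
      ((mem_primeDiv hg.ne_zero).mp hP).2.2
    have hru : IsUnit r := by
      by_contra hru
      have hr0 : r ≠ 0 := by rintro rfl; exact hg.ne_zero (by simpa using hr)
      obtain ⟨z, hz, hzr⟩ := WfDvdMonoid.exists_irreducible_factor hru hr0
      obtain ⟨P, hP, hP', hPz⟩ := exists_monic_irreducible_associated hz
      have hPr : P ∣ r := hPz.dvd.trans hzr
      have hPm : P ∈ primeDiv g := (mem_primeDiv hg.ne_zero).mpr
        ⟨hP, hP', hPr.trans (hr ▸ dvd_mul_left _ _)⟩
      have : P * P ∣ g := by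
        conv_rhs => rw [hr]
        exact mul_dvd_mul (Finset.dvd_prod_of_mem (fun P => P) hPm) hPr
      exact hP'.not_isUnit (hs P this)
    exact eq_of_monic_of_associated (monic_prod_primeDiv hg.ne_zero hT) hg ⟨hru.unit, hr.symm⟩

end PrimeDivisors

section Totient

variable {k : Type*} [Field k] [Fintype k]

lemma card_irreducible_le_card_units {g : k[X]} (hg : g.Monic) :
    ((monicFin k g.natDegree).filter Irreducible).card ≤
      Nat.card (k[X] ⧸ Ideal.span {g})ˣ + 1 := by
  have := finite_quotient hg
  let _ := Fintype.ofFinite (k[X] ⧸ Ideal.span {g})ˣ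
  set s := (monicFin k g.natDegree).filter Irreducible with hs
  have hmem : ∀ P ∈ s.erase g, P.Monic ∧ P.natDegree = g.natDegree ∧
      IsUnit (Ideal.Quotient.mk (Ideal.span {g}) P) := fun P hP => by
    obtain ⟨h1, h2⟩ := Finset.mem_erase.mp hP
    obtain ⟨h2, h3⟩ := Finset.mem_filter.mp h2
    obtain ⟨h2, h4⟩ := mem_monicFin.mp h2
    refine ⟨h2, h4, isUnit_quotient_mk_iff.mpr (h3.coprime_iff_not_dvd.mpr fun h5 => h1 ?_)⟩
    exact (eq_of_monic_of_dvd_of_natDegree_le h2 hg h5 h4.ge).symm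
  have h := Finset.card_le_card_of_injOn (s := s.erase g)
    (t := (Finset.univ : Finset (k[X] ⧸ Ideal.span {g})ˣ))
    (fun P => if h : IsUnit (Ideal.Quotient.mk (Ideal.span {g}) P) then h.unit else 1)
    (by simp) (fun P hP Q hQ hPQ => by
      obtain ⟨h1, h2, h3⟩ := hmem P hP
      obtain ⟨h4, h5, h6⟩ := hmem Q hQ
      simp only [dif_pos h3, dif_pos h6] at hPQ
      have h7 := congrArg Units.val hPQ
      rw [h3.unit_spec, h6.unit_spec, Ideal.Quotient.eq, Ideal.mem_span_singleton] at h7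
      by_contra hne
      have h8 : (P - Q).degree < P.degree := degree_sub_lt_left (by
        rw [degree_eq_natDegree h1.ne_zero, degree_eq_natDegree h4.ne_zero, h2, h5]) h1.ne_zero
        (by rw [h1.leadingCoeff, h4.leadingCoeff])
      have h9 := degree_le_of_dvd h7 (sub_ne_zero.mpr hne)
      rw [degree_eq_natDegree h1.ne_zero, h2, ← degree_eq_natDegree hg.ne_zero] at h8
      exact absurd h9 (not_le.mpr h8))
  rw [Finset.card_univ, ← Nat.card_eq_fintype_card] at h
  have := Finset.pred_card_le_card_erase (s := s) (a := g)
  omega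

/-- A lower bound for the totient of a monic polynomial. -/
lemma pow_natDegree_le_card_units {g : k[X]} (hg : g.Monic) :
    (Fintype.card k : ℝ) ^ g.natDegree ≤
      4 * (Fintype.card k : ℝ) ^ 4 * (g.natDegree + 1) * Nat.card (k[X] ⧸ Ideal.span {g})ˣ := by
  have := finite_quotient hg
  have hφ : (1 : ℝ) ≤ Nat.card (k[X] ⧸ Ideal.span {g})ˣ := by exact_mod_cast Nat.card_pos
  have hq : (2 : ℝ) ≤ Fintype.card k := by exact_mod_cast Fintype.one_lt_card (α := k)
  have hq4 : (1 : ℝ) ≤ (Fintype.card k : ℝ) ^ 4 := one_le_pow₀ (by linarith)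
  set φ : ℝ := ((Nat.card (k[X] ⧸ Ideal.span {g})ˣ : ℕ) : ℝ) with hφdef
  set d := g.natDegree with hd
  rcases lt_or_ge d 4 with h4 | h4
  · calc (Fintype.card k : ℝ) ^ d ≤ (Fintype.card k : ℝ) ^ 4 :=
          pow_le_pow_right₀ (by linarith) h4.le
      _ = 1 * (Fintype.card k : ℝ) ^ 4 * 1 * 1 := by ring
      _ ≤ 4 * (Fintype.card k : ℝ) ^ 4 * (d + 1) * φ := by
          gcongr
          · norm_num
          · linarith [Nat.cast_nonneg (α := ℝ) d]
  · set π : ℝ := (((monicFin k d).filter Irreducible).card : ℝ) with hπ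
    have h1 : π ≤ φ + 1 := by
      rw [hπ, hφdef]
      exact_mod_cast card_irreducible_le_card_units hg
    have h2 := norm_card_irreducible_sub_le (k := k) d (by omega)
    have h3 : (d * π - (Fintype.card k : ℝ) ^ d : ℝ) =
      ((d : ℂ) * ∑ _P ∈ (monicFin k d).filter Irreducible, (1 : ℂ) - (Fintype.card k : ℂ) ^ d) := by
      simp [hπ]
    rw [← h3, Complex.norm_real, Real.norm_eq_abs] at h2
    set y := √(Fintype.card k : ℝ) ^ d with hy
    have hyy : (Fintype.card k : ℝ) ^ d = y * y := by
      rw [hy, ← mul_pow, Real.mul_self_sqrt (by linarith)]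
    have hy4 : 4 ≤ y := by
      have h16 : (4 : ℝ) * 4 ≤ y * y := by
        rw [← hyy]
        calc (4 : ℝ) * 4 = 2 ^ 4 := by norm_num
          _ ≤ (Fintype.card k : ℝ) ^ 4 := by gcongr
          _ ≤ _ := pow_le_pow_right₀ (by linarith) h4
      have : 0 ≤ y := by positivity
      nlinarith
    rw [hyy] at h2 ⊢
    have hd1 : (4 : ℝ) ≤ d := by exact_mod_cast h4
    have h5 := (abs_le.mp h2).1
    have h6 : y * y ≤ 2 * (d * π) := by nlinarith
    have h7 : y * y ≤ 4 * d * φ := by nlinarith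
    calc y * y ≤ 4 * 1 * (d + 1) * φ := by nlinarith
      _ ≤ _ := by gcongr

end Totient

section AdditiveSums

variable {k : Type*} [Field k]

lemma map_eq_zero_of_forall_X_pow {l : k[X] →ₗ[k] k} {m : ℕ} (h : ∀ i < m, l (X ^ i) = 0)
    {r : k[X]} (hr : r.degree < m) : l r = 0 := by
  by_cases hr0 : r = 0
  · rw [hr0, map_zero]
  · have hr' : r.natDegree < m := (natDegree_lt_iff_degree_lt hr0).mpr hr
    rw [r.as_sum_range_C_mul_X_pow, map_sum]
    refine Finset.sum_eq_zero fun i hi => ?_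
    rw [← smul_eq_C_mul, map_smul, h i (by have := Finset.mem_range.mp hi; omega), smul_zero]

end AdditiveSums

section AdditiveSums

variable {k : Type*} [Field k] [Fintype k] (ψ : AddChar k ℂ) (l : k[X] →ₗ[k] k)

variable {ψ} in
lemma sum_polyFin_addChar (hψ : ψ ≠ 1) (m : ℕ) :
    ∑ r ∈ polyFin k m, ψ (l r) =
      if ∀ i < m, l (X ^ i) = 0 then (Fintype.card k : ℂ) ^ m else 0 := by
  split_ifs with h
  · rw [Finset.sum_congr rfl fun r hr => by
      rw [map_eq_zero_of_forall_X_pow h (mem_polyFin.mp hr), AddChar.map_zero_eq_one]]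
    simp [card_polyFin]
  · push Not at h
    obtain ⟨i, hi, hl⟩ := h
    obtain ⟨c, hc⟩ := AddChar.ne_one_iff.mp hψ
    set r₀ : k[X] := (c / l (X ^ i)) • X ^ i with hr₀
    have hr₀l : l r₀ = c := by rw [hr₀, map_smul, smul_eq_mul, div_mul_cancel₀ _ hl]
    have hr₀m : r₀.degree < m := by
      rw [hr₀, smul_eq_C_mul]
      exact (degree_C_mul_X_pow_le _ _).trans_lt (by exact_mod_cast hi)
    refine eq_zero_of_mul_eq_self_left (b := ψ c) hc ?_
    rw [Finset.mul_sum]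
    refine Finset.sum_bij' (fun r _ => r₀ + r) (fun r _ => r - r₀) ?_ ?_ ?_ ?_ ?_
    · exact fun r hr => mem_polyFin.mpr
        ((degree_add_le _ _).trans_lt (max_lt hr₀m (mem_polyFin.mp hr)))
    · exact fun r hr => mem_polyFin.mpr
        ((degree_sub_le _ _).trans_lt (max_lt (mem_polyFin.mp hr) hr₀m))
    · simp
    · simp
    · intro r _
      rw [map_add, AddChar.map_add_eq_mul, hr₀l]

variable {ψ} in
lemma sum_dvd_addChar (hψ : ψ ≠ 1) {D : k[X]} (hD : D.Monic) (m : ℕ) :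
    ∑ f ∈ (polyFin k m).filter (fun f => D ∣ f), ψ (l f) =
      if ∀ i < m - D.natDegree, l (D * X ^ i) = 0
        then (Fintype.card k : ℂ) ^ (m - D.natDegree) else 0 := by
  have h := sum_polyFin_addChar (l.comp (LinearMap.mulLeft k D)) hψ (m - D.natDegree)
  simp only [LinearMap.comp_apply, LinearMap.mulLeft_apply] at h
  refine Eq.trans ?_ (h.trans (by congr))
  refine Finset.sum_bij' (fun f _ => f /ₘ D) (fun r _ => D * r) ?_ ?_ ?_ ?_ ?_
  · intro f hf
    obtain ⟨h1, r, rfl⟩ := Finset.mem_filter.mp hf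
    rw [mul_divByMonic_cancel_left r hD, mem_polyFin]
    rw [mem_polyFin] at h1
    by_cases hr : r = 0
    · simp [hr]
    rw [← natDegree_lt_iff_degree_lt (mul_ne_zero hD.ne_zero hr), hD.natDegree_mul' hr] at h1
    rw [← natDegree_lt_iff_degree_lt hr]
    omega
  · intro r hr
    rw [mem_polyFin] at hr
    rw [Finset.mem_filter, mem_polyFin]
    refine ⟨?_, dvd_mul_right _ _⟩
    by_cases hr0 : r = 0
    · simp [hr0]
    rw [← natDegree_lt_iff_degree_lt hr0] at hr
    rw [← natDegree_lt_iff_degree_lt (mul_ne_zero hD.ne_zero hr0), hD.natDegree_mul' hr0]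
    omega
  · intro f hf
    obtain ⟨h1, r, rfl⟩ := Finset.mem_filter.mp hf
    rw [mul_divByMonic_cancel_left r hD]
  · intro r _
    rw [mul_divByMonic_cancel_left r hD]
  · intro f hf
    obtain ⟨h1, r, rfl⟩ := Finset.mem_filter.mp hf
    rw [mul_divByMonic_cancel_left r hD]

variable {ψ} in
/-- The sum of an additive character over the polynomials coprime to `g`, when no proper divisor
of `g` annihilates the character. -/
lemma sum_coprime_addChar (hψ : ψ ≠ 1) {g : k[X]} (hg : g.Monic) (m : ℕ)
    (hmin : ∀ D : k[X], D.Monic → D.natDegree < g.natDegree →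
      ∃ i < m - D.natDegree, l (D * X ^ i) ≠ 0) :
    ∑ f ∈ (polyFin k m).filter (fun f => IsCoprime f g), ψ (l f) =
      (if Squarefree g then (-1) ^ (primeDiv g).card else 0) *
        if ∀ i < m - g.natDegree, l (g * X ^ i) = 0
        then (Fintype.card k : ℂ) ^ (m - g.natDegree) else 0 := by
  have hind : ∀ f : k[X], (if IsCoprime f g then ψ (l f) else 0) =
      ∑ T ∈ (primeDiv g).powerset, (-1) ^ T.card *
        if (∏ P ∈ T, P) ∣ f then ψ (l f) else 0 := fun f => by
    have h1 := Finset.prod_one_add (R := ℂ) (f := fun P : k[X] => if P ∣ f then -1 else 0)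
      (primeDiv g)
    have h2 : ∏ P ∈ primeDiv g, (1 + if P ∣ f then -1 else 0) =
        if IsCoprime f g then (1 : ℂ) else 0 := by
      simp only [isCoprime_iff_primeDiv hg.ne_zero]
      have : ∀ P : k[X], (1 + if P ∣ f then -1 else 0 : ℂ) = if ¬ P ∣ f then 1 else 0 := fun P => by
        split_ifs <;> simp
      simp only [this, Finset.prod_ite_zero, Finset.prod_const_one]
    have h3 : (if IsCoprime f g then ψ (l f) else 0) =
        (if IsCoprime f g then (1 : ℂ) else 0) * ψ (l f) := by split_ifs <;> simp
    rw [h3, ← h2, h1, Finset.sum_mul]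
    refine Finset.sum_congr rfl fun T hT => ?_
    rw [Finset.prod_ite_zero, Finset.prod_const]
    simp only [prod_primeDiv_dvd hg.ne_zero (Finset.mem_powerset.mp hT)]
    split_ifs <;> simp
  rw [Finset.sum_filter]
  simp only [hind]
  rw [Finset.sum_comm]
  simp only [← Finset.mul_sum, ← Finset.sum_filter]
  have hterm : ∀ T ∈ (primeDiv g).powerset, T ≠ primeDiv g ∨ ¬ Squarefree g →
      ∑ f ∈ (polyFin k m).filter (fun f => (∏ P ∈ T, P) ∣ f), ψ (l f) = 0 := fun T hT h => by
    have hT' := Finset.mem_powerset.mp hT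
    have hm := monic_prod_primeDiv hg.ne_zero hT'
    have hdvd : (∏ P ∈ T, P) ∣ g := (prod_primeDiv_dvd hg.ne_zero hT').mpr fun P hP =>
      ((mem_primeDiv hg.ne_zero).mp (hT' hP)).2.2
    obtain ⟨i, hi, hl⟩ := hmin _ hm (by
      by_contra hlt
      have := eq_of_monic_of_dvd_of_natDegree_le hm hg hdvd (not_lt.mp hlt)
      rw [eq_comm, prod_primeDiv_eq_iff hg hT'] at this
      tauto)
    rw [sum_dvd_addChar l hψ hm, if_neg]
    exact fun h => hl (h i hi)
  rw [Finset.sum_eq_single (primeDiv g)]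
  · split_ifs with hs
    all_goals first
      | rw [(prod_primeDiv_eq_iff hg subset_rfl).mpr ⟨rfl, hs⟩, sum_dvd_addChar l hψ hg]
        simp_all
      | rw [hterm _ (Finset.mem_powerset_self _) (Or.inr hs)]
        simp
  · intro T hT hne
    rw [hterm T hT (Or.inl hne), mul_zero]
  · exact fun h => absurd (Finset.mem_powerset_self _) h

end AdditiveSums

section Residue

variable {k : Type*} [Field k]

/-- The coefficient of `t⁻¹` in the expansion of `f / s` at infinity, for a monic `s`. -/
def resPoly (s : k[X]) : k[X] →ₗ[k] k :=
  (lcoeff k (s.natDegree - 1)).comp (modByMonicHom s)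

lemma resPoly_apply (s f : k[X]) : resPoly s f = (f %ₘ s).coeff (s.natDegree - 1) := rfl

lemma resPoly_mul_self {s : k[X]} (hs : s.Monic) (f : k[X]) : resPoly s (s * f) = 0 := by
  rw [resPoly_apply, (modByMonic_eq_zero_iff_dvd hs).mpr (dvd_mul_right _ _), coeff_zero]

lemma resPoly_mul_modByMonic {s : k[X]} (hs : s.Monic) (f f' : k[X]) :
    resPoly s (f %ₘ s * f') = resPoly s (f * f') := by
  conv_rhs => rw [← modByMonic_add_div f s]
  rw [add_mul, map_add, mul_assoc, resPoly_mul_self hs, add_zero]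

lemma resPoly_mul_X_pow_ne_zero {s f : k[X]} (hs : s.Monic) (hf : f ≠ 0)
    (h : f.natDegree < s.natDegree) :
    resPoly s (f * X ^ (s.natDegree - 1 - f.natDegree)) ≠ 0 := by
  have h1 : (f * X ^ (s.natDegree - 1 - f.natDegree)).natDegree = s.natDegree - 1 := by
    rw [natDegree_mul_X_pow _ hf]
    omega
  rw [resPoly_apply, (modByMonic_eq_self_iff hs).mpr (degree_lt_degree (by omega))]
  have h2 := coeff_natDegree (p := f * X ^ (s.natDegree - 1 - f.natDegree))
  rw [h1] at h2
  rw [h2]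
  exact leadingCoeff_ne_zero.mpr (mul_ne_zero hf (pow_ne_zero _ X_ne_zero))

/-- A polynomial of small degree is determined by its residue pairings. -/
lemma eq_zero_of_resPoly_mul_X_pow {s f : k[X]} (hs : s.Monic) (hf : f.degree < s.natDegree)
    (h : ∀ i < s.natDegree, resPoly s (f * X ^ i) = 0) : f = 0 := by
  by_contra hf0
  have h1 := (natDegree_lt_iff_degree_lt hf0).mpr hf
  exact resPoly_mul_X_pow_ne_zero hs hf0 h1 (h _ (by omega))

lemma exists_resPoly_eq {s : k[X]} (hs : s.Monic) (l : k[X] →ₗ[k] k) :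
    ∃ b : k[X], b.degree < s.natDegree ∧
      ∀ i < s.natDegree, resPoly s (b * X ^ i) + l (X ^ i) = 0 := by
  let T : degreeLT k s.natDegree →ₗ[k] (Fin s.natDegree → k) :=
    (LinearMap.pi fun i : Fin s.natDegree =>
      (resPoly s).comp (LinearMap.mulRight k (X ^ (i : ℕ)))).comp (Submodule.subtype _)
  have hT : Function.Injective T := by
    refine (injective_iff_map_eq_zero _).mpr fun b hb => Subtype.ext ?_
    exact eq_zero_of_resPoly_mul_X_pow hs (mem_degreeLT.mp b.2)
      fun i hi => congrFun hb ⟨i, hi⟩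
  have hfin : FiniteDimensional k (degreeLT k s.natDegree) :=
    Module.Finite.equiv (degreeLTEquiv k s.natDegree).symm
  have hT' : Function.Surjective T :=
    (LinearMap.injective_iff_surjective_of_finrank_eq_finrank
      (by rw [finrank_degreeLT, Module.finrank_fin_fun])).mp hT
  obtain ⟨b, hb⟩ := hT' fun i => -l (X ^ (i : ℕ))
  refine ⟨(b : k[X]), mem_degreeLT.mp b.2, fun i hi => ?_⟩
  have h1 : resPoly s ((b : k[X]) * X ^ i) = -l (X ^ i) := congrFun hb ⟨i, hi⟩
  rw [h1, neg_add_cancel]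

end Residue

section Approximation

variable {k : Type*} [Field k] (l : k[X] →ₗ[k] k)

/-- A monic polynomial of least degree annihilating a functional on an initial range of powers. -/
lemma exists_minimal_annihilator (h : ℕ) :
    ∃ g : k[X], g.Monic ∧ g.natDegree ≤ h ∧ (∀ i < h, l (g * X ^ i) = 0) ∧
      ∀ D : k[X], D.Monic → D.natDegree < g.natDegree → ∃ i < h, l (D * X ^ i) ≠ 0 := by
  have hex : ∃ g : k[X], g.Monic ∧ g.natDegree ≤ h ∧ ∀ i < h, l (g * X ^ i) = 0 := by
    let T : degreeLT k (h + 1) →ₗ[k] (Fin h → k) :=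
      (LinearMap.pi fun i : Fin h =>
        l.comp (LinearMap.mulRight k (X ^ (i : ℕ)))).comp (Submodule.subtype _)
    have hfin : FiniteDimensional k (degreeLT k (h + 1)) :=
      Module.Finite.equiv (degreeLTEquiv k (h + 1)).symm
    have hT : LinearMap.ker T ≠ ⊥ := LinearMap.ker_ne_bot_of_finrank_lt
      (by rw [finrank_degreeLT, Module.finrank_fin_fun]; omega)
    obtain ⟨f, hf, hf0⟩ := (Submodule.ne_bot_iff _).mp hT
    have hf0' : (f : k[X]) ≠ 0 := fun h => hf0 (Subtype.ext h)
    have hf1 : ∀ i < h, l ((f : k[X]) * X ^ i) = 0 := fun i hi =>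
      congrFun (LinearMap.mem_ker.mp hf) ⟨i, hi⟩
    have hf2 := (natDegree_lt_iff_degree_lt hf0').mpr (mem_degreeLT.mp f.2)
    refine ⟨(f : k[X]) * C (f : k[X]).leadingCoeff⁻¹, monic_mul_leadingCoeff_inv hf0', ?_, fun i hi => ?_⟩
    · rw [natDegree_mul_leadingCoeff_inv _ hf0']
      omega
    · rw [mul_comm (f : k[X]), mul_assoc, ← smul_eq_C_mul, map_smul, hf1 i hi, smul_zero]
  have hex' : ∃ n, ∃ g : k[X], g.Monic ∧ g.natDegree ≤ h ∧ (∀ i < h, l (g * X ^ i) = 0) ∧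
      g.natDegree = n := by
    obtain ⟨g, h1, h2, h3⟩ := hex
    exact ⟨_, g, h1, h2, h3, rfl⟩
  obtain ⟨g, h1, h2, h3, h4⟩ := Nat.find_spec hex'
  refine ⟨g, h1, h2, h3, fun D hD hDg => ?_⟩
  by_contra! hD'
  exact Nat.find_min hex' (h4 ▸ hDg) ⟨D, hD, hDg.le.trans h2, hD', rfl⟩

variable {l} {g : k[X]} {h M : ℕ}

/-- A rational function with small denominator approximating the functional has denominator `g`. -/
lemma eq_of_resPoly_add_eq_zero (hg : g.Monic) (hgh : g.natDegree ≤ h)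
    (hg0 : ∀ i < h, l (g * X ^ i) = 0)
    (hmin : ∀ D : k[X], D.Monic → D.natDegree < g.natDegree → ∃ i < h, l (D * X ^ i) ≠ 0)
    (hM : 2 * h ≤ M) {s b : k[X]} (hs : s.Monic) (hsh : s.natDegree ≤ h) (hb : IsCoprime b s)
    (hsb : ∀ i < M, resPoly s (b * X ^ i) + l (X ^ i) = 0) :
    s = g ∧ ∀ i < M - g.natDegree, l (g * X ^ i) = 0 := by
  have hL : ∀ f : k[X], f.natDegree < M → resPoly s (b * f) + l f = 0 := fun f hf => by
    refine map_eq_zero_of_forall_X_pow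
      (l := (resPoly s).comp (LinearMap.mulLeft k b) + l) (m := M) hsb ?_
    exact degree_le_natDegree.trans_lt (by exact_mod_cast hf)
  have hX : ∀ (f : k[X]) i, (f * X ^ i).natDegree ≤ f.natDegree + i := fun f i =>
    natDegree_mul_le.trans (by rw [natDegree_X_pow])
  have hsg : s ∣ g := by
    refine hb.symm.dvd_of_dvd_mul_left ?_
    rw [← modByMonic_eq_zero_iff_dvd hs]
    by_contra hc
    have h1 : ((b * g) %ₘ s).natDegree < s.natDegree := by
      rw [natDegree_lt_iff_degree_lt hc, ← degree_eq_natDegree hs.ne_zero]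
      exact degree_modByMonic_lt _ hs
    refine resPoly_mul_X_pow_ne_zero hs hc h1 ?_
    set i := s.natDegree - 1 - ((b * g) %ₘ s).natDegree with hi
    have h2 := hL (g * X ^ i) ((hX _ _).trans_lt (by omega))
    rw [hg0 i (by omega), add_zero] at h2
    rw [resPoly_mul_modByMonic hs, mul_assoc, h2]
  have hs0 : ∀ i, s.natDegree + i < M → l (s * X ^ i) = 0 := fun i hi => by
    have h2 := hL (s * X ^ i) ((hX _ _).trans_lt hi)
    rwa [mul_left_comm, resPoly_mul_self hs, zero_add] at h2
  have hsg' : s = g := by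
    refine (eq_of_monic_of_dvd_of_natDegree_le hs hg hsg ?_).symm
    by_contra! hlt
    obtain ⟨i, hi, hl⟩ := hmin s hs hlt
    exact hl (hs0 i (by omega))
  subst hsg'
  exact ⟨rfl, fun i hi => hs0 i (by omega)⟩

/-- If `g` annihilates the functional on the full range, the functional is the residue pairing
with a unique reduced fraction of denominator `g`. -/
lemma existsUnique_resPoly_add_eq_zero (hg : g.Monic) (hgh : g.natDegree ≤ h)
    (hmin : ∀ D : k[X], D.Monic → D.natDegree < g.natDegree → ∃ i < h, l (D * X ^ i) ≠ 0)
    (hM : 2 * h ≤ M) (hE : ∀ i < M - g.natDegree, l (g * X ^ i) = 0) :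
    ∃ b : k[X], (b.degree < g.natDegree ∧ IsCoprime b g ∧
      ∀ i < M, resPoly g (b * X ^ i) + l (X ^ i) = 0) ∧
      ∀ b' : k[X], b'.degree < g.natDegree →
        (∀ i < M, resPoly g (b' * X ^ i) + l (X ^ i) = 0) → b' = b := by
  obtain ⟨b, hb, hb0⟩ := exists_resPoly_eq hg l
  have hL : ∀ f : k[X], f.natDegree < M → resPoly g (b * f) + l f = 0 := fun f hf => by
    let L := (resPoly g).comp (LinearMap.mulLeft k b) + l
    have h1 : L (f %ₘ g) = 0 := map_eq_zero_of_forall_X_pow hb0 (by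
      rw [← degree_eq_natDegree hg.ne_zero]
      exact degree_modByMonic_lt _ hg)
    have h2 : L (g * (f /ₘ g)) = 0 := by
      by_cases hf0 : f /ₘ g = 0
      · rw [hf0, mul_zero, map_zero]
      refine map_eq_zero_of_forall_X_pow (l := L.comp (LinearMap.mulLeft k g))
        (m := M - g.natDegree) (fun i hi => ?_) ?_
      · change resPoly g (b * (g * X ^ i)) + l (g * X ^ i) = 0
        rw [mul_left_comm, resPoly_mul_self hg, hE i hi, add_zero]
      · rw [← natDegree_lt_iff_degree_lt hf0]
        have h3 := natDegree_divByMonic f hg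
        have h4 : ¬ f.degree < g.degree := fun h => hf0 ((divByMonic_eq_zero_iff hg).mpr h)
        have h5 := natDegree_le_natDegree (not_lt.mp h4)
        omega
    change L f = 0
    rw [← modByMonic_add_div f g, map_add, h1, h2, add_zero]
  refine ⟨b, ⟨hb, ?_, fun i hi => hL _ (by rwa [natDegree_X_pow])⟩, fun b' hb' hb'' => ?_⟩
  · refine isCoprime_of_irreducible_dvd (fun h => hg.ne_zero h.2) fun z hz hzb hzg => ?_
    obtain ⟨P, hP, hP', hPz⟩ := exists_monic_irreducible_associated hz
    obtain ⟨b₁, rfl⟩ := hPz.dvd.trans hzb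
    obtain ⟨g₁, rfl⟩ := hPz.dvd.trans hzg
    have hg₁ := hP.of_mul_monic_left hg
    have h1 := hP.natDegree_mul hg₁
    have h2 := hP'.natDegree_pos
    obtain ⟨i, hi, hl⟩ := hmin g₁ hg₁ (by omega)
    have h3 := hL (g₁ * X ^ i) (by
      rw [natDegree_mul_X_pow _ hg₁.ne_zero]
      omega)
    rw [show P * b₁ * (g₁ * X ^ i) = P * g₁ * (b₁ * X ^ i) by ring, resPoly_mul_self hg,
      zero_add] at h3
    exact hl h3
  · refine sub_eq_zero.mp (eq_zero_of_resPoly_mul_X_pow hg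
      ((degree_sub_le _ _).trans_lt (max_lt hb' hb)) fun i hi => ?_)
    have h1 := hb'' i (by omega)
    have h2 := hL (X ^ i) (by rw [natDegree_X_pow]; omega)
    rw [sub_mul, map_sub]
    linear_combination h1 - h2

end Approximation

section RamanujanExpansion

variable {k : Type*} [Field k] [Fintype k] {ψ : AddChar k ℂ} {l : k[X] →ₗ[k] k}
  {g : k[X]} {h M : ℕ}

/-- The exponential sum of a truncated Ramanujan expansion. -/
lemma sum_ramanujan_addChar (hψ : ψ ≠ 1) (hg : g.Monic) (hgh : g.natDegree ≤ h)
    (hg0 : ∀ i < h, l (g * X ^ i) = 0)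
    (hmin : ∀ D : k[X], D.Monic → D.natDegree < g.natDegree → ∃ i < h, l (D * X ^ i) ≠ 0)
    (hM : 2 * h ≤ M) (S : Finset k[X]) (hS : ∀ s ∈ S, s.Monic ∧ s.natDegree ≤ h)
    (c : k[X] → ℂ) :
    ∑ f ∈ polyFin k M, (∑ s ∈ S, c s *
      ∑ b ∈ (polyFin k s.natDegree).filter (fun b => IsCoprime b s), ψ (resPoly s (b * f))) *
        ψ (l f) =
      if g ∈ S ∧ ∀ i < M - g.natDegree, l (g * X ^ i) = 0
      then c g * (Fintype.card k : ℂ) ^ M else 0 := by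
  have h1 : ∀ s b : k[X], ∑ f ∈ polyFin k M, ψ (resPoly s (b * f)) * ψ (l f) =
      if ∀ i < M, resPoly s (b * X ^ i) + l (X ^ i) = 0 then (Fintype.card k : ℂ) ^ M else 0 :=
    fun s b => by
      have := sum_polyFin_addChar ((resPoly s).comp (LinearMap.mulLeft k b) + l) hψ M
      simp only [LinearMap.add_apply, LinearMap.comp_apply, LinearMap.mulLeft_apply,
        AddChar.map_add_eq_mul] at this
      exact this.trans (by congr)
  have h2 : ∑ f ∈ polyFin k M, (∑ s ∈ S, c s *
      ∑ b ∈ (polyFin k s.natDegree).filter (fun b => IsCoprime b s), ψ (resPoly s (b * f))) *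
        ψ (l f) = ∑ s ∈ S, c s *
      ∑ b ∈ (polyFin k s.natDegree).filter (fun b => IsCoprime b s),
        if ∀ i < M, resPoly s (b * X ^ i) + l (X ^ i) = 0
        then (Fintype.card k : ℂ) ^ M else 0 := by
    simp only [← h1, Finset.sum_mul, mul_assoc]
    rw [Finset.sum_comm]
    refine Finset.sum_congr rfl fun s _ => ?_
    rw [← Finset.mul_sum, Finset.sum_comm]
  have h3 : ∀ s ∈ S, ∀ b ∈ (polyFin k s.natDegree).filter (fun b => IsCoprime b s),
      (∀ i < M, resPoly s (b * X ^ i) + l (X ^ i) = 0) →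
        s = g ∧ ∀ i < M - g.natDegree, l (g * X ^ i) = 0 := fun s hs b hb hsb =>
    eq_of_resPoly_add_eq_zero hg hgh hg0 hmin hM (hS s hs).1 (hS s hs).2
      (Finset.mem_filter.mp hb).2 hsb
  rw [h2]
  split_ifs with hE
  · rw [Finset.sum_eq_single_of_mem g hE.1 fun s hs hne => by
      rw [Finset.sum_eq_zero fun b hb => if_neg fun hsb => hne (h3 s hs b hb hsb).1, mul_zero]]
    obtain ⟨b, ⟨hb, hb', hb0⟩, huniq⟩ := existsUnique_resPoly_add_eq_zero hg hgh hmin hM hE.2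
    rw [Finset.sum_eq_single_of_mem b
      (Finset.mem_filter.mpr ⟨mem_polyFin.mpr hb, hb'⟩) fun b' hb₁ hne =>
        if_neg fun hsb => hne (huniq b' (mem_polyFin.mp (Finset.mem_filter.mp hb₁).1) hsb),
      if_pos hb0]
  · refine Finset.sum_eq_zero fun s hs => ?_
    rw [Finset.sum_eq_zero fun b hb => if_neg fun hsb => hE ?_, mul_zero]
    obtain ⟨rfl, h4⟩ := h3 s hs b hb hsb
    exact ⟨hs, h4⟩

end RamanujanExpansion

section MajorArc

variable {k : Type*} [Field k] [Fintype k] {ψ : AddChar k ℂ} {l : k[X] →ₗ[k] k}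
  {g : k[X]} {h : ℕ}

lemma addChar_eq_of_resMap_eq (hg0 : ∀ i < h, l (g * X ^ i) = 0) {n j : ℕ}
    (hjh : n + 1 ≤ g.natDegree + j + h) {f f' : k[X]} (hf : f ∈ degFin k n)
    (hf' : f' ∈ degFin k n) (hff' : resMap g j n f = resMap g j n f') :
    ψ (l f) = ψ (l f') := by
  have hz : resMap g j n (f - f') = 0 := by rw [map_sub, hff', sub_self]
  rw [resMap_apply, Prod.mk_eq_zero, Ideal.Quotient.eq_zero_iff_dvd,
    Ideal.Quotient.eq_zero_iff_dvd] at hz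
  obtain ⟨⟨r, hr⟩, hz⟩ := hz
  suffices h0 : l (f - f') = 0 by
    rw [map_sub, sub_eq_zero] at h0
    rw [h0]
  by_cases hr0 : r = 0
  · rw [hr, hr0, mul_zero, map_zero]
  by_cases hg' : g = 0
  · rw [hr, hg', zero_mul, map_zero]
  have h1 : (f - f').natDegree ≤ n :=
    (natDegree_sub_le _ _).trans (max_le (mem_degFin.mp hf).2.le (mem_degFin.mp hf').2.le)
  have hne : f - f' ≠ 0 := by rw [hr]; exact mul_ne_zero hg' hr0
  have h2 : (f - f').natDegree + j ≤ n := by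
    by_contra! hlt
    have h3 := (X_pow_dvd_iff.mp hz) (n - (f - f').natDegree) (by omega)
    rw [coeff_reflect, revAt_le (by omega), Nat.sub_sub_self h1, coeff_natDegree,
      leadingCoeff_eq_zero] at h3
    exact hne h3
  rw [hr, natDegree_mul hg' hr0] at h2
  rw [hr]
  refine map_eq_zero_of_forall_X_pow (l := l.comp (LinearMap.mulLeft k g)) (m := h) hg0 ?_
  rw [← natDegree_lt_iff_degree_lt hr0]
  omega

lemma card_degFin_le (n : ℕ) : ((degFin k n).card : ℝ) ≤ (Fintype.card k : ℝ) ^ (n + 1) := by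
  have h1 : (degFin k n).card ≤ (polyFin k (n + 1)).card :=
    Finset.card_le_card (Finset.filter_subset _ _)
  rw [card_polyFin] at h1
  exact_mod_cast h1

lemma norm_sum_filter_addChar_le (n : ℕ) (s : k[X] → Prop) :
    ‖∑ f ∈ (degFin k n).filter s, ψ (l f)‖ ≤ (Fintype.card k : ℝ) ^ (n + 1) := by
  refine (norm_sum_le _ _).trans ?_
  simp only [AddChar.norm_apply, Finset.sum_const, nsmul_eq_mul, mul_one]
  refine le_trans ?_ (card_degFin_le n)
  exact_mod_cast Finset.card_le_card (Finset.filter_subset _ _)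

lemma totient_ratio_le (hg : g.Monic) :
    (Fintype.card k : ℝ) ^ g.natDegree / Nat.card (k[X] ⧸ Ideal.span {g})ˣ ≤
      4 * (Fintype.card k : ℝ) ^ 4 * (g.natDegree + 1) := by
  have := finite_quotient hg
  have hφ : (0 : ℝ) < (Nat.card (k[X] ⧸ Ideal.span {g})ˣ : ℕ) := by exact_mod_cast Nat.card_pos
  rw [div_le_iff₀ hφ]
  exact pow_natDegree_le_card_units hg

lemma norm_totient_ratio :
    ‖(Fintype.card k : ℂ) ^ g.natDegree / Nat.card (k[X] ⧸ Ideal.span {g})ˣ‖ =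
      (Fintype.card k : ℝ) ^ g.natDegree / Nat.card (k[X] ⧸ Ideal.span {g})ˣ := by
  simp

variable {y : ℝ}

/-- The weighted sum over irreducibles of one degree, compared with the main term. -/
lemma norm_sum_degFin_le (hy : 1 ≤ y) (hyq : y ^ 4 = Fintype.card k) {N : ℕ} (hg : g.Monic)
    (hgh : g.natDegree ≤ N / 2) (hg0 : ∀ i < N / 2, l (g * X ^ i) = 0) {n : ℕ} (hn : n ≤ N) :
    ‖∑ f ∈ degFin k n, (if Irreducible f then (f.natDegree : ℂ) else 0) * ψ (l f) -
      ((Fintype.card k : ℂ) ^ g.natDegree / Nat.card (k[X] ⧸ Ideal.span {g})ˣ) *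
        ∑ f ∈ (degFin k n).filter (fun f => IsCoprime f g), ψ (l f)‖ ≤
      5 * (Fintype.card k : ℝ) ^ 5 * (N + 1) * y ^ (3 * N) := by
  have h1 : ∑ f ∈ degFin k n, (if Irreducible f then (f.natDegree : ℂ) else 0) * ψ (l f) =
      n * ∑ f ∈ (degFin k n).filter Irreducible, ψ (l f) := by
    rw [Finset.mul_sum, Finset.sum_filter]
    refine Finset.sum_congr rfl fun f hf => ?_
    rw [(mem_degFin.mp hf).2]
    split_ifs <;> simp
  rw [h1]
  have hq : (1 : ℝ) ≤ Fintype.card k := by exact_mod_cast Fintype.card_pos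
  have hN : (0 : ℝ) ≤ N := Nat.cast_nonneg _
  rcases lt_or_ge g.natDegree n with hlt | hle
  · set j := max 1 (n + 1 - g.natDegree - N / 2) with hj
    have hj1 : 0 < j := by omega
    have hj2 : g.natDegree + j ≤ n + 1 := by omega
    have hj3 : n + 1 ≤ g.natDegree + j + N / 2 := by omega
    have hj4 : 2 * (g.natDegree + j) ≤ N + 3 := by omega
    refine (norm_irreducible_sub_coprime_le hg hj1 hlt hj2
      (fun f => (AddChar.norm_apply ψ (l f)).le) fun f hf f' hf' hff' =>
        addChar_eq_of_resMap_eq hg0 hj3 hf hf' hff').trans ?_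
    have hsq : √(Fintype.card k : ℝ) = y ^ 2 := by
      rw [← hyq, show y ^ 4 = (y ^ 2) ^ 2 by ring]
      exact Real.sqrt_sq (by positivity)
    have h2 : (g.natDegree + j + 2 : ℝ) ≤ 4 * (N + 1) := by
      have : g.natDegree + j + 2 ≤ 4 * (N + 1) := by omega
      exact_mod_cast this
    have h3 : (y ^ 2) ^ (g.natDegree + j) ≤ y ^ 4 * y ^ N := by
      rw [← pow_mul, ← pow_add]
      exact pow_le_pow_right₀ hy (by omega)
    have h4 : (y ^ 2) ^ n ≤ y ^ (2 * N) := by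
      rw [← pow_mul]
      exact pow_le_pow_right₀ hy (by omega)
    rw [hsq]
    calc (y ^ 2) ^ (g.natDegree + j) *
          (Fintype.card k * ((g.natDegree + j + 2) * (y ^ 2) ^ n)) ≤
          (y ^ 4 * y ^ N) * (Fintype.card k * ((4 * (N + 1)) * y ^ (2 * N))) := by gcongr
      _ = 4 * (Fintype.card k : ℝ) ^ 2 * (N + 1) * y ^ (3 * N) := by
          rw [hyq]
          ring
      _ ≤ _ := by gcongr <;> norm_num
  · have hqn : (Fintype.card k : ℝ) ^ (n + 1) ≤ Fintype.card k * y ^ (3 * N) := by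
      rw [pow_succ', ← hyq, ← pow_mul]
      exact mul_le_mul_of_nonneg_left (pow_le_pow_right₀ hy (by omega)) (by positivity)
    have hd : (g.natDegree : ℝ) ≤ N := by exact_mod_cast (show g.natDegree ≤ N by omega)
    have hn' : (n : ℝ) ≤ N := by exact_mod_cast hn
    calc _ ≤ (n : ℝ) * (Fintype.card k : ℝ) ^ (n + 1) +
          (4 * (Fintype.card k : ℝ) ^ 4 * (g.natDegree + 1)) *
            (Fintype.card k : ℝ) ^ (n + 1) := by
          refine (norm_sub_le _ _).trans (add_le_add ?_ ?_)
          · rw [norm_mul, Complex.norm_natCast]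
            gcongr
            exact norm_sum_filter_addChar_le n _
          · rw [norm_mul, norm_totient_ratio]
            gcongr
            · exact totient_ratio_le hg
            · exact norm_sum_filter_addChar_le n _
      _ ≤ ((N + 1) * (Fintype.card k : ℝ) ^ 4) * (Fintype.card k * y ^ (3 * N)) +
          (4 * (Fintype.card k : ℝ) ^ 4 * (N + 1)) * (Fintype.card k * y ^ (3 * N)) := by
          gcongr
          calc (n : ℝ) ≤ (N + 1) * 1 := by linarith
            _ ≤ _ := by
              gcongr
              exact one_le_pow₀ hq
      _ = _ := by ring

/-- The weighted sum over irreducibles of bounded degree, compared with the main term. -/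
lemma norm_sum_polyFin_le (hy : 1 ≤ y) (hyq : y ^ 4 = Fintype.card k) {N : ℕ} (hg : g.Monic)
    (hgh : g.natDegree ≤ N / 2) (hg0 : ∀ i < N / 2, l (g * X ^ i) = 0) :
    ‖∑ f ∈ polyFin k (N + 1), (if Irreducible f then (f.natDegree : ℂ) else 0) * ψ (l f) -
      ((Fintype.card k : ℂ) ^ g.natDegree / Nat.card (k[X] ⧸ Ideal.span {g})ˣ) *
        ∑ f ∈ (polyFin k (N + 1)).filter (fun f => IsCoprime f g), ψ (l f)‖ ≤
      10 * (Fintype.card k : ℝ) ^ 5 * (N + 1) ^ 2 * y ^ (3 * N) := by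
  set ρ : ℂ := (Fintype.card k : ℂ) ^ g.natDegree / Nat.card (k[X] ⧸ Ideal.span {g})ˣ with hρ
  set T : ℝ := 5 * (Fintype.card k : ℝ) ^ 5 * (N + 1) * y ^ (3 * N) with hT
  have hq : (1 : ℝ) ≤ Fintype.card k := by exact_mod_cast Fintype.card_pos
  have hρT : ‖ρ‖ ≤ T := by
    rw [hρ, norm_totient_ratio]
    refine (totient_ratio_le hg).trans ?_
    calc 4 * (Fintype.card k : ℝ) ^ 4 * (g.natDegree + 1) =
          4 * (Fintype.card k : ℝ) ^ 4 * (g.natDegree + 1) * 1 := by ring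
      _ ≤ _ := by
        rw [hT]
        have hd : (g.natDegree : ℝ) ≤ N := by exact_mod_cast (show g.natDegree ≤ N by omega)
        gcongr
        · norm_num
        · norm_num
        · exact one_le_pow₀ hy
  have h0 : ‖(if Irreducible (0 : k[X]) then ((0 : k[X]).natDegree : ℂ) else 0) * ψ (l 0) -
      ρ * if IsCoprime (0 : k[X]) g then ψ (l 0) else 0‖ ≤ T := by
    rw [if_neg not_irreducible_zero, zero_mul, zero_sub, norm_neg, norm_mul]
    refine (mul_le_of_le_one_right (norm_nonneg _) ?_).trans hρT
    split_ifs
    · exact (AddChar.norm_apply _ _).le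
    · simp
  rw [Finset.sum_filter, sum_polyFin_eq, sum_polyFin_eq, mul_add, add_sub_add_comm, Finset.mul_sum,
    ← Finset.sum_sub_distrib]
  simp only [← Finset.sum_filter]
  refine (norm_add_le _ _).trans ?_
  calc _ ≤ T + ∑ _n ∈ Finset.range (N + 1), T := by
        refine add_le_add h0 (norm_sum_le_of_le _ fun n hn => ?_)
        exact norm_sum_degFin_le hy hyq hg hgh hg0 (by have := Finset.mem_range.mp hn; omega)
    _ = (N + 2) * T := by
        simp
        ring
    _ ≤ (2 * (N + 1)) * T := by
        gcongr
        linarith [Nat.cast_nonneg (α := ℝ) N]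
    _ = _ := by
        rw [hT]
        ring

/-- The exponential sum of the weighted indicator of the irreducibles is close to that of its
truncated Ramanujan expansion. -/
theorem norm_sum_irreducible_sub_ramanujan_le (hψ : ψ ≠ 1) (l : k[X] →ₗ[k] k) (hy : 1 ≤ y)
    (hyq : y ^ 4 = Fintype.card k) (N : ℕ) :
    ‖∑ f ∈ polyFin k (N + 1), ((if Irreducible f then (f.natDegree : ℂ) else 0) -
      ∑ s ∈ (polyFin k (N / 4 + 1)).filter (fun s => s.Monic ∧ Squarefree s),
        ((-1) ^ (primeDiv s).card / (Nat.card (k[X] ⧸ Ideal.span {s})ˣ : ℂ)) *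
          ∑ b ∈ (polyFin k s.natDegree).filter (fun b => IsCoprime b s),
            ψ (resPoly s (b * f))) * ψ (l f)‖ ≤
      14 * (Fintype.card k : ℝ) ^ 5 * (N + 1) ^ 2 * y ^ (3 * N) := by
  obtain ⟨g, hg, hgh, hg0, hmin⟩ := exists_minimal_annihilator l (N / 2)
  have hR := sum_ramanujan_addChar hψ hg hgh hg0 hmin (M := N + 1) (by omega)
    ((polyFin k (N / 4 + 1)).filter (fun s => s.Monic ∧ Squarefree s)) (fun s hs => by
      obtain ⟨h1, h2, _⟩ := Finset.mem_filter.mp hs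
      have := mem_polyFin_succ.mp h1
      exact ⟨h2, by omega⟩)
    fun s => (-1) ^ (primeDiv s).card / (Nat.card (k[X] ⧸ Ideal.span {s})ˣ : ℂ)
  have hC := sum_coprime_addChar l hψ hg (N + 1) fun D hD hDg => by
    obtain ⟨i, hi, hl⟩ := hmin D hD hDg
    exact ⟨i, by omega, hl⟩
  have hP := norm_sum_polyFin_le (ψ := ψ) hy hyq hg hgh hg0
  simp only [sub_mul, Finset.sum_sub_distrib]
  rw [hR]
  rw [hC] at hP
  have hq : (1 : ℝ) ≤ Fintype.card k := by exact_mod_cast Fintype.card_pos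
  have hN : (0 : ℝ) ≤ N := Nat.cast_nonneg _
  set ρ : ℂ := (Fintype.card k : ℂ) ^ g.natDegree / Nat.card (k[X] ⧸ Ideal.span {g})ˣ with hρ
  set E := ∀ i < N + 1 - g.natDegree, l (g * X ^ i) = 0 with hE
  set A := ∑ f ∈ polyFin k (N + 1), (if Irreducible f then (f.natDegree : ℂ) else 0) * ψ (l f)
    with hA
  set m : ℂ := ρ * ((if Squarefree g then (-1) ^ (primeDiv g).card else 0) *
    if E then (Fintype.card k : ℂ) ^ (N + 1 - g.natDegree) else 0) with hm
  suffices hmain : ‖m - if g ∈ (polyFin k (N / 4 + 1)).filter (fun s => s.Monic ∧ Squarefree s) ∧ E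
      then (-1) ^ (primeDiv g).card / (Nat.card (k[X] ⧸ Ideal.span {g})ˣ : ℂ) *
        (Fintype.card k : ℂ) ^ (N + 1) else 0‖ ≤
      4 * (Fintype.card k : ℝ) ^ 5 * (N + 1) ^ 2 * y ^ (3 * N) by
    rw [← sub_add_sub_cancel A m]
    refine (norm_add_le _ _).trans ((add_le_add hP hmain).trans_eq ?_)
    ring
  have hnn : 0 ≤ 4 * (Fintype.card k : ℝ) ^ 5 * (N + 1) ^ 2 * y ^ (3 * N) := by positivity
  by_cases hs : Squarefree g
  swap
  · have h1 : ¬ (g ∈ (polyFin k (N / 4 + 1)).filter (fun s => s.Monic ∧ Squarefree s) ∧ E) :=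
      fun h => hs (Finset.mem_filter.mp h.1).2.2
    rw [hm, if_neg hs, if_neg h1]
    simpa using hnn
  by_cases hE' : E
  swap
  · have h1 : ¬ (g ∈ (polyFin k (N / 4 + 1)).filter (fun s => s.Monic ∧ Squarefree s) ∧ E) :=
      fun h => hE' h.2
    rw [hm, if_neg hE', if_neg h1]
    simpa using hnn
  rw [hm, if_pos hs, if_pos hE']
  rcases le_or_gt g.natDegree (N / 4) with hd | hd
  · rw [if_pos ⟨Finset.mem_filter.mpr ⟨mem_polyFin_succ.mpr hd, hg, hs⟩, hE'⟩, hρ,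
      show N + 1 = g.natDegree + (N + 1 - g.natDegree) by omega, pow_add]
    refine le_of_eq_of_le ?_ hnn
    rw [show g.natDegree + (N + 1 - g.natDegree) - g.natDegree = N + 1 - g.natDegree by omega,
      norm_eq_zero]
    ring
  · rw [if_neg fun h => absurd (mem_polyFin_succ.mp (Finset.mem_filter.mp h.1).1) (not_le.mpr hd),
      sub_zero, norm_mul, norm_mul, norm_pow, norm_neg, norm_one, one_pow, one_mul, norm_pow,
      Complex.norm_natCast, hρ, norm_totient_ratio]
    have hdN : (g.natDegree : ℝ) ≤ N := by exact_mod_cast (show g.natDegree ≤ N by omega)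
    have h1 : (Fintype.card k : ℝ) ^ (N + 1 - g.natDegree) ≤ Fintype.card k * y ^ (3 * N) := by
      rw [← hyq, ← pow_mul, ← pow_add]
      exact pow_le_pow_right₀ hy (by omega)
    calc _ ≤ (4 * (Fintype.card k : ℝ) ^ 4 * (g.natDegree + 1)) *
          (Fintype.card k * y ^ (3 * N)) := by
          gcongr
          exact totient_ratio_le hg
      _ ≤ (4 * (Fintype.card k : ℝ) ^ 4 * ((N + 1) * (N + 1))) *
          (Fintype.card k * y ^ (3 * N)) := by
          gcongr
          nlinarith
      _ = _ := by ring

end MajorArc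

section Laurent

variable {Fq}

omit [Fintype Fq] in
lemma coeff_algebraMap_mul (a : Fq) (z : LaurentSeries Fq) (m : ℤ) :
    (algebraMap Fq (LaurentSeries Fq) a * z).coeff m = a * z.coeff m := by
  rw [HahnSeries.algebraMap_apply', PowerSeries.algebraMap_apply, HahnSeries.ofPowerSeries_C,
    HahnSeries.C_mul_eq_smul, HahnSeries.coeff_smul]
  rfl

omit [Fintype Fq] in
lemma coeff_toK (f : Fq[X]) (m : ℤ) :
    (toK Fq f).coeff m = if m ≤ 0 then f.coeff (-m).toNat else 0 := by
  induction f using Polynomial.induction_on' with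
  | add f f' hf hf' =>
    rw [toK, map_add, HahnSeries.coeff_add]
    change (toK Fq f).coeff m + (toK Fq f').coeff m = _
    rw [hf, hf', coeff_add]
    split_ifs <;> simp
  | monomial n a =>
    rw [toK, aeval_monomial, Kt, HahnSeries.single_pow, one_pow, coeff_monomial,
      coeff_algebraMap_mul, HahnSeries.coeff_single]
    by_cases hm : m ≤ 0
    · rw [if_pos hm]
      by_cases hn : n = (-m).toNat
      · rw [if_pos (by rw [nsmul_eq_mul]; omega), if_pos hn, mul_one]
      · rw [if_neg (by rw [nsmul_eq_mul]; omega), if_neg hn, mul_zero]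
    · rw [if_neg hm, if_neg (by rw [nsmul_eq_mul]; omega), mul_zero]

omit [Fintype Fq] in
lemma coeff_toK_neg (f : Fq[X]) (n : ℕ) : (toK Fq f).coeff (-n) = f.coeff n := by
  rw [coeff_toK, if_pos (by omega), neg_neg, Int.toNat_natCast]

omit [Fintype Fq] in
lemma toK_ne_zero {f : Fq[X]} (hf : f ≠ 0) : toK Fq f ≠ 0 := fun h =>
  leadingCoeff_ne_zero.mpr hf (by
    rw [← coeff_natDegree, ← coeff_toK_neg, h, HahnSeries.coeff_zero])

omit [Fintype Fq] in
lemma order_toK {f : Fq[X]} (hf : f ≠ 0) : (toK Fq f).order = -(f.natDegree : ℤ) := by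
  refine le_antisymm (HahnSeries.order_le_of_coeff_ne_zero ?_) ?_
  · rw [coeff_toK_neg, coeff_natDegree]
    exact leadingCoeff_ne_zero.mpr hf
  · by_contra! hlt
    have h1 := HahnSeries.coeff_order_eq_zero.not.mpr (toK_ne_zero hf)
    rw [coeff_toK] at h1
    split_ifs at h1 with h2
    · exact h1 (coeff_eq_zero_of_natDegree_lt (by omega))
    · exact h1 rfl

omit [Fintype Fq] in
lemma leadingCoeff_toK {f : Fq[X]} (hf : f ≠ 0) :
    (toK Fq f).leadingCoeff = f.leadingCoeff := by
  rw [HahnSeries.leadingCoeff_eq, order_toK hf, coeff_toK_neg, coeff_natDegree]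

omit [Fintype Fq] in
lemma coeff_one_toK_div {s : Fq[X]} (hs : s.Monic) (f : Fq[X]) :
    (toK Fq f / toK Fq s).coeff 1 = resPoly s f := by
  have hs0 := toK_ne_zero hs.ne_zero
  set r := f %ₘ s with hr
  have h1 : toK Fq f / toK Fq s = toK Fq r / toK Fq s + toK Fq (f /ₘ s) := by
    rw [div_add' _ _ _ hs0]
    congr 1
    conv_lhs => rw [← modByMonic_add_div f s]
    simp only [toK, map_add, map_mul, hr]
    ring
  rw [h1, HahnSeries.coeff_add, coeff_toK (f /ₘ s), if_neg (by norm_num), add_zero,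
    resPoly_apply, ← hr]
  by_cases hr0 : r = 0
  · simp [hr0, toK]
  set z := toK Fq r / toK Fq s with hz
  have hz0 : z ≠ 0 := div_ne_zero (toK_ne_zero hr0) hs0
  have hzs : z * toK Fq s = toK Fq r := div_mul_cancel₀ _ hs0
  have hdeg : r.natDegree < s.natDegree := by
    rw [natDegree_lt_iff_degree_lt hr0, ← degree_eq_natDegree hs.ne_zero]
    exact degree_modByMonic_lt _ hs
  have hord : z.order = s.natDegree - r.natDegree := by
    have h2 := HahnSeries.order_mul hz0 hs0
    rw [hzs, order_toK hr0, order_toK hs.ne_zero] at h2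
    omega
  rcases eq_or_ne (r.natDegree + 1) s.natDegree with h3 | h3
  · have h4 : z.order = 1 := by omega
    have h5 := HahnSeries.leadingCoeff_mul z (toK Fq s)
    rw [hzs, leadingCoeff_toK hr0, leadingCoeff_toK hs.ne_zero, hs.leadingCoeff, mul_one,
      HahnSeries.leadingCoeff_eq, h4] at h5
    rw [← h5, ← h3, Nat.add_sub_cancel, coeff_natDegree]
  · rw [HahnSeries.coeff_eq_zero_of_lt_order (by omega),
      coeff_eq_zero_of_natDegree_lt (by omega)]

/-- The linear functional `f ↦ res (f x)`. -/
def resMulRight (x : LaurentSeries Fq) : Fq[X] →ₗ[Fq] Fq where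
  toFun f := (toK Fq f * x).coeff 1
  map_add' f f' := by simp only [toK, map_add, add_mul, HahnSeries.coeff_add]
  map_smul' a f := by
    rw [smul_eq_C_mul, toK, map_mul, aeval_C, mul_assoc, coeff_algebraMap_mul]
    rfl

end Laurent

/-- The additive character `c ↦ exp(2πi · tr(c)/p)` of the finite field. -/
def traceChar : AddChar Fq ℂ :=
  (ZMod.stdAddChar (N := p)).compAddMonoidHom (Algebra.trace (ZMod p) Fq).toAddMonoidHom

omit [Fintype Fq] in
lemma eC_eq (x : LaurentSeries Fq) : eC p Fq x = traceChar p Fq (x.coeff 1) := by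
  change _ = ZMod.stdAddChar (Algebra.trace (ZMod p) Fq (x.coeff 1))
  rw [ZMod.stdAddChar_apply, ZMod.toCircle_apply]
  rfl

lemma traceChar_ne_one : traceChar p Fq ≠ 1 := by
  obtain ⟨c, hc⟩ := Algebra.trace_surjective (ZMod p) Fq 1
  refine AddChar.ne_one_iff.mpr ⟨c, fun h => ?_⟩
  change ZMod.stdAddChar (Algebra.trace (ZMod p) Fq c) = 1 at h
  rw [hc, ← AddChar.map_zero_eq_one (ZMod.stdAddChar (N := p))] at h
  exact one_ne_zero (ZMod.injective_stdAddChar h)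

lemma ramanujanC_eq {s : Fq[X]} (hs : s.Monic) (f : Fq[X]) :
    ramanujanC p Fq s f = ∑ b ∈ (polyFin Fq s.natDegree).filter (fun b => IsCoprime b s),
      traceChar p Fq (resPoly s (b * f)) := by
  have h : {a : Fq[X] | a.degree < s.degree ∧ IsCoprime a s} =
      ((polyFin Fq s.natDegree).filter (fun b => IsCoprime b s) : Finset Fq[X]) := by
    ext a
    simp [mem_polyFin, degree_eq_natDegree hs.ne_zero]
  rw [ramanujanC, h, finsum_mem_coe_finset]
  exact Finset.sum_congr rfl fun b _ => by rw [eC_eq, coeff_one_toK_div hs]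

lemma muP_eq {s : Fq[X]} (hs : Squarefree s) : muP Fq s = (-1) ^ (primeDiv s).card := by
  have h : {P : Fq[X] | P.Monic ∧ Irreducible P ∧ P ∣ s} = (primeDiv s : Set Fq[X]) := by
    ext P
    simp [mem_primeDiv hs.ne_zero]
  rw [muP, if_pos hs, h, Set.ncard_coe_finset]

lemma LambdaX_eq (N : ℕ) (f : Fq[X]) :
    LambdaX p Fq ((N : ℝ) / 4) f =
      ∑ s ∈ (polyFin Fq (N / 4 + 1)).filter (fun s => s.Monic ∧ Squarefree s),
        ((-1) ^ (primeDiv s).card / (Nat.card (Fq[X] ⧸ Ideal.span {s})ˣ : ℂ)) *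
          ∑ b ∈ (polyFin Fq s.natDegree).filter (fun b => IsCoprime b s),
            traceChar p Fq (resPoly s (b * f)) := by
  have h : {s : Fq[X] | s.Monic ∧ Squarefree s ∧ (s.natDegree : ℝ) ≤ (N : ℝ) / 4} =
      ((polyFin Fq (N / 4 + 1)).filter (fun s => s.Monic ∧ Squarefree s) : Finset Fq[X]) := by
    ext s
    have h1 : (s.natDegree : ℝ) ≤ (N : ℝ) / 4 ↔ s.natDegree ≤ N / 4 := by
      rw [le_div_iff₀ (by norm_num), Nat.le_div_iff_mul_le (by norm_num)]
      exact_mod_cast Iff.rfl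
    rw [Set.mem_ofPred_eq, h1, Finset.mem_coe, Finset.mem_filter, mem_polyFin_succ]
    tauto
  rw [LambdaX, h, finsum_mem_coe_finset]
  refine Finset.sum_congr rfl fun s hs => ?_
  obtain ⟨_, h2, h3⟩ := Finset.mem_filter.mp hs
  rw [muP_eq Fq h3, ramanujanC_eq p Fq h2, phiP]
  push_cast
  rfl

lemma exists_sq_le_rpow {q : ℝ} (hq : 1 < q) {ε : ℝ} (hε : 0 < ε) :
    ∃ K : ℝ, 0 < K ∧ ∀ N : ℕ, ((N : ℝ) + 1) ^ 2 ≤ K * q ^ ((N : ℝ) * ε) := by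
  have hc : 0 < Real.log q * ε := mul_pos (Real.log_pos hq) hε
  set c := Real.log q * ε with hc'
  refine ⟨(1 + 2 / c) ^ 2, by positivity, fun N => ?_⟩
  have h1 := Real.add_one_le_exp (c * N / 2)
  have h2 : q ^ ((N : ℝ) * ε) = Real.exp (c * N / 2) ^ 2 := by
    rw [Real.rpow_def_of_pos (by linarith), ← Real.exp_nat_mul, hc']
    congr 1
    push_cast
    ring
  rw [h2, ← mul_pow]
  have hN : (0 : ℝ) ≤ N := Nat.cast_nonneg N
  refine pow_le_pow_left₀ (by positivity) ?_ 2
  calc (N : ℝ) + 1 ≤ (1 + 2 / c) * (c * N / 2 + 1) := by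
        have : (1 + 2 / c) * (c * N / 2 + 1) = N + 1 + (c * N / 2 + 2 / c) := by
          field_simp
          ring
        rw [this]
        have : 0 ≤ c * N / 2 + 2 / c := by positivity
        linarith
    _ ≤ _ := by gcongr

end FFRH

/-- `Λ'` and `Λ_{N/4}` are uniformly close in the Fourier sense:
`|Σ_{deg f ≤ N} (Λ'(f) − Λ_{N/4}(f))·e(fx)| ≤ C(q,ε)·q^(N(3/4+ε))` uniformly in `x ∈ 𝕋`. -/
theorem Lambda_fourier_close (ε : ℝ) (hε : 0 < ε) :
    ∃ C : ℝ, 0 < C ∧ ∀ N : ℕ, ∀ x : LaurentSeries Fq, Knorm Fq x < 1 →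
      ‖∑ᶠ f ∈ {f : Polynomial Fq | f.degree ≤ (N : ℕ)},
          ((vonMangoldt' Fq f : ℂ) - LambdaX p Fq ((N : ℝ) / 4) f) *
            eC p Fq (toK Fq f * x)‖ ≤
        C * (Fintype.card Fq : ℝ) ^ ((N : ℝ) * (3 / 4 + ε)) := by
  have hq : (1 : ℝ) < Fintype.card Fq := by exact_mod_cast Fintype.one_lt_card
  have hq0 : (0 : ℝ) < Fintype.card Fq := by linarith
  obtain ⟨K, hK, hKN⟩ := FFRH.exists_sq_le_rpow hq hε
  refine ⟨14 * (Fintype.card Fq : ℝ) ^ 5 * K, by positivity, fun N x _ => ?_⟩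
  have hset : {f : Polynomial Fq | f.degree ≤ (N : ℕ)} =
      (FFRH.polyFin Fq (N + 1) : Set (Polynomial Fq)) := by
    ext f
    rw [Set.mem_ofPred_eq, Finset.mem_coe, FFRH.mem_polyFin_succ, natDegree_le_iff_degree_le]
  rw [hset, finsum_mem_coe_finset]
  have hy : 1 ≤ (Fintype.card Fq : ℝ) ^ (1 / 4 : ℝ) := Real.one_le_rpow hq.le (by norm_num)
  have hyq : ((Fintype.card Fq : ℝ) ^ (1 / 4 : ℝ)) ^ 4 = Fintype.card Fq := by
    rw [← Real.rpow_mul_natCast hq0.le]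
    norm_num
  have hmain := FFRH.norm_sum_irreducible_sub_ramanujan_le (FFRH.traceChar_ne_one p Fq)
    (FFRH.resMulRight x) hy hyq N
  calc _ ≤ 14 * (Fintype.card Fq : ℝ) ^ 5 * ((N : ℝ) + 1) ^ 2 *
        ((Fintype.card Fq : ℝ) ^ (1 / 4 : ℝ)) ^ (3 * N) := by
        refine le_of_eq_of_le (congrArg _ (Finset.sum_congr rfl fun f _ => ?_)) hmain
        rw [FFRH.LambdaX_eq, FFRH.eC_eq, vonMangoldt']
        congr 2
        split_ifs <;> simp
    _ ≤ 14 * (Fintype.card Fq : ℝ) ^ 5 * (K * (Fintype.card Fq : ℝ) ^ ((N : ℝ) * ε)) *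
        ((Fintype.card Fq : ℝ) ^ (1 / 4 : ℝ)) ^ (3 * N) := by
        gcongr
        exact hKN N
    _ = _ := by
        have hexp : (N : ℝ) * (3 / 4 + ε) = N * ε + 1 / 4 * (3 * N : ℕ) := by
          push_cast
          ring
        rw [← Real.rpow_mul_natCast hq0.le, hexp, Real.rpow_add hq0]
        ring

end
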